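/- Let r₁ > 0, 0 < r < r₁/4, R > 0, and Q⁺_{r,R} = {(x,y) : 0 < x < r, |y| < R}. Let φ ∈ C²(Q⁺_{r,R}) ∩ C(Q̄⁺_{r,R}) satisfy: φ > 0 in Q⁺_{r,R}; φ = 0 on {x = 0, |y| < R}; 0 ≤ φ(x,y) ≤ (2r₁ − k)x in Q⁺_{r,R} for some k > 0; inf over Q⁺_{r,R} ∩ {x > r/2} of φ is positive; and φ solves the degenerate elliptic equation (2r₁x − φ + O₁)φ_{xx} + (1 + O₂)φ_{yy} + (r₁ + O₃)φ_x − (1 + O₄)(φ_x)² = 0 in Q⁺_{r,R}, where O₁ = −x², O₂ = (x(2r₁ − x) − φ)/(r₁ − x)², O₃ = (2x² − 3r₁x + φ)/(r₁ − x), O₄ = (x² − 2r₁x + φ)/(r₁² − φ). Then for every α ∈ (0,1), φ ∈ C^{1,α}(Q̄⁺_{r/2,R/2}), and for every |y| < R/2 one has φ_x(0, y) = r₁ and φ_y(0, y) = 0. -/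

import Mathlib

open Real Set

/-- Partial derivative in the first (x) variable. -/
noncomputable def pdx (f : ℝ × ℝ → ℝ) (z : ℝ × ℝ) : ℝ := fderiv ℝ f z (1, 0)

/-- Partial derivative in the second (y) variable. -/
noncomputable def pdy (f : ℝ × ℝ → ℝ) (z : ℝ × ℝ) : ℝ := fderiv ℝ f z (0, 1)

section
open Real Set MeasureTheory
namespace S15

/-- profile -/
noncomputable def Hk (w : ℝ × ℝ) : ℝ := expNegInvGlue (1 - (w.1 ^ 2 + w.2 ^ 2))

noncomputable def etak (w : ℝ × ℝ) : ℝ := 2 * deriv expNegInvGlue (1 - (w.1 ^ 2 + w.2 ^ 2))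

lemma Hk_contDiff {n : ℕ∞} : ContDiff ℝ n Hk := by
  unfold Hk
  exact expNegInvGlue.contDiff.comp (by fun_prop)

lemma etak_contDiff {n : ℕ∞} : ContDiff ℝ n etak := by
  unfold etak
  have h : ContDiff ℝ n (deriv expNegInvGlue) := by
    have := (expNegInvGlue.contDiff (n := n + 1))
    rw [show ((n + 1 : ℕ∞) : WithTop ℕ∞) = (n : WithTop ℕ∞) + 1 by rfl] at this
    exact this.deriv'
  exact contDiff_const.mul (h.comp (by fun_prop))

lemma hasFDerivAt_Hk (w : ℝ × ℝ) (a : ℝ × ℝ) :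
    fderiv ℝ Hk w a = - (w.1 * a.1 + w.2 * a.2) * etak w := by
  have h1 : HasFDerivAt (fun w : ℝ × ℝ => 1 - (w.1 ^ 2 + w.2 ^ 2))
      (-((2 * w.1) • ContinuousLinearMap.fst ℝ ℝ ℝ + (2 * w.2) • ContinuousLinearMap.snd ℝ ℝ ℝ)) w := by
    have h1 : HasFDerivAt (fun w : ℝ × ℝ => w.1) (ContinuousLinearMap.fst ℝ ℝ ℝ) w := hasFDerivAt_fst
    have h2 : HasFDerivAt (fun w : ℝ × ℝ => w.2) (ContinuousLinearMap.snd ℝ ℝ ℝ) w := hasFDerivAt_snd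
    have := ((h1.pow 2).add (h2.pow 2)).const_sub 1
    refine HasFDerivAt.congr_fderiv this ?_
    ext <;> simp
  have h2 : DifferentiableAt ℝ expNegInvGlue (1 - (w.1 ^ 2 + w.2 ^ 2)) :=
    (expNegInvGlue.contDiff (n := 1)).differentiable (by simp) _
  have h3 := h2.hasDerivAt.comp_hasFDerivAt w h1
  have : fderiv ℝ Hk w = _ := h3.fderiv
  rw [this]
  simp [etak]
  ring

lemma sq_ge_of_norm {w : ℝ × ℝ} (hw : 1 ≤ ‖w‖) : 1 ≤ w.1 ^ 2 + w.2 ^ 2 := by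
  rw [Prod.norm_def] at hw
  rcases le_max_iff.1 hw with h | h
  · rw [Real.norm_eq_abs] at h
    have := sq_abs w.1
    nlinarith [sq_nonneg w.2]
  · rw [Real.norm_eq_abs] at h
    have := sq_abs w.2
    nlinarith [sq_nonneg w.1]

lemma Hk_zero {w : ℝ × ℝ} (hw : 1 ≤ ‖w‖) : Hk w = 0 := by
  unfold Hk
  exact expNegInvGlue.zero_of_nonpos (by linarith [sq_ge_of_norm hw])

lemma deriv_glue_zero {s : ℝ} (hs : s ≤ 0) : deriv expNegInvGlue s = 0 := by
  -- minimum
  apply IsLocalMin.deriv_eq_zero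
  filter_upwards with t
  rw [expNegInvGlue.zero_of_nonpos hs]
  exact expNegInvGlue.nonneg t

lemma etak_zero {w : ℝ × ℝ} (hw : 1 ≤ ‖w‖) : etak w = 0 := by
  unfold etak
  rw [deriv_glue_zero (by linarith [sq_ge_of_norm hw])]; simp

/-- kernel class: smooth, supported in the closed unit (sup) ball -/
structure Ker (k : ℝ × ℝ → ℝ) : Prop where
  smooth : ContDiff ℝ 2 k
  supp : ∀ w, 1 ≤ ‖w‖ → k w = 0

lemma Ker.compact {k : ℝ × ℝ → ℝ} (hk : Ker k) : HasCompactSupport k := by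
  apply HasCompactSupport.intro (isCompact_closedBall (0 : ℝ × ℝ) 1)
  intro x hx
  apply hk.supp
  simp at hx
  exact hx.le

lemma etak_ker : Ker etak := ⟨etak_contDiff (n := 2), fun _ h => etak_zero h⟩
lemma Hk_ker : Ker Hk := ⟨Hk_contDiff (n := 2), fun _ h => Hk_zero h⟩

lemma pdx_Hk : pdx Hk = fun w => - w.1 * etak w := by
  funext w; unfold pdx; rw [hasFDerivAt_Hk]; simp

lemma pdy_Hk : pdy Hk = fun w => - w.2 * etak w := by
  funext w; unfold pdy; rw [hasFDerivAt_Hk]; simp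

lemma pdx_contDiff {f : ℝ × ℝ → ℝ} {n : ℕ∞} (hf : ContDiff ℝ (n + 1) f) : ContDiff ℝ n (pdx f) := by
  unfold pdx
  exact (hf.fderiv_right le_rfl).clm_apply contDiff_const

lemma pdy_contDiff {f : ℝ × ℝ → ℝ} {n : ℕ∞} (hf : ContDiff ℝ (n + 1) f) : ContDiff ℝ n (pdy f) := by
  unfold pdy
  exact (hf.fderiv_right le_rfl).clm_apply contDiff_const

lemma pdxHk_ker : Ker (pdx Hk) := by
  rw [pdx_Hk]
  exact ⟨(contDiff_fst.neg).mul (etak_contDiff (n := 2)), fun w h => by simp [etak_zero h]⟩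

lemma pdyHk_ker : Ker (pdy Hk) := by
  rw [pdy_Hk]
  exact ⟨(contDiff_snd.neg).mul (etak_contDiff (n := 2)), fun w h => by simp [etak_zero h]⟩

lemma pdx_etak (w : ℝ × ℝ) (hw : 1 ≤ ‖w‖) : pdx etak w = 0 := by
  -- nonneg with zero value is a local min
  have : IsLocalMin etak w := by
    filter_upwards with t
    rw [etak_zero hw]
    unfold etak
    have : 0 ≤ deriv expNegInvGlue (1 - (t.1 ^ 2 + t.2 ^ 2)) := expNegInvGlue.monotone.deriv_nonneg
    linarith
  unfold pdx
  rw [this.fderiv_eq_zero]; simp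

lemma pdxxHk_ker : Ker (pdx (pdx Hk)) := by
  refine ⟨?_, ?_⟩
  · exact pdx_contDiff (n := 2) (pdx_contDiff (n := 3) (Hk_contDiff (n := 4)))
  · intro w hw
    rw [pdx_Hk]
    unfold pdx
    have h1 : DifferentiableAt ℝ (fun w : ℝ × ℝ => - w.1) w := by fun_prop
    have h2 : DifferentiableAt ℝ etak w := (etak_contDiff (n := 1)).differentiable (by simp) w
    have h3 : fderiv ℝ etak w (1, 0) = 0 := pdx_etak w hw
    have : fderiv ℝ (fun w : ℝ × ℝ => - w.1 * etak w) w = _ := fderiv_mul h1 h2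
    rw [this]
    simp [etak_zero hw, h3]

lemma etak_integral_pos : 0 < ∫ w, etak w := by
  have hnn : ∀ w, 0 ≤ etak w := fun t => by
    unfold etak
    have : 0 ≤ deriv expNegInvGlue (1 - (t.1 ^ 2 + t.2 ^ 2)) := expNegInvGlue.monotone.deriv_nonneg
    linarith
  have hne : ∃ s ∈ Ioo (0:ℝ) 1, deriv expNegInvGlue s ≠ 0 := by
    obtain ⟨s, hs, h⟩ := exists_deriv_eq_slope expNegInvGlue (a := 0) (b := 1) (by norm_num)
      (expNegInvGlue.contDiff (n := 1)).continuous.continuousOn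
      ((expNegInvGlue.contDiff (n := 1)).differentiable (by simp)).differentiableOn
    refine ⟨s, hs, ?_⟩
    rw [h]
    have := expNegInvGlue.pos_of_pos (x := 1) (by norm_num)
    simp
  obtain ⟨s, hs, h⟩ := hne
  have hx : etak (Real.sqrt (1 - s), 0) ≠ 0 := by
    unfold etak
    simp only
    rw [Real.sq_sqrt (by linarith [hs.2])]
    simp
    exact h
  exact (etak_contDiff (n := 0)).continuous.integral_pos_of_hasCompactSupport_nonneg_nonzero
    etak_ker.compact hnn hx

end S15
end

section
open Real Set MeasureTheory
namespace S15

noncomputable def II (f k : ℝ × ℝ → ℝ) (z : ℝ × ℝ) (ρ : ℝ) : ℝ := ∫ w, f (z + ρ • w) * k w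

lemma integrable_ker {f k : ℝ × ℝ → ℝ} (hf : Continuous f) (hk : Ker k) :
    Integrable (fun w => f w * k w) := by
  apply Continuous.integrable_of_hasCompactSupport
  · exact hf.mul hk.smooth.continuous
  · exact hk.compact.mul_left

lemma integrable_ker' {f k : ℝ × ℝ → ℝ} (hf : Continuous f) (hk : Ker k) (z : ℝ × ℝ) (ρ : ℝ) :
    Integrable (fun w => f (z + ρ • w) * k w) :=
  integrable_ker (f := fun w => f (z + ρ • w)) (hf.comp (by fun_prop)) hk

lemma Ker.integrable {k : ℝ × ℝ → ℝ} (hk : Ker k) : Integrable k :=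
  hk.smooth.continuous.integrable_of_hasCompactSupport hk.compact

lemma hasDerivAt_line {f : ℝ × ℝ → ℝ} (hf : ContDiff ℝ 1 f) (z w : ℝ × ℝ) (ρ : ℝ) :
    HasDerivAt (fun ρ : ℝ => f (z + ρ • w)) (fderiv ℝ f (z + ρ • w) w) ρ := by
  have h1 : HasDerivAt (fun ρ : ℝ => z + ρ • w) w ρ := by
    have := ((hasDerivAt_id ρ).smul_const w).const_add z
    simpa using this
  exact (hf.differentiable (by simp) (z + ρ • w)).hasFDerivAt.comp_hasDerivAt ρ h1

lemma hasDerivAt_II {f k : ℝ × ℝ → ℝ} (hf : ContDiff ℝ 1 f) (hk : Ker k) (z : ℝ × ℝ) (ρ : ℝ) :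
    HasDerivAt (II f k z) (∫ w, fderiv ℝ f (z + ρ • w) w * k w) ρ := by
  have hcd : Continuous (fderiv ℝ f) := hf.continuous_fderiv (by simp)
  have hcomp : IsCompact ((fun p : ℝ × (ℝ × ℝ) => z + p.1 • p.2) ''
      (Icc (ρ - 1) (ρ + 1) ×ˢ Metric.closedBall (0 : ℝ × ℝ) 1)) :=
    (isCompact_Icc.prod (isCompact_closedBall _ _)).image (by fun_prop)
  obtain ⟨A, hA⟩ := hcomp.exists_bound_of_continuousOn (f := fderiv ℝ f) hcd.continuousOn
  have hAnn : 0 ≤ A := by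
    refine (norm_nonneg _).trans (hA (z + ρ • (0 : ℝ × ℝ)) ⟨(ρ, 0), ⟨?_, ?_⟩, rfl⟩)
    · simp
    · simp
  have := hasDerivAt_integral_of_dominated_loc_of_deriv_le (μ := (volume : Measure (ℝ × ℝ)))
    (F := fun ρ w => f (z + ρ • w) * k w) (F' := fun ρ w => fderiv ℝ f (z + ρ • w) w * k w)
    (x₀ := ρ) (s := Ioo (ρ - 1) (ρ + 1)) (bound := fun w => A * ‖k w‖)
    (Ioo_mem_nhds (by linarith) (by linarith)) ?_ ?_ ?_ ?_ ?_ ?_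
  · exact this.2
  · filter_upwards with x
    exact (integrable_ker' hf.continuous hk z x).aestronglyMeasurable
  · exact integrable_ker' hf.continuous hk z ρ
  · apply Continuous.aestronglyMeasurable
    have := hk.smooth.continuous
    have h2 : Continuous (fun w : ℝ × ℝ => fderiv ℝ f (z + ρ • w) w) :=
      (hcd.comp (by fun_prop)).clm_apply continuous_id
    exact h2.mul this
  · filter_upwards with w x hx
    by_cases hw : 1 ≤ ‖w‖
    · simp [hk.supp w hw]
    · push Not at hw
      rw [norm_mul]
      gcongr
      have h1 : ‖fderiv ℝ f (z + x • w)‖ ≤ A := hA _ ⟨(x, w), ⟨⟨hx.1.le, hx.2.le⟩, by simpa using hw.le⟩, rfl⟩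
      calc _ ≤ ‖fderiv ℝ f (z + x • w)‖ * ‖w‖ := ContinuousLinearMap.le_opNorm _ _
        _ ≤ A * 1 := by gcongr
        _ = A := mul_one _
  · exact hk.integrable.norm.const_mul A
  · filter_upwards with w x hx
    exact (hasDerivAt_line hf z w x).mul_const _

lemma fderiv_scale {f : ℝ × ℝ → ℝ} (hf : ContDiff ℝ 1 f) (z w e : ℝ × ℝ) (ρ : ℝ) :
    fderiv ℝ (fun w => f (z + ρ • w)) w e = ρ * fderiv ℝ f (z + ρ • w) e := by
  have h1 : HasFDerivAt (fun w : ℝ × ℝ => z + ρ • w) (ρ • ContinuousLinearMap.id ℝ (ℝ × ℝ)) w :=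
    ((hasFDerivAt_id w).const_smul ρ).const_add z
  have h2 := (hf.differentiable (by simp) (z + ρ • w)).hasFDerivAt.comp w h1
  have : fderiv ℝ (fun w => f (z + ρ • w)) w = _ := h2.fderiv
  rw [this]
  simp

lemma ibp {f k : ℝ × ℝ → ℝ} (hf : ContDiff ℝ 1 f) (hk : Ker k) (z e : ℝ × ℝ) (ρ : ℝ) :
    ∫ w, f (z + ρ • w) * fderiv ℝ k w e = - (ρ * ∫ w, fderiv ℝ f (z + ρ • w) e * k w) := by
  have hcd : Continuous (fderiv ℝ f) := hf.continuous_fderiv (by simp)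
  have hkd : Continuous (fderiv ℝ k) := hk.smooth.continuous_fderiv (by simp)
  have hfs : ContDiff ℝ 1 (fun w : ℝ × ℝ => f (z + ρ • w)) := hf.comp (by fun_prop)
  have h := integral_mul_fderiv_eq_neg_fderiv_mul_of_integrable (μ := (volume : Measure (ℝ × ℝ)))
    (f := fun w => f (z + ρ • w)) (g := k) (v := e) ?_ ?_ ?_ ?_ ?_
  · rw [h, ← integral_const_mul]
    congr 1
    apply integral_congr_ae
    filter_upwards with w
    rw [fderiv_scale hf]; ring
  · apply integrable_ker _ hk
    exact (hfs.continuous_fderiv (by simp)).clm_apply continuous_const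
  · apply Continuous.integrable_of_hasCompactSupport
    · exact hfs.continuous.mul (hkd.clm_apply continuous_const)
    · exact (hk.compact.fderiv_apply (𝕜 := ℝ) e).mul_left
  · exact integrable_ker' hf.continuous hk z ρ
  · exact fun x _ => hfs.differentiable (by simp) x
  · exact fun x _ => hk.smooth.differentiable (by simp) x

lemma fderiv_eq_pd {f : ℝ × ℝ → ℝ} (z w : ℝ × ℝ) :
    fderiv ℝ f z w = w.1 * pdx f z + w.2 * pdy f z := by
  have : w = w.1 • ((1 : ℝ), (0 : ℝ)) + w.2 • ((0 : ℝ), (1 : ℝ)) := by ext <;> simp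
  conv_lhs => rw [this]
  rw [map_add, map_smul, map_smul]
  simp [pdx, pdy]

lemma deriv_main {v G G1 G0 : ℝ × ℝ → ℝ} (hv : ContDiff ℝ 2 v) (hG : ContDiff ℝ 2 G)
    (hG1 : ContDiff ℝ 1 G1) (hG0 : Continuous G0)
    (heq : ∀ z, pdx (pdx v) z + pdy (pdy v) z = pdx (pdx G) z + pdx G1 z + G0 z)
    (z : ℝ × ℝ) {ρ : ℝ} (hρ : 0 < ρ) :
    HasDerivAt (II v etak z)
      (ρ⁻¹ * II G (pdx (pdx Hk)) z ρ - II G1 (pdx Hk) z ρ + ρ * II G0 Hk z ρ) ρ := by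
  have hv1 : ContDiff ℝ 1 v := hv.of_le (by norm_num)
  have hG1' : ContDiff ℝ 1 G := hG.of_le (by norm_num)
  have hvx : ContDiff ℝ 1 (pdx v) := pdx_contDiff (n := 1) hv
  have hvy : ContDiff ℝ 1 (pdy v) := pdy_contDiff (n := 1) hv
  have hGx : ContDiff ℝ 1 (pdx G) := pdx_contDiff (n := 1) hG
  have hvxx : Continuous (pdx (pdx v)) := (pdx_contDiff (n := 0) hvx).continuous
  have hvyy : Continuous (pdy (pdy v)) := (pdy_contDiff (n := 0) hvy).continuous
  have hGxx : Continuous (pdx (pdx G)) := (pdx_contDiff (n := 0) hGx).continuous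
  have hG1x : Continuous (pdx G1) := (pdx_contDiff (n := 0) hG1).continuous
  convert hasDerivAt_II hv1 etak_ker z ρ using 1
  have e1 : ∀ w, fderiv ℝ v (z + ρ • w) w * etak w
      = -(pdx v (z + ρ • w) * fderiv ℝ Hk w (1,0)) - (pdy v (z + ρ • w) * fderiv ℝ Hk w (0,1)) := by
    intro w
    rw [fderiv_eq_pd, hasFDerivAt_Hk, hasFDerivAt_Hk]; simp; ring
  simp_rw [e1]
  have i1 : Integrable (fun w => pdx v (z + ρ • w) * fderiv ℝ Hk w (1,0)) :=
    integrable_ker' hvx.continuous pdxHk_ker z ρ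
  have i2 : Integrable (fun w => pdy v (z + ρ • w) * fderiv ℝ Hk w (0,1)) :=
    integrable_ker' hvy.continuous pdyHk_ker z ρ
  have e0 := integral_sub i1.neg i2
  simp only [Pi.neg_apply] at e0
  rw [e0, integral_neg, ibp hvx Hk_ker, ibp hvy Hk_ker]
  have e2 := ibp hG1 Hk_ker z (1,0) ρ
  have e3 := ibp hGx Hk_ker z (1,0) ρ
  have e4 := ibp hG1' pdxHk_ker z (1,0) ρ
  change II G (pdx (pdx Hk)) z ρ = -(ρ * ∫ w, pdx G (z + ρ • w) * fderiv ℝ Hk w (1,0)) at e4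
  rw [e3] at e4
  change II G1 (pdx Hk) z ρ = _ at e2
  rw [e4, e2]
  have e5 : (∫ w, pdx (pdx v) (z + ρ • w) * Hk w) + (∫ w, pdy (pdy v) (z + ρ • w) * Hk w)
      = (∫ w, pdx (pdx G) (z + ρ • w) * Hk w) + (∫ w, pdx G1 (z + ρ • w) * Hk w) + II G0 Hk z ρ := by
    unfold II
    have e6 := integral_add ((integrable_ker' hGxx Hk_ker z ρ).add (integrable_ker' hG1x Hk_ker z ρ)) (integrable_ker' hG0 Hk_ker z ρ)
    simp only [Pi.add_apply] at e6
    rw [← integral_add (integrable_ker' hvxx Hk_ker z ρ) (integrable_ker' hvyy Hk_ker z ρ),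
      ← integral_add (integrable_ker' hGxx Hk_ker z ρ) (integrable_ker' hG1x Hk_ker z ρ),
      ← e6]
    congr 1; funext w
    have := heq (z + ρ • w)
    rw [← add_mul, this]; ring
  change _ = - -(ρ * ∫ w, pdx (pdx v) (z + ρ • w) * Hk w) - -(ρ * ∫ w, pdy (pdy v) (z + ρ • w) * Hk w)
  have hρ' := hρ.ne'
  change ρ⁻¹ * -(ρ * -(ρ * ∫ w, pdx (pdx G) (z + ρ • w) * Hk w)) - -(ρ * ∫ w, pdx G1 (z + ρ • w) * Hk w) + ρ * II G0 Hk z ρ = _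
  field_simp
  linear_combination (-1) * e5

/-- Taylor bound -/
lemma taylor_bound {f : ℝ × ℝ → ℝ} (hf : ContDiff ℝ 2 f) (hc : HasCompactSupport f) :
    ∃ K : ℝ, 0 ≤ K ∧ ∀ z h, |f (z + h) - f z - fderiv ℝ f z h| ≤ K * ‖h‖ ^ 2 := by
  obtain ⟨C, hC⟩ := ContDiff.lipschitzWith_of_hasCompactSupport (hc.fderiv (𝕜 := ℝ))
    (hf.fderiv_right (m := 1) (by norm_num)) (by simp)
  refine ⟨C, C.2, fun z h => ?_⟩
  have := Convex.norm_image_sub_le_of_norm_fderiv_le' (𝕜 := ℝ) (f := f) (φ := fderiv ℝ f z)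
    (s := Metric.closedBall z ‖h‖) (C := C * ‖h‖) (x := z) (y := z + h)
    (fun x _ => hf.differentiable (by simp) x) ?_ (convex_closedBall _ _) (by simp) (by simp)
  · rw [Real.norm_eq_abs] at this
    simp only [add_sub_cancel_left] at this
    calc _ ≤ _ := this
      _ = _ := by ring
  · intro x hx
    rw [← dist_eq_norm]
    refine (hC.dist_le_mul x z).trans ?_
    have : dist x z ≤ ‖h‖ := hx
    gcongr

lemma Ker.diff2 {k : ℝ × ℝ → ℝ} (hk : Ker k) :
    ∃ B : ℝ, 0 ≤ B ∧ ∀ w a, |k (w - a) + k (w + a) - 2 * k w| ≤ B * ‖a‖ ^ 2 := by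
  obtain ⟨K, hK, h⟩ := taylor_bound hk.smooth hk.compact
  refine ⟨2 * K, by positivity, fun w a => ?_⟩
  have h1 := h w a
  have h2 := h w (-a)
  rw [map_neg, norm_neg, ← sub_eq_add_neg] at h2
  rw [abs_le] at *
  constructor <;> linarith [h1.1, h1.2, h2.1, h2.2]

end S15
end

section
open Real Set MeasureTheory
namespace S15

/-- bounded continuous kernel supported in the ball of radius two -/
structure MK (m : ℝ × ℝ → ℝ) (b : ℝ) : Prop where
  cont : Continuous m
  supp : ∀ w, 2 ≤ ‖w‖ → m w = 0
  bd : ∀ w, |m w| ≤ b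

noncomputable def VV : ℝ := (volume : Measure (ℝ × ℝ)).real (Metric.closedBall (0 : ℝ × ℝ) 2)

lemma VV_nonneg : 0 ≤ VV := measureReal_nonneg

lemma MK.compact {m : ℝ × ℝ → ℝ} {b : ℝ} (hm : MK m b) : HasCompactSupport m := by
  apply HasCompactSupport.intro (isCompact_closedBall (0 : ℝ × ℝ) 2)
  intro x hx
  apply hm.supp
  simp at hx
  exact hx.le

lemma MK.integrable {m : ℝ × ℝ → ℝ} {b : ℝ} (hm : MK m b) : Integrable m :=
  hm.cont.integrable_of_hasCompactSupport hm.compact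

lemma MK.integrable_mul {f m : ℝ × ℝ → ℝ} {b : ℝ} (hm : MK m b) (hf : Continuous f) :
    Integrable (fun w => f w * m w) :=
  (hf.mul hm.cont).integrable_of_hasCompactSupport hm.compact.mul_left

lemma MK.bound {m g : ℝ × ℝ → ℝ} {b A : ℝ} (hm : MK m b)
    (hg : ∀ w, ‖w‖ ≤ 2 → |g w| ≤ A) : |∫ w, g w * m w| ≤ VV * b * A := by
  have hb : 0 ≤ b := (abs_nonneg _).trans (hm.bd 0)
  have h1 : ∫ w, g w * m w = ∫ w in Metric.closedBall (0 : ℝ × ℝ) 2, g w * m w := by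
    symm
    apply setIntegral_eq_integral_of_forall_compl_eq_zero
    intro w hw
    simp at hw
    simp [hm.supp w hw.le]
  rw [h1]
  have := norm_setIntegral_le_of_norm_le_const (μ := (volume : Measure (ℝ × ℝ)))
    (s := Metric.closedBall (0 : ℝ × ℝ) 2) (f := fun w => g w * m w) (C := A * b)
    (measure_closedBall_lt_top) ?_
  · rw [Real.norm_eq_abs] at this
    refine this.trans (le_of_eq ?_)
    unfold VV; ring
  · intro w hw
    rw [norm_mul]
    simp at hw
    have h2 := hg w (by simpa using hw)
    have h0 : 0 ≤ A := (abs_nonneg _).trans h2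
    exact mul_le_mul h2 (hm.bd w) (abs_nonneg _) h0

lemma MK.b0 {m f : ℝ × ℝ → ℝ} {b A : ℝ} (hm : MK m b) (z : ℝ × ℝ) (ρ : ℝ)
    (hg : ∀ w, ‖w‖ ≤ 2 → |f (z + ρ • w)| ≤ A) : |II f m z ρ| ≤ VV * b * A :=
  hm.bound hg

lemma MK.b1 {m f : ℝ × ℝ → ℝ} {b A : ℝ} (hm : MK m b) (hf : Continuous f) (h0 : ∫ w, m w = 0)
    (z : ℝ × ℝ) (ρ : ℝ)
    (hg : ∀ w, ‖w‖ ≤ 2 → |f (z + ρ • w) - f z| ≤ A) : |II f m z ρ| ≤ VV * b * A := by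
  have := hm.bound (g := fun w => f (z + ρ • w) - f z) hg
  have e : ∫ w, (f (z + ρ • w) - f z) * m w = II f m z ρ := by
    simp_rw [sub_mul]
    rw [integral_sub (hm.integrable_mul (f := fun w => f (z + ρ • w)) (hf.comp (by fun_prop)))
      (hm.integrable.const_mul _), integral_const_mul, h0]
    simp [II]
  rwa [e] at this

lemma MK.b2 {m f : ℝ × ℝ → ℝ} {b A : ℝ} (hm : MK m b) (hf : Continuous f) (h0 : ∫ w, m w = 0)
    (he : ∀ w, m (-w) = m w) (z : ℝ × ℝ) (ρ : ℝ)
    (hg : ∀ w, ‖w‖ ≤ 2 → |f (z + ρ • w) + f (z - ρ • w) - 2 * f z| ≤ A) :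
    |II f m z ρ| ≤ VV * b * A := by
  have hb : 0 ≤ b := (abs_nonneg _).trans (hm.bd 0)
  have := hm.bound (g := fun w => f (z + ρ • w) + f (z - ρ • w) - 2 * f z) hg
  have e1 : ∫ w, f (z - ρ • w) * m w = II f m z ρ := by
    unfold II
    rw [← integral_neg_eq_self]
    congr 1; funext w
    rw [he]; simp
  have e : ∫ w, (f (z + ρ • w) + f (z - ρ • w) - 2 * f z) * m w = 2 * II f m z ρ := by
    have i1 := hm.integrable_mul (f := fun w => f (z + ρ • w)) (hf.comp (by fun_prop))
    have i2 := hm.integrable_mul (f := fun w => f (z - ρ • w)) (hf.comp (by fun_prop))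
    have i3 := (hm.integrable.const_mul (2 * f z))
    have e3 := integral_sub (i1.add i2) i3
    simp only [Pi.add_apply] at e3
    simp_rw [sub_mul, add_mul]
    rw [e3, integral_add i1 i2, integral_const_mul, h0, e1]
    change II f m z ρ + _ - _ = _
    ring
  rw [e, abs_mul] at this
  have h2 : |(2:ℝ)| = 2 := by norm_num
  rw [h2] at this
  linarith [abs_nonneg (II f m z ρ)]

/-- the second-difference kernel -/
def LL2 (k : ℝ × ℝ → ℝ) (a w : ℝ × ℝ) : ℝ := k (w - a) + k (w + a) - 2 * k w

lemma Ker.toMK {k : ℝ × ℝ → ℝ} (hk : Ker k) : ∃ b : ℝ, 0 ≤ b ∧ MK k b ∧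
    ∀ a : ℝ × ℝ, ‖a‖ ≤ 1 → MK (LL2 k a) (b * ‖a‖ ^ 2) := by
  obtain ⟨B, hB, h⟩ := hk.diff2
  obtain ⟨M, hM⟩ := hk.compact.exists_bound_of_continuous hk.smooth.continuous
  have hM0 : 0 ≤ M := (norm_nonneg _).trans (hM 0)
  refine ⟨B + M, by positivity, ⟨hk.smooth.continuous, fun w hw => hk.supp w (by linarith), fun w => ?_⟩, ?_⟩
  · exact (hM w).trans (by linarith)
  · intro a ha
    refine ⟨?_, ?_, ?_⟩
    · have := hk.smooth.continuous
      unfold LL2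
      fun_prop
    · intro w hw
      unfold LL2
      have h1 := norm_sub_norm_le w a
      have h2 := norm_sub_norm_le w (-a)
      rw [norm_neg, sub_neg_eq_add] at h2
      rw [hk.supp w (by linarith), hk.supp (w - a) (by linarith), hk.supp (w + a) (by linarith)]
      ring
    · intro w
      refine (h w a).trans ?_
      gcongr
      linarith

lemma LL2_int {k : ℝ × ℝ → ℝ} (hk : Ker k) (a : ℝ × ℝ) : ∫ w, LL2 k a w = 0 := by
  unfold LL2
  have i1 : Integrable (fun w => k (w - a)) := hk.integrable.comp_sub_right a
  have i2 : Integrable (fun w => k (w + a)) := hk.integrable.comp_add_right a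
  have e3 := integral_sub (i1.add i2) (hk.integrable.const_mul 2)
  simp only [Pi.add_apply] at e3
  rw [e3, integral_add i1 i2, integral_const_mul, integral_sub_right_eq_self k, integral_add_right_eq_self k]
  ring

lemma LL2_even {k : ℝ × ℝ → ℝ} (he : ∀ w, k (-w) = k w) (a w : ℝ × ℝ) :
    LL2 k a (-w) = LL2 k a w := by
  unfold LL2
  rw [he w, ← he (-w - a), ← he (-w + a)]
  simp only [neg_sub, neg_add_rev, neg_neg, sub_neg_eq_add]
  rw [add_comm a w, show -a + w = w - a by abel]; ring

lemma II_diff {f k : ℝ × ℝ → ℝ} (hf : Continuous f) (hk : Ker k) (z h : ℝ × ℝ) {ρ : ℝ} (hρ : 0 < ρ) :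
    II f k (z + h) ρ + II f k (z - h) ρ - 2 * II f k z ρ = II f (LL2 k (ρ⁻¹ • h)) z ρ := by
  set a := ρ⁻¹ • h with ha
  have hh : h = ρ • a := by rw [ha, smul_smul, mul_inv_cancel₀ hρ.ne', one_smul]
  have e1 : ∀ b : ℝ × ℝ, II f k (z + ρ • b) ρ = ∫ w, f (z + ρ • w) * k (w - b) := by
    intro b
    rw [← integral_add_right_eq_self (fun w => f (z + ρ • w) * k (w - b)) b]
    unfold II
    congr 1; funext w
    simp only [add_sub_cancel_right, smul_add]
    congr 2; abel
  have e2 : II f k (z + h) ρ = ∫ w, f (z + ρ • w) * k (w - a) := by rw [hh, e1]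
  have e3 : II f k (z - h) ρ = ∫ w, f (z + ρ • w) * k (w + a) := by
    have := e1 (-a)
    rw [smul_neg, ← hh, ← sub_eq_add_neg] at this
    rw [this]
    simp_rw [sub_neg_eq_add]
  have hfc : Continuous (fun w : ℝ × ℝ => f (z + ρ • w)) := hf.comp (by fun_prop)
  have hkc := hk.smooth.continuous
  have i1 : Integrable (fun w => f (z + ρ • w) * k (w - a)) := by
    apply (hfc.mul (by fun_prop)).integrable_of_hasCompactSupport
    have : HasCompactSupport (fun w => k (w - a)) := by
      have := hk.compact.comp_homeomorph (Homeomorph.addRight (-a))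
      simpa [sub_eq_add_neg, Function.comp_def] using this
    exact this.mul_left
  have i2 : Integrable (fun w => f (z + ρ • w) * k (w + a)) := by
    apply (hfc.mul (by fun_prop)).integrable_of_hasCompactSupport
    have : HasCompactSupport (fun w => k (w + a)) := by
      have := hk.compact.comp_homeomorph (Homeomorph.addRight a)
      simpa [Function.comp_def] using this
    exact this.mul_left
  have i3 := integrable_ker' hf hk z ρ
  rw [e2, e3]
  unfold II LL2
  have e4 := integral_sub (i1.add i2) (i3.const_mul 2)
  simp only [Pi.add_apply] at e4
  rw [integral_add i1 i2, integral_const_mul] at e4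
  rw [← e4]
  congr 1; funext w; ring

lemma ker_gen {k : ℝ × ℝ → ℝ} (hk : Ker k) (P : (ℝ × ℝ → ℝ) → Prop) (hP : P k)
    (hP' : ∀ a, P (LL2 k a)) : ∃ C : ℝ, 0 ≤ C ∧ ∀ f : ℝ × ℝ → ℝ, Continuous f → ∀ z ρ A, 0 < ρ →
      (∀ m b, MK m b → P m → |II f m z ρ| ≤ VV * b * A) →
      |II f k z ρ| ≤ C * A ∧
      ∀ h, ‖h‖ ≤ ρ → |II f k (z + h) ρ + II f k (z - h) ρ - 2 * II f k z ρ| ≤ C * A * (‖h‖ / ρ) ^ 2 := by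
  obtain ⟨b, hb, m1, m2⟩ := hk.toMK
  refine ⟨VV * b, mul_nonneg VV_nonneg hb, fun f hf z ρ A hρ H => ⟨H k b m1 hP, fun h hh => ?_⟩⟩
  rw [II_diff hf hk z h hρ]
  have hn : ‖ρ⁻¹ • h‖ = ‖h‖ / ρ := by
    rw [norm_smul, norm_inv, Real.norm_of_nonneg hρ.le]; field_simp
  have := H _ _ (m2 (ρ⁻¹ • h) (by rw [hn]; exact (div_le_one hρ).2 hh)) (hP' _)
  rw [hn] at this
  refine this.trans (le_of_eq ?_); ring

lemma ker0 {k : ℝ × ℝ → ℝ} (hk : Ker k) : ∃ C : ℝ, 0 ≤ C ∧ ∀ f : ℝ × ℝ → ℝ, Continuous f →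
      ∀ z ρ A, 0 < ρ → (∀ w, ‖w‖ ≤ 2 → |f (z + ρ • w)| ≤ A) →
      |II f k z ρ| ≤ C * A ∧
      ∀ h, ‖h‖ ≤ ρ → |II f k (z + h) ρ + II f k (z - h) ρ - 2 * II f k z ρ| ≤ C * A * (‖h‖ / ρ) ^ 2 := by
  obtain ⟨C, hC, H⟩ := ker_gen hk (fun _ => True) trivial (fun _ => trivial)
  exact ⟨C, hC, fun f hf z ρ A hρ hw => H f hf z ρ A hρ (fun m b hm _ => hm.b0 z ρ hw)⟩

lemma ker1 {k : ℝ × ℝ → ℝ} (hk : Ker k) (h0 : ∫ w, k w = 0) :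
    ∃ C : ℝ, 0 ≤ C ∧ ∀ f : ℝ × ℝ → ℝ, Continuous f →
      ∀ z ρ A, 0 < ρ → (∀ w, ‖w‖ ≤ 2 → |f (z + ρ • w) - f z| ≤ A) →
      |II f k z ρ| ≤ C * A ∧
      ∀ h, ‖h‖ ≤ ρ → |II f k (z + h) ρ + II f k (z - h) ρ - 2 * II f k z ρ| ≤ C * A * (‖h‖ / ρ) ^ 2 := by
  obtain ⟨C, hC, H⟩ := ker_gen hk (fun m => ∫ w, m w = 0) h0 (fun a => LL2_int hk a)
  exact ⟨C, hC, fun f hf z ρ A hρ hw => H f hf z ρ A hρ (fun m b hm h1 => hm.b1 hf h1 z ρ hw)⟩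

lemma ker2 {k : ℝ × ℝ → ℝ} (hk : Ker k) (h0 : ∫ w, k w = 0) (he : ∀ w, k (-w) = k w) :
    ∃ C : ℝ, 0 ≤ C ∧ ∀ f : ℝ × ℝ → ℝ, Continuous f →
      ∀ z ρ A, 0 < ρ → (∀ w, ‖w‖ ≤ 2 → |f (z + ρ • w) + f (z - ρ • w) - 2 * f z| ≤ A) →
      |II f k z ρ| ≤ C * A ∧
      ∀ h, ‖h‖ ≤ ρ → |II f k (z + h) ρ + II f k (z - h) ρ - 2 * II f k z ρ| ≤ C * A * (‖h‖ / ρ) ^ 2 := by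
  obtain ⟨C, hC, H⟩ := ker_gen hk (fun m => (∫ w, m w = 0) ∧ ∀ w, m (-w) = m w) ⟨h0, he⟩
    (fun a => ⟨LL2_int hk a, LL2_even he a⟩)
  exact ⟨C, hC, fun f hf z ρ A hρ hw => H f hf z ρ A hρ (fun m b hm h1 => hm.b2 hf h1.1 h1.2 z ρ hw)⟩

lemma int_fderiv_ker {k : ℝ × ℝ → ℝ} (hk : Ker k) : ∫ w, pdx k w = 0 := by
  have := ibp (f := fun _ => 1) contDiff_const hk 0 (1,0) 1
  simpa [pdx] using this

lemma Hk_even (w : ℝ × ℝ) : Hk (-w) = Hk w := by simp [Hk]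
lemma etak_even (w : ℝ × ℝ) : etak (-w) = etak w := by simp [etak]

lemma pdx_neg_of {f : ℝ × ℝ → ℝ} {s : ℝ} (hf : ∀ w, f (-w) = s * f w) (hd : Differentiable ℝ f) (w : ℝ × ℝ) :
    pdx f (-w) = - s * pdx f w := by
  have h1 : HasFDerivAt (fun w => f (-w)) ((fderiv ℝ f (-w)).comp (-ContinuousLinearMap.id ℝ (ℝ × ℝ))) w :=
    (hd (-w)).hasFDerivAt.comp w (hasFDerivAt_id w).neg
  have h2 : HasFDerivAt (fun w => s * f w) (s • fderiv ℝ f w) w := (hd w).hasFDerivAt.const_mul s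
  have h3 : (fun w => f (-w)) = fun w => s * f w := funext hf
  rw [h3] at h1
  have h4 := h1.unique h2
  have h5 := congrArg (fun L => L (1,0)) h4
  simp at h5
  have h6 : fderiv ℝ f (-w) (-1, 0) = - fderiv ℝ f (-w) (1,0) := by
    rw [← map_neg]; simp
  have h7 : fderiv ℝ f (-w) (-(1, 0)) = - fderiv ℝ f (-w) (1,0) := by
    rw [← map_neg]
  unfold pdx
  linarith [h5, h6]

lemma pdxxHk_even (w : ℝ × ℝ) : pdx (pdx Hk) (-w) = pdx (pdx Hk) w := by
  have h := pdx_neg_of (f := pdx Hk) (s := -1) (fun w => by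
    have := pdx_neg_of (f := Hk) (s := 1) (fun w => by simp [Hk_even]) (Hk_ker.smooth.differentiable (by simp)) w
    simpa using this) (pdxHk_ker.smooth.differentiable (by simp)) w
  simpa using h

end S15
end

section
open Real Set MeasureTheory
namespace S15

lemma ode_bound {α A t σ F : ℝ} {f f' : ℝ → ℝ} (hα : α ∈ Ioo (0:ℝ) 1) (ht : 0 < t) (htσ : t ≤ σ)
    (hA : 0 ≤ A) (hf0 : ContinuousOn f (Icc 0 σ)) (hf : ∀ ρ, 0 < ρ → HasDerivAt f (f' ρ) ρ)
    (h1 : ∀ ρ, 0 < ρ → ρ ≤ t → |f' ρ| ≤ A * ρ ^ α)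
    (h2 : ∀ ρ, t ≤ ρ → ρ ≤ σ → |f' ρ| ≤ A * (ρ ^ α * (t / ρ) ^ 2))
    (h3 : |f σ| ≤ F * (t / σ) ^ (1 + α)) :
    |f 0| ≤ (A + A / (1 - α)) * t ^ (1 + α) + F * (t / σ) ^ (1 + α) := by
  have h1α : 0 < 1 - α := by linarith [hα.2]
  have e1 : |f t - f 0| ≤ A * t ^ (1 + α) := by
    have := exists_hasDerivAt_eq_slope f f' ht (hf0.mono (Icc_subset_Icc le_rfl htσ))
      (fun x hx => hf x hx.1)
    obtain ⟨c, hc, e⟩ := this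
    have h4 := h1 c hc.1 hc.2.le
    have h5 : f t - f 0 = f' c * t := by
      rw [e, sub_zero]; field_simp
    rw [h5, abs_mul, abs_of_pos ht, rpow_add ht, rpow_one]
    have h6 : c ^ α ≤ t ^ α := rpow_le_rpow hc.1.le hc.2.le hα.1.le
    calc |f' c| * t ≤ (A * t ^ α) * t := by
          gcongr
          exact h4.trans (by gcongr)
      _ = _ := by ring
  have e2 : |f σ - f t| ≤ A / (1 - α) * t ^ (1 + α) := by
    have hB : ∀ x, t ≤ x → HasDerivAt (fun ρ => A * t ^ 2 / (1 - α) * (t ^ (α - 1) - ρ ^ (α - 1)))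
        (A * t ^ 2 * x ^ (α - 2)) x := by
      intro x hx
      have := ((Real.hasDerivAt_rpow_const (x := x) (p := α - 1) (Or.inl (by linarith))).const_sub
        (t ^ (α - 1))).const_mul (A * t ^ 2 / (1 - α))
      refine this.congr_deriv ?_
      rw [show α - 1 - 1 = α - 2 by ring]
      field_simp
      ring
    have hx := image_norm_le_of_norm_deriv_right_le_deriv_boundary' (f := fun ρ => f ρ - f t) (f' := f')
      (a := t) (b := σ) (B := fun ρ => A * t ^ 2 / (1 - α) * (t ^ (α - 1) - ρ ^ (α - 1)))
      (B' := fun x => A * t ^ 2 * x ^ (α - 2)) ?_ ?_ ?_ ?_ ?_ ?_ (x := σ) ⟨htσ, le_rfl⟩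
    · rw [Real.norm_eq_abs] at hx
      refine hx.trans ?_
      have e : t ^ (1 + α) = t ^ 2 * t ^ (α - 1) := by
        rw [← rpow_two, ← rpow_add ht]; congr 1; ring
      have p : 0 ≤ σ ^ (α - 1) := rpow_nonneg (by linarith) _
      have : 0 ≤ A * t ^ 2 / (1 - α) := by positivity
      rw [e]
      calc _ ≤ A * t ^ 2 / (1 - α) * t ^ (α - 1) := by gcongr; linarith
        _ = _ := by ring
    · exact (hf0.mono (Icc_subset_Icc ht.le le_rfl)).sub continuousOn_const
    · intro x hx
      exact ((hf x (by linarith [hx.1])).sub_const _).hasDerivWithinAt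
    · simp
    · intro x hx
      exact (hB x hx.1).continuousAt.continuousWithinAt
    · intro x hx
      exact (hB x hx.1).hasDerivWithinAt
    · intro x hx
      rw [Real.norm_eq_abs]
      refine (h2 x hx.1 hx.2.le).trans (le_of_eq ?_)
      have hx0 : 0 < x := by linarith [hx.1]
      have : x ^ (α - 2) = x ^ α / x ^ 2 := by rw [rpow_sub hx0, rpow_two]
      rw [this]; field_simp
  have e3 : |f 0| ≤ |f t - f 0| + |f σ - f t| + |f σ| := by
    have := abs_add_three (-(f t - f 0)) (-(f σ - f t)) (f σ)
    rw [abs_neg, abs_neg] at this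
    rw [show -(f t - f 0) + -(f σ - f t) + f σ = f 0 by ring] at this
    exact this
  rw [add_mul]
  linarith

/-- second difference -/
def dd (f : ℝ × ℝ → ℝ) (z h : ℝ × ℝ) : ℝ := f (z + h) + f (z - h) - 2 * f z

lemma second_diff {α : ℝ} (hα : α ∈ Ioo (0:ℝ) 1) : ∃ C : ℝ, 0 < C ∧
    ∀ (v G G1 G0 : ℝ × ℝ → ℝ) (_ : ContDiff ℝ 2 v) (_ : ContDiff ℝ 2 G)
    (_ : ContDiff ℝ 1 G1) (_ : Continuous G0)
    (_ : ∀ z, pdx (pdx v) z + pdy (pdy v) z = pdx (pdx G) z + pdx G1 z + G0 z)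
    (z : ℝ × ℝ) (σ E : ℝ) (_ : 0 < σ) (_ : σ ≤ 1) (_ : 0 ≤ E)
    (_ : ∀ z', ‖z' - z‖ ≤ 3 * σ → |v z'| ≤ 1) (_ : ∀ z', ‖z' - z‖ ≤ 3 * σ → |G0 z'| ≤ 1)
    (_ : ∀ z' k, ‖z' - z‖ ≤ σ → ‖k‖ ≤ 2 * σ → |dd G z' k| ≤ E * ‖k‖ ^ (1 + α))
    (_ : ∀ z' k, ‖z' - z‖ ≤ σ → ‖k‖ ≤ 2 * σ → |G1 (z' + k) - G1 z'| ≤ E * ‖k‖ ^ α)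
    (h : ℝ × ℝ) (_ : ‖h‖ ≤ σ),
    |dd v z h| ≤ C * ((σ ^ (1 + α))⁻¹ + E + 1) * ‖h‖ ^ (1 + α) := by
  obtain ⟨C2, hC2, H2⟩ := ker2 pdxxHk_ker (int_fderiv_ker pdxHk_ker) pdxxHk_even
  obtain ⟨C1, hC1, H1⟩ := ker1 pdxHk_ker (int_fderiv_ker Hk_ker)
  obtain ⟨C0, hC0, H0⟩ := ker0 Hk_ker
  obtain ⟨Cv, hCv, Hv⟩ := ker0 etak_ker
  set c := ∫ w, etak w with hc
  have hc0 : 0 < c := etak_integral_pos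
  have h1α : 0 < 1 - α := by linarith [hα.2]
  have hα0 := hα.1
  set D := 4 * (4 * C2 + 2 * C1 + C0) with hD
  have hD0 : 0 ≤ D := by positivity
  refine ⟨c⁻¹ * (D + D / (1 - α) + Cv) + 1, by positivity, ?_⟩
  intro v G G1 G0 hv hG hG1 hG0 heq z σ E hσ hσ1 hE bv bG0 bG bG1 h hh
  by_cases hh0 : h = 0
  · subst hh0
    simp [dd]
    rw [show v z + v z - 2 * v z = 0 by ring]
    rw [abs_zero]; positivity
  set t := ‖h‖ with ht
  have ht0 : 0 < t := norm_pos_iff.2 hh0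
  set f : ℝ → ℝ := fun ρ => II v etak (z + h) ρ + II v etak (z - h) ρ - 2 * II v etak z ρ with hf
  set T : ℝ × ℝ → ℝ → ℝ := fun z ρ => ρ⁻¹ * II G (pdx (pdx Hk)) z ρ - II G1 (pdx Hk) z ρ + ρ * II G0 Hk z ρ with hT
  have hv1 : ContDiff ℝ 1 v := hv.of_le (by norm_num)
  have hfd : ∀ ρ, 0 < ρ → HasDerivAt f (T (z + h) ρ + T (z - h) ρ - 2 * T z ρ) ρ := by
    intro ρ hρ
    exact ((deriv_main hv hG hG1 hG0 heq (z + h) hρ).add (deriv_main hv hG hG1 hG0 heq (z - h) hρ)).sub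
      ((deriv_main hv hG hG1 hG0 heq z hρ).const_mul 2)
  have hfc : Continuous f := by
    have : ∀ z, Continuous (II v etak z) := fun z =>
      continuous_iff_continuousAt.2 fun ρ => (hasDerivAt_II hv1 etak_ker z ρ).continuousAt
    have a1 := this (z + h)
    have a2 := this (z - h)
    have a3 := this z
    exact (a1.add a2).sub (a3.const_mul 2)
  have nw : ∀ {ρ : ℝ}, 0 < ρ → ρ ≤ σ → ∀ w : ℝ × ℝ, ‖w‖ ≤ 2 → ‖ρ • w‖ ≤ 2 * ρ ∧ ‖ρ • w‖ ≤ 2 * σ := by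
    intro ρ hρ hρσ w hw
    have : ‖ρ • w‖ ≤ 2 * ρ := by
      rw [norm_smul, Real.norm_of_nonneg hρ.le]; nlinarith
    exact ⟨this, by linarith⟩
  have r1 : ∀ {ρ : ℝ}, 0 < ρ → (2 * ρ) ^ (1 + α) ≤ 4 * (ρ * ρ ^ α) := by
    intro ρ hρ
    rw [mul_rpow (by norm_num) hρ.le, rpow_add hρ, rpow_one]
    have : (2:ℝ) ^ (1 + α) ≤ 2 ^ (2:ℝ) := rpow_le_rpow_of_exponent_le (by norm_num) (by linarith)
    norm_num at this
    have := rpow_pos_of_pos hρ α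
    gcongr
  have r2 : ∀ {ρ : ℝ}, 0 < ρ → (2 * ρ) ^ α ≤ 2 * ρ ^ α := by
    intro ρ hρ
    rw [mul_rpow (by norm_num) hρ.le]
    have : (2:ℝ) ^ α ≤ 2 ^ (1:ℝ) := rpow_le_rpow_of_exponent_le (by norm_num) (by linarith)
    norm_num at this
    have := rpow_pos_of_pos hρ α
    gcongr
  have B2 : ∀ z', ‖z' - z‖ ≤ σ → ∀ ρ, 0 < ρ → ρ ≤ σ → ∀ w : ℝ × ℝ, ‖w‖ ≤ 2 →
      |G (z' + ρ • w) + G (z' - ρ • w) - 2 * G z'| ≤ E * (4 * (ρ * ρ ^ α)) := by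
    intro z' hz' ρ hρ hρσ w hw
    obtain ⟨n1, n2⟩ := nw hρ hρσ w hw
    refine (bG z' (ρ • w) hz' n2).trans ?_
    gcongr
    exact (rpow_le_rpow (norm_nonneg _) n1 (by linarith)).trans (r1 hρ)
  have B1 : ∀ z', ‖z' - z‖ ≤ σ → ∀ ρ, 0 < ρ → ρ ≤ σ → ∀ w : ℝ × ℝ, ‖w‖ ≤ 2 →
      |G1 (z' + ρ • w) - G1 z'| ≤ E * (2 * ρ ^ α) := by
    intro z' hz' ρ hρ hρσ w hw
    obtain ⟨n1, n2⟩ := nw hρ hρσ w hw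
    refine (bG1 z' (ρ • w) hz' n2).trans ?_
    gcongr
    exact (rpow_le_rpow (norm_nonneg _) n1 (by linarith)).trans (r2 hρ)
  have tri : ∀ z', ‖z' - z‖ ≤ σ → ∀ ρ, 0 < ρ → ρ ≤ σ → ∀ w : ℝ × ℝ, ‖w‖ ≤ 2 →
      ‖z' + ρ • w - z‖ ≤ 3 * σ := by
    intro z' hz' ρ hρ hρσ w hw
    obtain ⟨n1, n2⟩ := nw hρ hρσ w hw
    have := norm_add_le (z' - z) (ρ • w)
    rw [show z' - z + ρ • w = z' + ρ • w - z by abel] at this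
    linarith
  have B0 : ∀ z', ‖z' - z‖ ≤ σ → ∀ ρ, 0 < ρ → ρ ≤ σ → ∀ w : ℝ × ℝ, ‖w‖ ≤ 2 →
      |G0 (z' + ρ • w)| ≤ 1 :=
    fun z' hz' ρ hρ hρσ w hw => bG0 _ (tri z' hz' ρ hρ hρσ w hw)
  have zz : ‖z - z‖ ≤ σ := by simp [hσ.le]
  have zp : ‖z + h - z‖ ≤ σ := by simpa using hh
  have zm : ‖z - h - z‖ ≤ σ := by
    rw [show z - h - z = -h by abel, norm_neg]; exact hh
  have ρα : ∀ ρ, 0 < ρ → ρ ≤ σ → ρ ≤ ρ ^ α := by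
    intro ρ hρ hρσ
    have := rpow_le_rpow_of_exponent_ge hρ (by linarith : ρ ≤ 1) hα.2.le
    rwa [rpow_one] at this
  have comb : ∀ ρ, 0 < ρ → ρ ≤ σ → ∀ s a b d : ℝ, 0 ≤ s → |a| ≤ C2 * (E * (4 * (ρ * ρ ^ α))) * s →
      |b| ≤ C1 * (E * (2 * ρ ^ α)) * s → |d| ≤ C0 * 1 * s →
      |ρ⁻¹ * a - b + ρ * d| ≤ D / 4 * (E + 1) * (ρ ^ α * s) := by
    intro ρ hρ hρσ s a b d hs ha hb hd
    have hp := rpow_pos_of_pos hρ α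
    have q1 : |ρ⁻¹ * a| ≤ 4 * C2 * E * (ρ ^ α * s) := by
      rw [abs_mul, abs_of_pos (inv_pos.2 hρ)]
      calc _ ≤ ρ⁻¹ * (C2 * (E * (4 * (ρ * ρ ^ α))) * s) := by gcongr
        _ = _ := by field_simp
    have q3 : |ρ * d| ≤ C0 * (ρ ^ α * s) := by
      rw [abs_mul, abs_of_pos hρ]
      calc _ ≤ ρ ^ α * (C0 * 1 * s) := by
            gcongr
            exact ρα ρ hρ hρσ
        _ = _ := by ring
    have q : |ρ⁻¹ * a - b + ρ * d| ≤ |ρ⁻¹ * a| + |b| + |ρ * d| := by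
      have := abs_add_three (ρ⁻¹ * a) (-b) (ρ * d)
      rw [abs_neg] at this
      simpa [sub_eq_add_neg] using this
    have hps : 0 ≤ ρ ^ α * s := by positivity
    rw [hD]
    have u1 : 0 ≤ C2 * (ρ ^ α * s) := by positivity
    have u2 : 0 ≤ C1 * (ρ ^ α * s) := by positivity
    have u3 : 0 ≤ C0 * E * (ρ ^ α * s) := by positivity
    calc _ ≤ _ := q
      _ ≤ 4 * C2 * E * (ρ ^ α * s) + C1 * (E * (2 * ρ ^ α)) * s + C0 * (ρ ^ α * s) := by linarith
      _ ≤ _ := by nlinarith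
  have main := ode_bound (f := f) (f' := fun ρ => T (z + h) ρ + T (z - h) ρ - 2 * T z ρ)
    (A := D * (E + 1)) (t := t) (σ := σ) (F := Cv) hα ht0 hh (by positivity) hfc.continuousOn hfd ?_ ?_ ?_
  · have f0 : f 0 = c * dd v z h := by
      simp only [hf, II, zero_smul, add_zero, integral_const_mul, dd]
      rw [← hc]; ring
    rw [f0, abs_mul, abs_of_pos hc0, div_rpow ht0.le hσ.le] at main
    have hσp := rpow_pos_of_pos hσ (1 + α)
    have htp := rpow_pos_of_pos ht0 (1 + α)
    have hinv : 0 < (σ ^ (1 + α))⁻¹ := inv_pos.2 hσp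
    have m2 : |dd v z h| ≤ c⁻¹ * ((D * (E + 1) + D * (E + 1) / (1 - α)) * t ^ (1 + α) + Cv * (t ^ (1 + α) / σ ^ (1 + α))) := by
      rw [le_inv_mul_iff₀ hc0]; exact main
    refine m2.trans ?_
    rw [div_eq_mul_inv (t ^ (1+α))]
    have hci : 0 < c⁻¹ := inv_pos.2 hc0
    have hDd : 0 ≤ D / (1 - α) := by positivity
    have e : c⁻¹ * ((D * (E + 1) + D * (E + 1) / (1 - α)) * t ^ (1 + α) + Cv * (t ^ (1 + α) * (σ ^ (1 + α))⁻¹))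
       = c⁻¹ * ((D + D / (1 - α)) * (E + 1) + Cv * (σ ^ (1 + α))⁻¹) * t ^ (1 + α) := by ring
    rw [e]
    refine mul_le_mul_of_nonneg_right ?_ htp.le
    have k1 : 0 ≤ c⁻¹ * (D + D / (1 - α)) * (σ ^ (1 + α))⁻¹ := by positivity
    have k2 : 0 ≤ c⁻¹ * Cv * (E + 1) := by positivity
    nlinarith
  · intro ρ hρ hρt
    have hρσ := hρt.trans hh
    have each : ∀ z', ‖z' - z‖ ≤ σ → |T z' ρ| ≤ D / 4 * (E + 1) * (ρ ^ α * 1) := by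
      intro z' hz'
      have a2 := (H2 G hG.continuous z' ρ _ hρ (B2 z' hz' ρ hρ hρσ)).1
      have a1 := (H1 G1 hG1.continuous z' ρ _ hρ (B1 z' hz' ρ hρ hρσ)).1
      have a0 := (H0 G0 hG0 z' ρ _ hρ (B0 z' hz' ρ hρ hρσ)).1
      exact comb ρ hρ hρσ 1 _ _ _ zero_le_one (by simpa using a2) (by simpa using a1) (by simpa using a0)
    have b1 := each _ zp
    have b2 := each _ zm
    have b3 := each _ zz
    simp only [mul_one] at b1 b2 b3
    rw [abs_le] at *
    constructor <;> linarith [b1.1, b1.2, b2.1, b2.2, b3.1, b3.2]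
  · intro ρ hρt hρσ
    have hρ : 0 < ρ := ht0.trans_le hρt
    have a2 := (H2 G hG.continuous z ρ _ hρ (B2 z zz ρ hρ hρσ)).2 h hρt
    have a1 := (H1 G1 hG1.continuous z ρ _ hρ (B1 z zz ρ hρ hρσ)).2 h hρt
    have a0 := (H0 G0 hG0 z ρ _ hρ (B0 z zz ρ hρ hρσ)).2 h hρt
    have := comb ρ hρ hρσ ((t / ρ) ^ 2) _ _ _ (by positivity) a2 a1 a0
    simp only [hT]
    have e : ∀ a b c d e f x y w : ℝ, ρ⁻¹ * a - b + ρ * c + (ρ⁻¹ * d - e + ρ * f) - 2 * (ρ⁻¹ * x - y + ρ * w)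
       = ρ⁻¹ * (a + d - 2 * x) - (b + e - 2 * y) + ρ * (c + f - 2 * w) := by intros; ring
    rw [e]
    refine this.trans ?_
    gcongr
    linarith
  · have := (Hv v hv.continuous z σ 1 hσ (fun w hw => bv _ (tri z zz σ hσ le_rfl w hw))).2 h hh
    refine this.trans ?_
    rw [mul_one]
    gcongr
    rw [← rpow_two]
    exact rpow_le_rpow_of_exponent_ge (by positivity) ((div_le_one hσ).2 hh) (by linarith)

end S15
end

section
open Real Set MeasureTheory
namespace S15

lemma interp {α N s : ℝ} {v : ℝ × ℝ → ℝ} {D : ℝ × ℝ →L[ℝ] ℝ} {z : ℝ × ℝ} (hα : α ∈ Ioo (0:ℝ) 1)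
    (hs0 : 0 < s) (hs : s ≤ 1) (hN : (s ^ (1 + α))⁻¹ ≤ N)
    (hv : ∀ k, ‖k‖ ≤ s → |v (z + k)| ≤ 1)
    (hR : ∀ k, ‖k‖ ≤ s → |v (z + k) - v z - D k| ≤ N * ‖k‖ ^ (1 + α)) (k : ℝ × ℝ) (hk : ‖k‖ ≤ s) :
    |v (z + k) - v z| ^ 2 ≤ 16 * N * ‖k‖ ^ (1 + α) ∧ |v (z + k) - v z| ≤ 4 * N * ‖k‖ ^ α ∧
    ‖k‖ ^ 2 ≤ N * ‖k‖ ^ (1 + α) ∧ ‖k‖ ≤ N * ‖k‖ ^ α := by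
  have hα0 := hα.1
  have hα1 := hα.2
  have hsp : 0 < s ^ (1 + α) := rpow_pos_of_pos hs0 _
  have hsp1 : s ^ (1 + α) ≤ 1 := rpow_le_one hs0.le hs (by linarith)
  have hN1 : 1 ≤ N := (one_le_inv₀ hsp).2 hsp1 |>.trans hN
  have hN0 : 0 < N := by linarith
  by_cases hk0 : k = 0
  · subst hk0
    have h1 : (1 + α) ≠ 0 := by linarith
    simp [zero_rpow h1, zero_rpow hα0.ne']
  set t := ‖k‖ with ht
  have ht0 : 0 < t := norm_pos_iff.2 hk0
  have ht1 : t ≤ 1 := hk.trans hs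
  have hv0 : |v z| ≤ 1 := by simpa using hv 0 (by simpa using hs0.le)
  have htα : t ≤ t ^ α := by
    have := rpow_le_rpow_of_exponent_ge ht0 ht1 hα1.le
    rwa [rpow_one] at this
  have ht2 : t ^ 2 ≤ t ^ (1 + α) := by
    rw [← rpow_two]
    exact rpow_le_rpow_of_exponent_ge ht0 ht1 (by linarith)
  have p1 : 0 < t ^ (1 + α) := rpow_pos_of_pos ht0 _
  have p2 : 0 < t ^ α := rpow_pos_of_pos ht0 _
  refine ⟨?_, ?_, by nlinarith, by nlinarith⟩ <;>
  · set L := (N⁻¹) ^ ((1 + α)⁻¹) with hL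
    have hL0 : 0 < L := rpow_pos_of_pos (inv_pos.2 hN0) _
    have hLp : L ^ (1 + α) = N⁻¹ := rpow_inv_rpow (inv_pos.2 hN0).le (by linarith)
    have hLs : L ≤ s := by
      have : L ^ (1 + α) ≤ s ^ (1 + α) := by
        rw [hLp]; exact inv_le_of_inv_le₀ hsp hN
      exact (rpow_le_rpow_iff hL0.le hs0.le (by linarith)).1 this
    have hL1 : L ≤ 1 := hLs.trans hs
    have ha2 : |v (z + k) - v z| ≤ 2 := by
      have := hv k hk
      rw [abs_le] at *
      constructor <;> linarith [this.1, this.2, hv0.1, hv0.2]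
    have a0 := abs_nonneg (v (z + k) - v z)
    have hLa : N * (L * L ^ α) = 1 := by
      have : L ^ (1 + α) = L * L ^ α := by rw [rpow_add hL0, rpow_one]
      rw [← this, hLp]; field_simp
    rcases le_or_gt L t with hLt | hLt
    · have q1 : 1 ≤ N * t ^ (1 + α) := by
        have : N⁻¹ ≤ t ^ (1 + α) := by
          rw [← hLp]; exact rpow_le_rpow hL0.le hLt (by linarith)
        calc 1 = N * N⁻¹ := by field_simp
          _ ≤ _ := by gcongr
      have q2 : t ^ (1 + α) ≤ t ^ α := rpow_le_rpow_of_exponent_ge ht0 ht1 (by linarith)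
      nlinarith
    · set τ := t / L with hτ
      have hτ0 : 0 < τ := by positivity
      have hτ1 : τ ≤ 1 := (div_le_one hL0).2 hLt.le
      have htL : t = τ * L := by rw [hτ]; field_simp
      have e1 : N * t ^ (1 + α) = τ ^ (1 + α) := by
        rw [htL, mul_rpow hτ0.le hL0.le, hLp]; field_simp
      have e2 : N * L * t ^ α = τ ^ α := by
        rw [htL, mul_rpow hτ0.le hL0.le]
        linear_combination (τ ^ α) * hLa
      have hD : |D k| ≤ 3 * τ := by
        have hn : ‖(τ⁻¹) • k‖ = L := by
          rw [norm_smul, norm_inv, Real.norm_of_nonneg hτ0.le, ← ht, htL]; field_simp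
        have h1 := hR (τ⁻¹ • k) (by rw [hn]; exact hLs)
        have h2 := hv (τ⁻¹ • k) (by rw [hn]; exact hLs)
        rw [hn, hLp, mul_inv_cancel₀ hN0.ne', map_smul, smul_eq_mul] at h1
        have h3 : |τ⁻¹ * D k| ≤ 3 := by
          rw [abs_le] at *
          constructor <;> linarith [h1.1, h1.2, h2.1, h2.2, hv0.1, hv0.2]
        rw [abs_mul, abs_of_pos (inv_pos.2 hτ0), inv_mul_le_iff₀ hτ0] at h3
        linarith
      have hτp : τ ^ (1 + α) ≤ τ := by
        have := rpow_le_rpow_of_exponent_ge hτ0 hτ1 (by linarith : (1:ℝ) ≤ 1 + α)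
        rwa [rpow_one] at this
      have hτ2 : τ ^ 2 ≤ τ ^ (1 + α) := by
        rw [← rpow_two]
        exact rpow_le_rpow_of_exponent_ge hτ0 hτ1 (by linarith)
      have hτa : τ ≤ τ ^ α := by
        have := rpow_le_rpow_of_exponent_ge hτ0 hτ1 hα1.le
        rwa [rpow_one] at this
      have h4 : |v (z + k) - v z| ≤ 4 * τ := by
        have := hR k hk
        rw [← ht, e1] at this
        rw [abs_le] at *
        constructor <;> linarith [this.1, this.2, hD.1, hD.2]
      have hNL : N * L * t ^ α ≤ N * t ^ α := by
        have : N * L ≤ N := by nlinarith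
        gcongr
      have s1 : |v (z + k) - v z| ^ 2 ≤ 16 * N * t ^ (1 + α) := by
        have h5 : |v (z + k) - v z| ^ 2 ≤ (4 * τ) ^ 2 := by gcongr
        rw [mul_assoc, e1]
        linarith [mul_pow 4 τ 2, hτ2]
      have s2 : |v (z + k) - v z| ≤ 4 * N * t ^ α := by
        rw [mul_assoc]
        linarith
      first
        | exact s1
        | exact s2

structure LD (v G G1 G0 : ℝ × ℝ → ℝ) (ε : ℝ) : Prop where
  hv : ContDiff ℝ 2 v
  hG : ContDiff ℝ 2 G
  hG1 : ContDiff ℝ 1 G1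
  hG0 : Continuous G0
  heq : ∀ z, pdx (pdx v) z + pdy (pdy v) z = pdx (pdx G) z + pdx G1 z + G0 z
  hvc : HasCompactSupport v
  bv : ∀ z, ‖z‖ < 1 → |v z| ≤ 1
  bG0 : ∀ z, ‖z‖ < 1 → |G0 z| ≤ 1
  bG : ∀ z k, ‖z‖ + ‖k‖ < 1 →
    |dd G z k| ≤ ε * (|dd v z k| + ‖k‖ ^ 2 + |v (z + k) - v z| ^ 2 + |v (z - k) - v z| ^ 2)
  bG1 : ∀ z k, ‖z‖ + ‖k‖ < 1 → |G1 (z + k) - G1 z| ≤ ε * (|v (z + k) - v z| + ‖k‖)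

def PP (α N : ℝ) (v : ℝ × ℝ → ℝ) : Prop := ∀ z h : ℝ × ℝ, ‖z‖ < 1 → ‖h‖ ≤ (1 - ‖z‖) / 2 →
  |v (z + h) - v z - fderiv ℝ v z h| ≤ N * ((1 - ‖z‖) ^ (1 + α))⁻¹ * ‖h‖ ^ (1 + α)

lemma rpow_scale {α c d : ℝ} (hα : α ∈ Ioo (0:ℝ) 1) (hc : 0 < c) (hc1 : c ≤ 1) (hd : 0 < d) :
    ((c * d) ^ (1 + α))⁻¹ ≤ (c ^ 2)⁻¹ * (d ^ (1 + α))⁻¹ := by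
  rw [mul_rpow hc.le hd.le, mul_inv]
  have : c ^ 2 ≤ c ^ (1 + α) := by
    rw [← rpow_two]; exact rpow_le_rpow_of_exponent_ge hc hc1 (by linarith [hα.2])
  have := rpow_pos_of_pos hd (1 + α)
  gcongr

lemma improve1 {α : ℝ} (hα : α ∈ Ioo (0:ℝ) 1) : ∃ K : ℝ, 0 < K ∧ ∀ v G G1 G0 ε N,
    LD v G G1 G0 ε → 0 < ε → ε ≤ 1 → 0 ≤ N → PP α N v → ∀ c e : ℝ × ℝ, ‖c‖ < 1 → ‖e‖ ≤ (1 - ‖c‖) / 2 →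
      |dd v c e| ≤ K * (1 + ε * N) * ((1 - ‖c‖) ^ (1 + α))⁻¹ * ‖e‖ ^ (1 + α) := by
  obtain ⟨C, hC, H⟩ := second_diff hα
  refine ⟨1000 * C + 256, by positivity, ?_⟩
  intro v G G1 G0 ε N hd hε hε1 hN hP c e hc he
  have hα0 := hα.1
  set d := 1 - ‖c‖ with hdd
  have hd0 : 0 < d := by linarith
  have hd1 : d ≤ 1 := by linarith [norm_nonneg c]
  have hdp : 0 < d ^ (1 + α) := rpow_pos_of_pos hd0 _
  have hdi : 1 ≤ (d ^ (1 + α))⁻¹ := (one_le_inv₀ hdp).2 (rpow_le_one hd0.le hd1 (by linarith))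
  set X := (d ^ (1 + α))⁻¹ with hX
  have hεN : 0 ≤ ε * N := by positivity
  have sc8 : ((1 / 8 * d) ^ (1 + α))⁻¹ ≤ 64 * X := by
    have := rpow_scale hα (c := 1/8) (d := d) (by norm_num) (by norm_num) hd0
    norm_num at this ⊢; exact this
  have sc4 : ((1 / 4 * d) ^ (1 + α))⁻¹ ≤ 16 * X := by
    have := rpow_scale hα (c := 1/4) (d := d) (by norm_num) (by norm_num) hd0
    norm_num at this ⊢; exact this
  have sc2 : ((1 / 2 * d) ^ (1 + α))⁻¹ ≤ 4 * X := by
    have := rpow_scale hα (c := 1/2) (d := d) (by norm_num) (by norm_num) hd0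
    norm_num at this ⊢; exact this
  rcases le_or_gt ‖e‖ (1 / 8 * d) with hs | hs
  · set N2 := (4 * N + 16) * X with hN2
    have key : ∀ z' k, ‖z' - c‖ ≤ 1 / 8 * d → ‖k‖ ≤ 2 * (1 / 8 * d) →
        ‖z'‖ + ‖k‖ < 1 ∧ |v (z' + k) - v z' - fderiv ℝ v z' k| ≤ N2 * ‖k‖ ^ (1 + α) := by
      intro z' k hz hk
      have h1 := norm_sub_norm_le z' c
      have h2 : ‖z'‖ + ‖k‖ < 1 := by linarith
      refine ⟨h2, ?_⟩
      have h3 := hP z' k (by linarith [norm_nonneg k]) (by linarith)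
      refine h3.trans ?_
      have h4 : ((1 - ‖z'‖) ^ (1 + α))⁻¹ ≤ 4 * X := by
        refine le_trans ?_ sc2
        have : (0:ℝ) < 1 / 2 * d := by positivity
        have h6 : 1 / 2 * d ≤ 1 - ‖z'‖ := by linarith
        have h5 := rpow_pos_of_pos this (1 + α)
        gcongr
      have : 0 ≤ ‖k‖ ^ (1 + α) := by positivity
      have : N * ((1 - ‖z'‖) ^ (1 + α))⁻¹ ≤ N2 := by
        rw [hN2]; nlinarith
      gcongr
    have intp : ∀ z' k, ‖z' - c‖ ≤ 1 / 8 * d → ‖k‖ ≤ 2 * (1 / 8 * d) →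
        |v (z' + k) - v z'| ^ 2 ≤ 16 * N2 * ‖k‖ ^ (1 + α) ∧ |v (z' + k) - v z'| ≤ 4 * N2 * ‖k‖ ^ α ∧
    ‖k‖ ^ 2 ≤ N2 * ‖k‖ ^ (1 + α) ∧ ‖k‖ ≤ N2 * ‖k‖ ^ α := by
      intro z' k hz hk
      refine interp (D := fderiv ℝ v z') hα (s := 1 / 4 * d) (by positivity) (by linarith) ?_ ?_ ?_ k (by linarith)
      · rw [hN2]; nlinarith
      · intro k hk
        have := key z' k hz (by linarith)
        exact hd.bv _ (lt_of_le_of_lt (norm_add_le _ _) this.1)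
      · intro k hk
        exact (key z' k hz (by linarith)).2
    have hN20 : 0 ≤ N2 := by positivity
    have := H v G G1 G0 hd.hv hd.hG hd.hG1 hd.hG0 hd.heq c (1 / 8 * d) (35 * ε * N2) (by positivity)
      (by linarith) (by positivity) ?_ ?_ ?_ ?_ e hs
    · refine this.trans ?_
      have q : 0 ≤ ‖e‖ ^ (1 + α) := by positivity
      refine mul_le_mul_of_nonneg_right ?_ q
      have q1 : ((1 / 8 * d) ^ (1 + α))⁻¹ + 35 * ε * N2 + 1 ≤ 1000 * (1 + ε * N) * X := by
        rw [hN2]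
        have : ε * X ≤ X := by nlinarith
        have : 0 ≤ ε * N * X := by positivity
        nlinarith
      have : 0 ≤ (1 + ε * N) * X := by positivity
      calc _ ≤ C * (1000 * (1 + ε * N) * X) := by gcongr
        _ ≤ _ := by nlinarith
    · intro z' hz
      apply hd.bv
      have h1 := norm_sub_norm_le z' c
      linarith
    · intro z' hz
      apply hd.bG0
      have h1 := norm_sub_norm_le z' c
      linarith
    · intro z' k hz hk
      have h1 := key z' k hz hk
      have h2 := intp z' k hz hk
      have h3 := intp z' (-k) hz (by rwa [norm_neg])
      have h4 := key z' (-k) hz (by rwa [norm_neg])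
      have h5 := hd.bG z' k h1.1
      rw [norm_neg, ← sub_eq_add_neg] at h3
      have h6 := h4.2
      have h7 := h1.2
      rw [norm_neg, ← sub_eq_add_neg, map_neg] at h6
      have h8 : |dd v z' k| ≤ 2 * N2 * ‖k‖ ^ (1 + α) := by
        unfold dd
        rw [abs_le] at *
        constructor <;> linarith [h7.1, h7.2, h6.1, h6.2]
      refine h5.trans ?_
      calc _ ≤ ε * (2 * N2 * ‖k‖ ^ (1 + α) + N2 * ‖k‖ ^ (1 + α) + 16 * N2 * ‖k‖ ^ (1 + α) + 16 * N2 * ‖k‖ ^ (1 + α)) := by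
            gcongr
            · exact h2.2.2.1
            · exact h2.1
            · exact h3.1
        _ = _ := by ring
    · intro z' k hz hk
      have h1 := key z' k hz hk
      have h2 := intp z' k hz hk
      have h5 := hd.bG1 z' k h1.1
      refine h5.trans ?_
      have : 0 ≤ ε * N2 * ‖k‖ ^ α := by positivity
      calc _ ≤ ε * (4 * N2 * ‖k‖ ^ α + N2 * ‖k‖ ^ α) := by
            gcongr
            · exact h2.2.1
            · exact h2.2.2.2
        _ ≤ _ := by nlinarith
  · have b1 := hd.bv c hc
    have b2 := hd.bv (c + e) (lt_of_le_of_lt (norm_add_le _ _) (by linarith))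
    have b3 := hd.bv (c - e) (lt_of_le_of_lt (norm_sub_le _ _) (by linarith))
    have b4 : |dd v c e| ≤ 4 := by
      unfold dd
      rw [abs_le] at *
      constructor <;> linarith [b1.1, b1.2, b2.1, b2.2, b3.1, b3.2]
    have h0 : (0:ℝ) < 1 / 8 * d := by positivity
    have b5 : 1 ≤ 64 * X * ‖e‖ ^ (1 + α) := by
      have h1 : (1 / 8 * d) ^ (1 + α) ≤ ‖e‖ ^ (1 + α) := rpow_le_rpow h0.le hs.le (by linarith)
      have h2 := rpow_pos_of_pos h0 (1 + α)
      calc 1 = ((1 / 8 * d) ^ (1 + α))⁻¹ * (1 / 8 * d) ^ (1 + α) := by field_simp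
        _ ≤ _ := by gcongr
    have hX0 : 0 ≤ X * ‖e‖ ^ (1 + α) := by positivity
    calc _ ≤ 4 * (64 * X * ‖e‖ ^ (1 + α)) := by linarith
      _ = 256 * 1 * (X * ‖e‖ ^ (1 + α)) := by ring
      _ ≤ (1000 * C + 256) * (1 + ε * N) * (X * ‖e‖ ^ (1 + α)) := by
          gcongr
          · linarith
          · linarith
      _ = _ := by ring

end S15
end

section
open Real Set MeasureTheory Filter Topology
namespace S15

lemma improve2 {α : ℝ} (hα : α ∈ Ioo (0:ℝ) 1) : ∃ K : ℝ, 0 < K ∧ ∀ (v : ℝ × ℝ → ℝ) (M : ℝ), ContDiff ℝ 2 v →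
    0 ≤ M → (∀ c e : ℝ × ℝ, ‖c‖ < 1 → ‖e‖ ≤ (1 - ‖c‖) / 2 →
      |dd v c e| ≤ M * ((1 - ‖c‖) ^ (1 + α))⁻¹ * ‖e‖ ^ (1 + α)) → PP α (K * M) v := by
  have hα0 := hα.1
  set r : ℝ := (1 / 2) ^ α with hr
  have hr0 : 0 < r := rpow_pos_of_pos (by norm_num) _
  have hr1 : r < 1 := rpow_lt_one (by norm_num) (by norm_num) hα0
  refine ⟨4 / (1 - r), by have : 0 < 1 - r := by linarith
                          positivity, ?_⟩
  intro v M hv hM H z h hz hh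
  set d := 1 - ‖z‖ with hd
  have hd0 : 0 < d := by linarith
  have hdp : 0 < d ^ (1 + α) := rpow_pos_of_pos hd0 _
  set X := (d ^ (1 + α))⁻¹ with hX
  have hX0 : 0 < X := inv_pos.2 hdp
  have sc2 : ((1 / 2 * d) ^ (1 + α))⁻¹ ≤ 4 * X := by
    have := rpow_scale hα (c := 1/2) (d := d) (by norm_num) (by norm_num) hd0
    norm_num at this ⊢; exact this
  set a : ℕ → ℝ := fun j => (((1:ℝ) / 2) ^ j)⁻¹ * (v (z + ((1:ℝ) / 2) ^ j • h) - v z) with ha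
  have hlim : Tendsto a atTop (𝓝 (fderiv ℝ v z h)) := by
    have h1 := hasDerivAt_line (hv.of_le (by norm_num) : ContDiff ℝ 1 v) z h 0
    have h2 := h1.tendsto_slope_zero
    simp only [zero_add, zero_smul, add_zero, smul_eq_mul] at h2
    have h3 : Tendsto (fun j : ℕ => ((1:ℝ) / 2) ^ j) atTop (𝓝[≠] 0) := by
      rw [tendsto_nhdsWithin_iff]
      refine ⟨tendsto_pow_atTop_nhds_zero_of_lt_one (by norm_num) (by norm_num), ?_⟩
      filter_upwards with j
      simp
    exact h2.comp h3
  have hstep : ∀ j, dist (a j) (a (j + 1)) ≤ (4 * M * X * ‖h‖ ^ (1 + α)) * r ^ j := by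
    intro j
    set q : ℝ := (1 / 2) ^ (j + 1) with hq
    have hq0 : 0 < q := by positivity
    have hqj : ((1:ℝ) / 2) ^ j = 2 * q := by rw [hq, pow_succ]; ring
    have hq1 : q ≤ 1 / 2 := by
      rw [hq, pow_succ]
      have : ((1:ℝ)/2) ^ j ≤ 1 := pow_le_one₀ (by norm_num) (by norm_num)
      linarith
    have hne : ‖q • h‖ = q * ‖h‖ := by rw [norm_smul, Real.norm_of_nonneg hq0.le]
    have hne2 : ‖q • h‖ ≤ d / 4 := by rw [hne]; nlinarith [norm_nonneg h]
    have hc := norm_add_le z (q • h)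
    have hdc : 1 / 2 * d ≤ 1 - ‖z + q • h‖ := by linarith
    have h1 := H (z + q • h) (q • h) (by linarith) (by linarith)
    have e : a j - a (j + 1) = (2 * q)⁻¹ * dd v (z + q • h) (q • h) := by
      simp only [ha, dd]
      rw [hqj, ← hq, show z + q • h + q • h = z + (2 * q) • h by rw [two_mul, add_smul, add_assoc],
        show z + q • h - q • h = z by abel]
      field_simp
      ring
    rw [Real.dist_eq, e, abs_mul, abs_of_pos (by positivity)]
    have h2 : ((1 - ‖z + q • h‖) ^ (1 + α))⁻¹ ≤ 4 * X := by
      refine le_trans ?_ sc2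
      have h0 : (0:ℝ) < 1 / 2 * d := by positivity
      have := rpow_pos_of_pos h0 (1 + α)
      gcongr
    have h3 : q ^ (1 + α) ≤ q * r ^ j := by
      rw [rpow_add hq0, rpow_one, hq, ← Real.rpow_pow_comm (by norm_num), ← hr]
      have : r ^ (j + 1) ≤ r ^ j := pow_le_pow_of_le_one hr0.le hr1.le (by omega)
      gcongr
    have hhp : 0 ≤ ‖h‖ ^ (1 + α) := by positivity
    calc (2 * q)⁻¹ * |dd v (z + q • h) (q • h)|
        ≤ (2 * q)⁻¹ * (M * (4 * X) * ((q * r ^ j) * ‖h‖ ^ (1 + α))) := by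
          gcongr
          refine h1.trans ?_
          rw [hne, mul_rpow hq0.le (norm_nonneg _)]
          gcongr
      _ = 1 / 2 * ((4 * M * X * ‖h‖ ^ (1 + α)) * r ^ j) := by field_simp
      _ ≤ _ := by
          have : 0 ≤ (4 * M * X * ‖h‖ ^ (1 + α)) * r ^ j := by positivity
          linarith
  have := dist_le_of_le_geometric_of_tendsto₀ r _ hr1 hstep hlim
  rw [Real.dist_eq] at this
  simp only [ha, pow_zero, one_smul, inv_one, one_mul] at this
  refine this.trans (le_of_eq ?_)
  ring

lemma PP_limit {α : ℝ} (hα : α ∈ Ioo (0:ℝ) 1) : ∃ ε K : ℝ, 0 < ε ∧ 0 < K ∧ ∀ v G G1 G0,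
    LD v G G1 G0 ε → PP α K v := by
  obtain ⟨K1, hK1, H1⟩ := improve1 hα
  obtain ⟨K2, hK2, H2⟩ := improve2 hα
  set K := K2 * K1 + 1 with hK
  have hK0 : 1 < K := by have := mul_pos hK2 hK1; linarith
  refine ⟨1 / (2 * K), 2 * K, by positivity, by positivity, ?_⟩
  intro v G G1 G0 hd
  have hε1 : 1 / (2 * K) ≤ 1 := by rw [div_le_one (by positivity)]; linarith
  have step : ∀ N, 0 ≤ N → PP α N v → PP α (N / 2 + K) v := by
    intro N hN hP
    have h1 := H1 v G G1 G0 _ N hd (by positivity) hε1 hN hP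
    have h2 := H2 v (K1 * (1 + 1 / (2 * K) * N)) hd.hv (by positivity) h1
    intro z h hz hh
    refine (h2 z h hz hh).trans ?_
    have e : K2 * (K1 * (1 + 1 / (2 * K) * N)) ≤ N / 2 + K := by
      have : K * (1 + 1 / (2 * K) * N) = N / 2 + K := by field_simp; ring
      rw [← this, ← mul_assoc]
      gcongr
      linarith
    have : 0 < 1 - ‖z‖ := by linarith
    have : 0 < (1 - ‖z‖) ^ (1 + α) := by positivity
    gcongr
  obtain ⟨T, hT, HT⟩ := taylor_bound hd.hv hd.hvc
  have base : PP α T v := by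
    intro z h hz hh
    refine (HT z h).trans ?_
    have hz0 := norm_nonneg z
    have h1 : 1 ≤ ((1 - ‖z‖) ^ (1 + α))⁻¹ := by
      refine (one_le_inv₀ (rpow_pos_of_pos (by linarith) _)).2 (rpow_le_one (by linarith) (by linarith) (by linarith [hα.1]))
    have h2 : ‖h‖ ^ 2 ≤ ‖h‖ ^ (1 + α) := by
      by_cases h0 : h = 0
      · subst h0; simp; positivity
      rw [← rpow_two]
      exact rpow_le_rpow_of_exponent_ge (norm_pos_iff.2 h0) (by linarith) (by linarith [hα.2])
    calc T * ‖h‖ ^ 2 ≤ T * ‖h‖ ^ (1 + α) := by gcongr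
      _ ≤ _ := by
        have : T ≤ T * ((1 - ‖z‖) ^ (1 + α))⁻¹ := by nlinarith
        gcongr
  have all : ∀ j : ℕ, PP α (T * (1 / 2) ^ j + 2 * K) v := by
    intro j
    induction j with
    | zero =>
      intro z h hz hh
      refine (base z h hz hh).trans ?_
      have : 0 < 1 - ‖z‖ := by linarith
      have : 0 < (1 - ‖z‖) ^ (1 + α) := by positivity
      gcongr
      simp; linarith
    | succ j ih =>
      have := step _ (by positivity) ih
      have e : (T * (1 / 2) ^ j + 2 * K) / 2 + K = T * (1 / 2) ^ (j + 1) + 2 * K := by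
        rw [pow_succ]; ring
      rwa [e] at this
  intro z h hz hh
  have hl : Tendsto (fun j : ℕ => (T * (1 / 2) ^ j + 2 * K) * ((1 - ‖z‖) ^ (1 + α))⁻¹ * ‖h‖ ^ (1 + α)) atTop
      (𝓝 ((T * 0 + 2 * K) * ((1 - ‖z‖) ^ (1 + α))⁻¹ * ‖h‖ ^ (1 + α))) := by
    have := tendsto_pow_atTop_nhds_zero_of_lt_one (r := (1:ℝ)/2) (by norm_num) (by norm_num)
    exact (((this.const_mul T).add_const _).mul_const _).mul_const _
  have := ge_of_tendsto' hl (fun j => all j z h hz hh)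
  simpa using this

/-- Local estimate, global data -/
lemma LL_global {α : ℝ} (hα : α ∈ Ioo (0:ℝ) 1) : ∃ ε C : ℝ, 0 < ε ∧ 0 < C ∧ ∀ v G G1 G0,
    LD v G G1 G0 ε → (∀ z e, ‖z‖ ≤ 1 / 2 → |fderiv ℝ v z e| ≤ C * ‖e‖) ∧
     ∀ z z' e, ‖z‖ ≤ 1 / 2 → ‖z'‖ ≤ 1 / 2 → ‖z' - z‖ ≤ 1 / 8 →
      |fderiv ℝ v z' e - fderiv ℝ v z e| ≤ C * ‖z' - z‖ ^ α * ‖e‖ := by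
  obtain ⟨ε, K, hε, hK, H⟩ := PP_limit hα
  have hα0 := hα.1
  refine ⟨ε, 8 + 24 * K, hε, by positivity, ?_⟩
  intro v G G1 G0 hd
  have hP := H v G G1 G0 hd
  have hR : ∀ z h : ℝ × ℝ, ‖z‖ ≤ 1 / 2 → ‖h‖ ≤ 1 / 4 →
      |v (z + h) - v z - fderiv ℝ v z h| ≤ 4 * K * ‖h‖ ^ (1 + α) := by
    intro z h hz hh
    refine (hP z h (by linarith) (by linarith)).trans ?_
    have h1 := rpow_scale hα (c := 1/2) (d := 1) (by norm_num) (by norm_num) (by norm_num)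
    have h2 : ((1 - ‖z‖) ^ (1 + α))⁻¹ ≤ 4 := by
      have h0 : (0:ℝ) < 1 / 2 * 1 := by positivity
      have := rpow_pos_of_pos h0 (1 + α)
      calc _ ≤ (((1:ℝ) / 2 * 1) ^ (1 + α))⁻¹ := by
            gcongr
            linarith
        _ ≤ 4 := by
            refine h1.trans ?_
            norm_num
    have : 0 ≤ ‖h‖ ^ (1 + α) := by positivity
    calc _ ≤ K * 4 * ‖h‖ ^ (1 + α) := by gcongr
      _ = _ := by ring
  constructor
  · intro z e hz
    by_cases he : e = 0
    · subst he; simp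
    have he0 := norm_pos_iff.2 he
    set s : ℝ := 1 / (4 * ‖e‖) with hs
    have hs0 : 0 < s := by positivity
    have hn : ‖s • e‖ = 1 / 4 := by
      rw [norm_smul, Real.norm_of_nonneg hs0.le, hs]; field_simp
    have h1 := hR z (s • e) hz hn.le
    have h2 := hd.bv z (by linarith)
    have h3 := hd.bv (z + s • e) (lt_of_le_of_lt (norm_add_le _ _) (by linarith))
    have h4 : 4 * K * ‖s • e‖ ^ (1 + α) ≤ 4 * K * (1 / 4) := by
      rw [hn]
      gcongr
      have := rpow_le_rpow_of_exponent_ge (by norm_num : (0:ℝ) < 1/4) (by norm_num) (by linarith : (1:ℝ) ≤ 1 + α)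
      rwa [rpow_one] at this
    have h5 := h1.trans h4
    rw [map_smul, smul_eq_mul] at h5
    have h6 : |s * fderiv ℝ v z e| ≤ 2 + K := by
      rw [abs_le] at *
      constructor <;> linarith [h2.1, h2.2, h3.1, h3.2, h5.1, h5.2]
    rw [abs_mul, abs_of_pos hs0] at h6
    have h7 : |fderiv ℝ v z e| = (s * |fderiv ℝ v z e|) * (4 * ‖e‖) := by rw [hs]; field_simp
    rw [h7]
    nlinarith
  · intro z z' e hz hz' ht
    set k := z' - z with hk
    by_cases hk0 : k = 0
    · have : z' = z := sub_eq_zero.1 hk0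
      subst this
      simp
      positivity
    have hkp := norm_pos_iff.2 hk0
    by_cases he : e = 0
    · subst he; simp
    have he0 := norm_pos_iff.2 he
    set s : ℝ := ‖k‖ / ‖e‖ with hs
    have hs0 : 0 < s := by positivity
    have hn : ‖s • e‖ = ‖k‖ := by
      rw [norm_smul, Real.norm_of_nonneg hs0.le, hs]; field_simp
    have hz'e : z' = z + k := by rw [hk]; abel
    have hke := norm_add_le k (s • e)
    have r1 := hR z (k + s • e) hz (by linarith)
    have r2 := hR z k hz (by linarith)
    have r3 := hR z' (s • e) hz' (by linarith)
    rw [hn] at r3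
    have r4 : ‖k + s • e‖ ^ (1 + α) ≤ 4 * ‖k‖ ^ (1 + α) := by
      have : ‖k + s • e‖ ≤ 2 * ‖k‖ := by linarith
      calc _ ≤ (2 * ‖k‖) ^ (1 + α) := rpow_le_rpow (norm_nonneg _) this (by linarith)
        _ ≤ _ := by
          rw [mul_rpow (by norm_num) hkp.le]
          have : (2:ℝ) ^ (1 + α) ≤ 2 ^ (2:ℝ) := rpow_le_rpow_of_exponent_le (by norm_num) (by linarith [hα.2])
          norm_num at this
          gcongr
    have kp := rpow_pos_of_pos hkp (1 + α)
    have r5 : |s * (fderiv ℝ v z' e - fderiv ℝ v z e)| ≤ 24 * K * ‖k‖ ^ (1 + α) := by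
      have r1' : |v (z + (k + s • e)) - v z - fderiv ℝ v z (k + s • e)| ≤ 16 * K * ‖k‖ ^ (1 + α) := by
        refine r1.trans ?_
        nlinarith
      rw [map_add, map_smul, smul_eq_mul, ← add_assoc, ← hz'e] at r1'
      rw [← hz'e] at r2
      rw [map_smul, smul_eq_mul] at r3
      rw [abs_le] at *
      constructor <;> linarith [r1'.1, r1'.2, r2.1, r2.2, r3.1, r3.2]
    rw [abs_mul, abs_of_pos hs0] at r5
    have h7 : |fderiv ℝ v z' e - fderiv ℝ v z e| = (s * |fderiv ℝ v z' e - fderiv ℝ v z e|) * (‖e‖ / ‖k‖) := by rw [hs]; field_simp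
    rw [h7]
    calc _ ≤ (24 * K * ‖k‖ ^ (1 + α)) * (‖e‖ / ‖k‖) := by gcongr
      _ = 24 * K * ‖k‖ ^ α * ‖e‖ := by rw [rpow_add hkp, rpow_one]; field_simp
      _ ≤ _ := by
        have : 0 < ‖k‖ ^ α := by positivity
        gcongr
        linarith

/-- cutoff extension -/
lemma extend {f : ℝ × ℝ → ℝ} {n : ℕ∞} (hf : ContDiffOn ℝ n f (Metric.ball 0 2)) :
    ∃ g : ℝ × ℝ → ℝ, ContDiff ℝ n g ∧ HasCompactSupport g ∧ ∀ z ∈ Metric.ball (0 : ℝ × ℝ) 1, g z = f z := by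
  let χ : ContDiffBump (0 : ℝ × ℝ) := ⟨1, 3 / 2, by norm_num, by norm_num⟩
  refine ⟨fun z => χ z * f z, ?_, χ.hasCompactSupport.mul_right, ?_⟩
  · rw [contDiff_iff_contDiffAt]
    intro z
    by_cases hz : z ∈ Metric.ball (0 : ℝ × ℝ) 2
    · exact χ.contDiff.contDiffAt.mul (hf.contDiffAt (Metric.isOpen_ball.mem_nhds hz))
    · have : z ∉ tsupport χ := by
        rw [χ.tsupport_eq]
        simp at hz ⊢
        have : χ.rOut = 3 / 2 := rfl
        rw [this]
        linarith
      have h2 : (fun z => χ z * f z) =ᶠ[𝓝 z] fun _ => 0 := by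
        have := notMem_tsupport_iff_eventuallyEq.1 this
        filter_upwards [this] with x hx
        simp [hx]
      exact contDiffAt_const.congr_of_eventuallyEq h2
  · intro z hz
    have : χ z = 1 := χ.one_of_mem_closedBall (Metric.ball_subset_closedBall hz)
    simp [this]

lemma pdx_congr {f g : ℝ × ℝ → ℝ} {z : ℝ × ℝ} (h : f =ᶠ[𝓝 z] g) : pdx f =ᶠ[𝓝 z] pdx g := by
  filter_upwards [h.fderiv (𝕜 := ℝ)] with x hx
  simp [pdx, hx]

lemma pdy_congr {f g : ℝ × ℝ → ℝ} {z : ℝ × ℝ} (h : f =ᶠ[𝓝 z] g) : pdy f =ᶠ[𝓝 z] pdy g := by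
  filter_upwards [h.fderiv (𝕜 := ℝ)] with x hx
  simp [pdy, hx]

/-- Local estimate -/
lemma LL {α : ℝ} (hα : α ∈ Ioo (0:ℝ) 1) : ∃ ε C : ℝ, 0 < ε ∧ 0 < C ∧ ∀ v G G1 : ℝ × ℝ → ℝ,
    ContDiffOn ℝ 2 v (Metric.ball 0 2) → ContDiffOn ℝ 2 G (Metric.ball 0 2) →
    ContDiffOn ℝ 1 G1 (Metric.ball 0 2) → 
    (∀ z, ‖z‖ < 1 → |v z| ≤ 1) → 
    (∀ z, ‖z‖ < 1 → |pdx (pdx v) z + pdy (pdy v) z - pdx (pdx G) z - pdx G1 z| ≤ 1) →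
    (∀ z k, ‖z‖ + ‖k‖ < 1 →
    |dd G z k| ≤ ε * (|dd v z k| + ‖k‖ ^ 2 + |v (z + k) - v z| ^ 2 + |v (z - k) - v z| ^ 2)) →
    (∀ z k, ‖z‖ + ‖k‖ < 1 → |G1 (z + k) - G1 z| ≤ ε * (|v (z + k) - v z| + ‖k‖)) →
    (∀ z e, ‖z‖ ≤ 1 / 2 → |fderiv ℝ v z e| ≤ C * ‖e‖) ∧
     ∀ z z' e, ‖z‖ ≤ 1 / 2 → ‖z'‖ ≤ 1 / 2 → ‖z' - z‖ ≤ 1 / 8 →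
      |fderiv ℝ v z' e - fderiv ℝ v z e| ≤ C * ‖z' - z‖ ^ α * ‖e‖ := by
  obtain ⟨ε, C, hε, hC, H⟩ := LL_global hα
  refine ⟨ε, C, hε, hC, ?_⟩
  intro v G G1 hv hG hG1 bv beq bG bG1
  obtain ⟨v', cv, sv, ev⟩ := extend (n := 2) hv
  obtain ⟨G', cG, sG, eG⟩ := extend (n := 2) hG
  obtain ⟨G1', cG1, sG1, eG1⟩ := extend (n := 1) hG1
  have cvx : ContDiff ℝ 1 (pdx v') := pdx_contDiff (n := 1) cv
  have cvy : ContDiff ℝ 1 (pdy v') := pdy_contDiff (n := 1) cv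
  have cGx : ContDiff ℝ 1 (pdx G') := pdx_contDiff (n := 1) cG
  have nb : ∀ {f g : ℝ × ℝ → ℝ}, (∀ z ∈ Metric.ball (0 : ℝ × ℝ) 1, f z = g z) → ∀ z : ℝ × ℝ, ‖z‖ < 1 → f =ᶠ[𝓝 z] g := by
    intro f g h z hz
    filter_upwards [Metric.isOpen_ball.mem_nhds (show z ∈ Metric.ball (0 : ℝ × ℝ) 1 by simpa using hz)] with x hx using h x hx
  have ev' : ∀ z, ‖z‖ < 1 → v' z = v z := fun z hz => ev z (by simpa using hz)
  have eG' : ∀ z, ‖z‖ < 1 → G' z = G z := fun z hz => eG z (by simpa using hz)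
  have eG1' : ∀ z, ‖z‖ < 1 → G1' z = G1 z := fun z hz => eG1 z (by simpa using hz)
  have hlt : ∀ z k : ℝ × ℝ, ‖z‖ + ‖k‖ < 1 → ‖z‖ < 1 ∧ ‖z + k‖ < 1 ∧ ‖z - k‖ < 1 := fun z k h =>
    ⟨by linarith [norm_nonneg k], (norm_add_le _ _).trans_lt h, (norm_sub_le _ _).trans_lt h⟩
  have := H v' G' G1' (fun z => pdx (pdx v') z + pdy (pdy v') z - pdx (pdx G') z - pdx G1' z)
    { hv := cv, hG := cG, hG1 := cG1
      hG0 := (((pdx_contDiff (n := 0) cvx).continuous.add (pdy_contDiff (n := 0) cvy).continuous).sub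
        (pdx_contDiff (n := 0) cGx).continuous).sub (pdx_contDiff (n := 0) cG1).continuous
      heq := fun z => by ring
      hvc := sv
      bv := fun z hz => by rw [ev' z hz]; exact bv z hz
      bG0 := fun z hz => by
        have a1 := (pdx_congr (pdx_congr (nb ev z hz))).eq_of_nhds
        have a2 := (pdy_congr (pdy_congr (nb ev z hz))).eq_of_nhds
        have a3 := (pdx_congr (pdx_congr (nb eG z hz))).eq_of_nhds
        have a4 := (pdx_congr (nb eG1 z hz)).eq_of_nhds
        rw [a1, a2, a3, a4]
        exact beq z hz
      bG := fun z k h => by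
        obtain ⟨h1, h2, h3⟩ := hlt z k h
        have := bG z k h
        unfold dd at *
        rw [ev' _ h1, ev' _ h2, ev' _ h3, eG' _ h1, eG' _ h2, eG' _ h3]
        exact this
      bG1 := fun z k h => by
        obtain ⟨h1, h2, h3⟩ := hlt z k h
        rw [ev' _ h1, ev' _ h2, eG1' _ h1, eG1' _ h2]
        exact bG1 z k h }
  have fd : ∀ z, ‖z‖ ≤ 1 / 2 → fderiv ℝ v' z = fderiv ℝ v z := fun z hz =>
    (nb ev z (by linarith)).fderiv_eq
  constructor
  · intro z e hz
    rw [← fd z hz]; exact this.1 z e hz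
  · intro z z' e hz hz' h
    rw [← fd z hz, ← fd z' hz']; exact this.2 z z' e hz hz' h

end S15
end

section
open Real Set Filter Topology
namespace S15

lemma test1d {g g' : ℝ → ℝ} {t₀ c : ℝ} (h1 : ∀ᶠ t in 𝓝 t₀, HasDerivAt g (g' t) t)
    (h2 : HasDerivAt g' c t₀) (hm : IsLocalMin g t₀) : g' t₀ = 0 ∧ 0 ≤ c := by
  have h0 : g' t₀ = 0 := hm.hasDerivAt_eq_zero h1.self_of_nhds
  refine ⟨h0, ?_⟩
  by_contra hc
  push Not at hc
  have ed : deriv g =ᶠ[𝓝 t₀] g' := by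
    filter_upwards [h1] with t ht using ht.deriv
  have hdd : deriv (deriv g) t₀ = c := by
    rw [ed.deriv_eq, h2.deriv]
  have hmax : IsLocalMax g t₀ := by
    apply isLocalMax_of_deriv_deriv_neg
    · rw [hdd]; exact hc
    · rw [ed.eq_of_nhds, h0]
    · exact h1.self_of_nhds.continuousAt
  have hconst : g =ᶠ[𝓝 t₀] fun _ => g t₀ := by
    filter_upwards [hmax, hm] with t a b using le_antisymm a b
  have : deriv (deriv g) t₀ = 0 := by
    have := hconst.deriv
    rw [this.deriv_eq]
    simp
  linarith

lemma mp {f fx fxx fy fyy : ℝ × ℝ → ℝ} {δ y₀ ρ : ℝ} (hδ : 0 < δ) (hρ : 0 < ρ)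
    (hc : ContinuousOn f (Icc 0 δ ×ˢ Icc (y₀ - ρ) (y₀ + ρ)))
    (hx : ∀ z ∈ Ioo 0 δ ×ˢ Ioo (y₀ - ρ) (y₀ + ρ), HasDerivAt (fun t => f (t, z.2)) (fx z) z.1)
    (hxx : ∀ z ∈ Ioo 0 δ ×ˢ Ioo (y₀ - ρ) (y₀ + ρ), HasDerivAt (fun t => fx (t, z.2)) (fxx z) z.1)
    (hy : ∀ z ∈ Ioo 0 δ ×ˢ Ioo (y₀ - ρ) (y₀ + ρ), HasDerivAt (fun t => f (z.1, t)) (fy z) z.2)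
    (hyy : ∀ z ∈ Ioo 0 δ ×ˢ Ioo (y₀ - ρ) (y₀ + ρ), HasDerivAt (fun t => fy (z.1, t)) (fyy z) z.2)
    (b0 : ∀ y ∈ Icc (y₀ - ρ) (y₀ + ρ), 0 ≤ f (0, y))
    (b1 : ∀ y ∈ Icc (y₀ - ρ) (y₀ + ρ), 0 ≤ f (δ, y))
    (b2 : ∀ x ∈ Icc 0 δ, 0 ≤ f (x, y₀ - ρ))
    (b3 : ∀ x ∈ Icc 0 δ, 0 ≤ f (x, y₀ + ρ))
    (hint : ∀ z ∈ Ioo 0 δ ×ˢ Ioo (y₀ - ρ) (y₀ + ρ), f z < 0 → fx z = 0 → 0 ≤ fxx z → 0 ≤ fyy z → False) :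
    ∀ z ∈ Icc 0 δ ×ˢ Icc (y₀ - ρ) (y₀ + ρ), 0 ≤ f z := by
  have hK : IsCompact (Icc 0 δ ×ˢ Icc (y₀ - ρ) (y₀ + ρ)) := isCompact_Icc.prod isCompact_Icc
  obtain ⟨z, hz, hmin⟩ := hK.exists_isMinOn ⟨(0, y₀), ⟨⟨le_rfl, hδ.le⟩, ⟨by simp; linarith, by simp; linarith⟩⟩⟩ hc
  intro w hw
  refine le_trans ?_ (hmin hw)
  by_contra hneg
  push Not at hneg
  obtain ⟨zx, zy⟩ := z
  obtain ⟨⟨hx0, hx1⟩, hy0, hy1⟩ := hz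
  simp only at hx0 hx1 hy0 hy1
  have n0 : zx ≠ 0 := by rintro rfl; linarith [b0 zy ⟨hy0, hy1⟩]
  have n1 : zx ≠ δ := by rintro rfl; linarith [b1 zy ⟨hy0, hy1⟩]
  have n2 : y₀ - ρ ≠ zy := by intro h; rw [← h] at hneg; linarith [b2 zx ⟨hx0, hx1⟩]
  have n3 : zy ≠ y₀ + ρ := by intro h; rw [h] at hneg; linarith [b3 zx ⟨hx0, hx1⟩]
  have hx0' : 0 < zx := lt_of_le_of_ne hx0 (Ne.symm n0)
  have hx1' : zx < δ := lt_of_le_of_ne hx1 n1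
  have hy0' : y₀ - ρ < zy := lt_of_le_of_ne hy0 n2
  have hy1' : zy < y₀ + ρ := lt_of_le_of_ne hy1 n3
  have hI : (zx, zy) ∈ Ioo 0 δ ×ˢ Ioo (y₀ - ρ) (y₀ + ρ) := ⟨⟨hx0', hx1'⟩, hy0', hy1'⟩
  have nx : Ioo 0 δ ∈ 𝓝 zx := Ioo_mem_nhds hx0' hx1'
  have ny : Ioo (y₀ - ρ) (y₀ + ρ) ∈ 𝓝 zy := Ioo_mem_nhds hy0' hy1'
  have t1 := test1d (g := fun t => f (t, zy)) (g' := fun t => fx (t, zy)) (t₀ := zx) (c := fxx (zx, zy))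
    (by filter_upwards [nx] with t ht using hx (t, zy) ⟨ht, hy0', hy1'⟩) (hxx _ hI)
    (by filter_upwards [nx] with t ht using hmin ⟨⟨ht.1.le, ht.2.le⟩, hy0, hy1⟩)
  have t2 := test1d (g := fun t => f (zx, t)) (g' := fun t => fy (zx, t)) (t₀ := zy) (c := fyy (zx, zy))
    (by filter_upwards [ny] with t ht using hy (zx, t) ⟨⟨hx0', hx1'⟩, ht⟩) (hyy _ hI)
    (by filter_upwards [ny] with t ht using hmin ⟨⟨hx0, hx1⟩, ht.1.le, ht.2.le⟩)
  exact hint _ hI hneg t1.1 t1.2 t2.2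

lemma line_x {F : ℝ × ℝ → ℝ} {z : ℝ × ℝ} (h : DifferentiableAt ℝ F z) :
    HasDerivAt (fun t => F (t, z.2)) (pdx F z) z.1 := by
  have h1 : HasDerivAt (fun t : ℝ => (t, z.2)) ((1:ℝ), (0:ℝ)) z.1 :=
    (hasDerivAt_id z.1).prodMk (hasDerivAt_const z.1 z.2)
  have h2 : HasFDerivAt F (fderiv ℝ F z) ((fun t : ℝ => (t, z.2)) z.1) := h.hasFDerivAt
  exact h2.comp_hasDerivAt z.1 h1

lemma line_y {F : ℝ × ℝ → ℝ} {z : ℝ × ℝ} (h : DifferentiableAt ℝ F z) :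
    HasDerivAt (fun t => F (z.1, t)) (pdy F z) z.2 := by
  have h1 : HasDerivAt (fun t : ℝ => (z.1, t)) ((0:ℝ), (1:ℝ)) z.2 :=
    (hasDerivAt_const z.2 z.1).prodMk (hasDerivAt_id z.2)
  have h2 : HasFDerivAt F (fderiv ℝ F z) ((fun t : ℝ => (z.1, t)) z.2) := h.hasFDerivAt
  exact h2.comp_hasDerivAt z.2 h1

lemma pdx_cdAt {F : ℝ × ℝ → ℝ} {z : ℝ × ℝ} (h : ContDiffAt ℝ 2 F z) : ContDiffAt ℝ 1 (pdx F) z := by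
  unfold pdx
  exact (h.fderiv_right (m := 1) (by norm_num)).clm_apply contDiffAt_const

lemma pdy_cdAt {F : ℝ × ℝ → ℝ} {z : ℝ × ℝ} (h : ContDiffAt ℝ 2 F z) : ContDiffAt ℝ 1 (pdy F) z := by
  unfold pdy
  exact (h.fderiv_right (m := 1) (by norm_num)).clm_apply contDiffAt_const

lemma lines {F : ℝ × ℝ → ℝ} {z : ℝ × ℝ} (h : ContDiffAt ℝ 2 F z) :
    HasDerivAt (fun t => F (t, z.2)) (pdx F z) z.1 ∧ HasDerivAt (fun t => pdx F (t, z.2)) (pdx (pdx F) z) z.1 ∧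
    HasDerivAt (fun t => F (z.1, t)) (pdy F z) z.2 ∧ HasDerivAt (fun t => pdy F (z.1, t)) (pdy (pdy F) z) z.2 :=
  ⟨line_x (h.differentiableAt (by simp)), line_x ((pdx_cdAt h).differentiableAt (by simp)),
   line_y (h.differentiableAt (by simp)), line_y ((pdy_cdAt h).differentiableAt (by simp))⟩

/-- open half-strip -/
def Om (a R : ℝ) : Set (ℝ × ℝ) := {z | 0 < z.1 ∧ z.1 < a ∧ |z.2| < R}

lemma Om_open (a R : ℝ) : IsOpen (Om a R) := by
  unfold Om
  apply IsOpen.inter (isOpen_lt continuous_const continuous_fst)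
  exact IsOpen.inter (isOpen_lt continuous_fst continuous_const)
    (isOpen_lt (continuous_snd.abs) continuous_const)

structure NS (F : ℝ × ℝ → ℝ) (a R : ℝ) : Prop where
  ha : 0 < a
  ha4 : a ≤ 1 / 4
  hR : 0 < R
  c2 : ContDiffOn ℝ 2 F (Om a R)
  cont : ContinuousOn F {z | 0 ≤ z.1 ∧ z.1 < a ∧ |z.2| < R}
  zero : ∀ y, |y| < R → F (0, y) = 0
  pos : ∀ z ∈ Om a R, 0 < F z
  lt : ∀ z ∈ Om a R, F z < 2 * z.1 - z.1 ^ 2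
  pde : ∀ z ∈ Om a R, (2 * z.1 - F z - z.1 ^ 2) * pdx (pdx F) z
    + (1 - F z) / (1 - z.1) ^ 2 * pdy (pdy F) z
    + (1 - 4 * z.1 + 2 * z.1 ^ 2 + F z) / (1 - z.1) * pdx F z
    - (1 - z.1) ^ 2 / (1 - F z) * (pdx F z) ^ 2 = 0

/-- the good unknown -/
noncomputable def Vf (F : ℝ × ℝ → ℝ) (z : ℝ × ℝ) : ℝ := (F z - z.1) / (1 - z.1)

lemma NS.cdAt {F : ℝ × ℝ → ℝ} {a R : ℝ} (h : NS F a R) {z : ℝ × ℝ} (hz : z ∈ Om a R) : ContDiffAt ℝ 2 F z :=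
  h.c2.contDiffAt ((Om_open a R).mem_nhds hz)

lemma NS.Vc2 {F : ℝ × ℝ → ℝ} {a R : ℝ} (h : NS F a R) {z : ℝ × ℝ} (hz : z ∈ Om a R) :
    ContDiffAt ℝ 2 (Vf F) z := by
  unfold Vf
  have hz1 : 1 - z.1 ≠ 0 := by have := hz.2.1; have := h.ha4; linarith
  exact ((h.cdAt hz).sub contDiffAt_fst).div (contDiffAt_const.sub contDiffAt_fst) hz1

lemma NS.Vbounds {F : ℝ × ℝ → ℝ} {a R : ℝ} (h : NS F a R) {z : ℝ × ℝ} (hz : z ∈ Om a R) :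
    Vf F z < z.1 ∧ -(z.1) / (1 - z.1) < Vf F z := by
  have h1 : 0 < 1 - z.1 := by have := hz.2.1; have := h.ha4; linarith
  unfold Vf
  constructor
  · rw [div_lt_iff₀ h1]; nlinarith [h.lt z hz]
  · rw [div_lt_div_iff_of_pos_right h1]; linarith [h.pos z hz]

lemma NS.rel {F : ℝ × ℝ → ℝ} {a R : ℝ} (h : NS F a R) {z : ℝ × ℝ} (hz : z ∈ Om a R) :
    F z = z.1 + (1 - z.1) * Vf F z ∧ pdx F z = 1 - Vf F z + (1 - z.1) * pdx (Vf F) z ∧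
    pdy F z = (1 - z.1) * pdy (Vf F) z ∧
    pdx (pdx F) z = - 2 * pdx (Vf F) z + (1 - z.1) * pdx (pdx (Vf F)) z ∧
    pdy (pdy F) z = (1 - z.1) * pdy (pdy (Vf F)) z := by
  have r0 : ∀ w ∈ Om a R, F w = w.1 + (1 - w.1) * Vf F w := by
    intro w hw
    have h1 : 1 - w.1 ≠ 0 := by have := hw.2.1; have := h.ha4; linarith
    unfold Vf; field_simp; ring
  have nb : ∀ w ∈ Om a R, (∀ᶠ t in 𝓝 w.1, (t, w.2) ∈ Om a R) ∧ (∀ᶠ t in 𝓝 w.2, (w.1, t) ∈ Om a R) := by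
    intro w hw
    constructor
    · have : ContinuousAt (fun t : ℝ => (t, w.2)) w.1 := by fun_prop
      exact this.eventually_mem ((Om_open a R).mem_nhds hw)
    · have : ContinuousAt (fun t : ℝ => (w.1, t)) w.2 := by fun_prop
      exact this.eventually_mem ((Om_open a R).mem_nhds hw)
  have r1 : ∀ w ∈ Om a R, pdx F w = 1 - Vf F w + (1 - w.1) * pdx (Vf F) w := by
    intro w hw
    have d1 := (lines (h.cdAt hw)).1
    have d2 := (lines (h.Vc2 hw)).1
    have d3 : HasDerivAt (fun t => t + (1 - t) * Vf F (t, w.2)) (1 + (-1 * Vf F w + (1 - w.1) * pdx (Vf F) w)) w.1 :=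
      (hasDerivAt_id w.1).add (((hasDerivAt_id w.1).const_sub 1).mul d2)
    have := d1.unique (d3.congr_of_eventuallyEq (by
      filter_upwards [(nb w hw).1] with t ht using r0 _ ht))
    rw [this]; ring
  have r2 : ∀ w ∈ Om a R, pdy F w = (1 - w.1) * pdy (Vf F) w := by
    intro w hw
    have d1 := (lines (h.cdAt hw)).2.2.1
    have d2 := (lines (h.Vc2 hw)).2.2.1
    have d3 := (d2.const_mul (1 - w.1)).const_add w.1
    exact d1.unique (d3.congr_of_eventuallyEq (by
      filter_upwards [(nb w hw).2] with t ht using r0 _ ht))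
  refine ⟨r0 z hz, r1 z hz, r2 z hz, ?_, ?_⟩
  · have d1 := (lines (h.cdAt hz)).2.1
    have d2 := (lines (h.Vc2 hz)).2.1
    have d0 := (lines (h.Vc2 hz)).1
    have d3 : HasDerivAt (fun t => 1 - Vf F (t, z.2) + (1 - t) * pdx (Vf F) (t, z.2))
       (- pdx (Vf F) z + (-1 * pdx (Vf F) z + (1 - z.1) * pdx (pdx (Vf F)) z)) z.1 :=
      (d0.const_sub 1).add (((hasDerivAt_id z.1).const_sub 1).mul d2)
    have := d1.unique (d3.congr_of_eventuallyEq (by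
      filter_upwards [(nb z hz).1] with t ht using r1 _ ht))
    rw [this]; ring
  · have d1 := (lines (h.cdAt hz)).2.2.2
    have d2 := (lines (h.Vc2 hz)).2.2.2
    have d3 := (d2.const_mul (1 - z.1))
    exact d1.unique (d3.congr_of_eventuallyEq (by
      filter_upwards [(nb z hz).2] with t ht using r2 _ ht))

lemma NS.Vpde {F : ℝ × ℝ → ℝ} {a R : ℝ} (h : NS F a R) {z : ℝ × ℝ} (hz : z ∈ Om a R) :
    pdy (pdy (Vf F)) z + (1 - z.1) ^ 2 * (z.1 - Vf F z) / (1 - Vf F z) * pdx (pdx (Vf F)) z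
     - (1 - z.1) * (3 - 2 * (1 - z.1) / (1 - Vf F z)) * pdx (Vf F) z
     - (1 - z.1) ^ 3 * (pdx (Vf F) z) ^ 2 / (1 - Vf F z) ^ 2 + Vf F z - z.1 = 0 := by
  obtain ⟨e0, e1, e2, e3, e4⟩ := h.rel hz
  have hp := h.pde z hz
  have hb := h.Vbounds hz
  have h1 : 0 < 1 - z.1 := by have := hz.2.1; have := h.ha4; linarith
  have h2 : 0 < 1 - Vf F z := by linarith
  rw [e1, e3, e4, e0] at hp
  generalize Vf F z = v at *
  generalize pdx (Vf F) z = p at *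
  generalize pdx (pdx (Vf F)) z = q at *
  generalize pdy (pdy (Vf F)) z = s at *
  generalize z.1 = x at *
  rw [show 1 - (x + (1 - x) * v) = (1 - x) * (1 - v) by ring] at hp
  have hx := h1.ne'
  have hv := h2.ne'
  have key : ∀ G : ℝ, (1 - v) * G = 0 → G = 0 := fun G hG => (mul_eq_zero.mp hG).resolve_left hv
  apply key
  rw [← hp]
  field_simp
  ring

end S15
end

section
open Real Set Filter Topology
namespace S15

lemma Om_mem {a R x y : ℝ} (h0 : 0 < x) (h1 : x < a) (h2 : |y| < R) : (x, y) ∈ Om a R := ⟨h0, h1, h2⟩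

lemma low_int {ε x F q s : ℝ} (hε0 : 0 < ε) (hε1 : ε ≤ 1 / 8) (hx0 : 0 < x) (hx8 : x < 1 / 8) (hF0 : 0 < F)
    (hF1 : F < 2 * x - x ^ 2) (hFε : F ≤ ε * x) (h3 : 0 ≤ q) (h4 : 0 ≤ s + ε / 8)
    (hp : (2 * x - F - x ^ 2) * q + (1 - F) / (1 - x) ^ 2 * s + (1 - 4 * x + 2 * x ^ 2 + F) / (1 - x) * ε
      - (1 - x) ^ 2 / (1 - F) * ε ^ 2 = 0) : False := by
  have hF64 : F ≤ 1 / 64 := by nlinarith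
  have hA0 : 0 ≤ (1 - F) / (1 - x) ^ 2 := div_nonneg (by linarith) (sq_nonneg _)
  have hA1 : (1 - F) / (1 - x) ^ 2 ≤ 64 / 49 := by
    rw [div_le_div_iff₀ (by nlinarith) (by norm_num)]; nlinarith
  have hB : 1 / 2 ≤ (1 - 4 * x + 2 * x ^ 2 + F) / (1 - x) := by
    rw [le_div_iff₀ (by linarith)]; nlinarith
  have hC : (1 - x) ^ 2 / (1 - F) ≤ 64 / 63 := by
    rw [div_le_div_iff₀ (by linarith) (by norm_num)]; nlinarith
  have hC0 : 0 ≤ (1 - x) ^ 2 / (1 - F) := div_nonneg (sq_nonneg _) (by linarith)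
  generalize (1 - F) / (1 - x) ^ 2 = A at *
  generalize (1 - 4 * x + 2 * x ^ 2 + F) / (1 - x) = B at *
  generalize (1 - x) ^ 2 / (1 - F) = D at *
  have t1 : 0 ≤ (2 * x - F - x ^ 2) * q := mul_nonneg (by linarith) h3
  have t2 : - (64 / 49 * (ε / 8)) ≤ A * s := by
    have := mul_nonneg hA0 h4
    have := mul_le_mul_of_nonneg_right hA1 hε0.le
    linarith
  have t3 : 1 / 2 * ε ≤ B * ε := mul_le_mul_of_nonneg_right hB hε0.le
  have t4 : D * ε ^ 2 ≤ 64 / 63 * (1 / 8 * ε) := by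
    apply mul_le_mul hC (by nlinarith) (sq_nonneg _) (by norm_num)
  linarith

lemma NS.lower {F : ℝ × ℝ → ℝ} {a R R' : ℝ} (h : NS F a R) (hR' : R' < R) : ∃ ε δ : ℝ, 0 < ε ∧ ε ≤ 1 ∧ 0 < δ ∧ δ < a ∧
    ∀ x y, 0 ≤ x → x ≤ δ → |y| ≤ R' → ε * x ≤ F (x, y) := by
  by_cases hneg : R' < 0
  · refine ⟨1, a / 2, one_pos, le_rfl, by linarith [h.ha], by linarith [h.ha], ?_⟩
    intro x y _ _ hy
    linarith [abs_nonneg y]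
  push Not at hneg
  have ha := h.ha
  have ha4 := h.ha4
  set ρ : ℝ := (R - R') / 2 with hρ
  have hρ0 : 0 < ρ := by rw [hρ]; linarith
  obtain ⟨δ, hδ0, hδ1, hδ2, hδ3⟩ : ∃ δ : ℝ, 0 < δ ∧ δ ≤ 1 / 8 ∧ δ ≤ ρ ^ 2 / 16 ∧ δ < a :=
    ⟨min (1/8) (min (ρ ^ 2 / 16) (a / 2)), by positivity, min_le_left _ _,
      (min_le_right _ _).trans (min_le_left _ _), ((min_le_right _ _).trans (min_le_right _ _)).trans_lt (by linarith)⟩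
  have hRρ : R' + ρ < R := by rw [hρ]; linarith
  have hcl : ∀ y, |y| ≤ R' + ρ → (δ, y) ∈ Om a R := fun y hy => Om_mem hδ0 hδ3 (by linarith)
  obtain ⟨y1, hy1, hmin⟩ := (isCompact_Icc (a := -(R' + ρ)) (b := R' + ρ)).exists_isMinOn
    ⟨0, by constructor <;> linarith⟩ (f := fun y => F (δ, y)) (by
      apply ContinuousOn.comp h.cont (by fun_prop)
      intro y hy
      have := abs_le.mpr hy
      exact ⟨hδ0.le, hδ3, by linarith⟩)
  have hm : 0 < F (δ, y1) := h.pos _ (hcl _ (abs_le.mpr hy1))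
  obtain ⟨ε, hε0, hε1, hε2⟩ : ∃ ε : ℝ, 0 < ε ∧ ε ≤ 1 / 8 ∧ ε * δ ≤ F (δ, y1) := by
    refine ⟨min (1/8) (F (δ, y1) / δ), by positivity, min_le_left _ _, ?_⟩
    rw [← le_div_iff₀ hδ0]
    exact min_le_right _ _
  refine ⟨ε, δ, hε0, by linarith, hδ0, hδ3, ?_⟩
  intro x y hx0 hx1 hy
  have hin : ∀ t, t ∈ Icc (y - ρ) (y + ρ) → |t| ≤ R' + ρ := by
    intro t ht
    rw [abs_le] at hy ⊢
    constructor <;> linarith [ht.1, ht.2, hy.1, hy.2]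
  have hOm : ∀ z ∈ Ioo 0 δ ×ˢ Ioo (y - ρ) (y + ρ), z ∈ Om a R := by
    intro z hz
    exact ⟨hz.1.1, hz.1.2.trans hδ3, (hin z.2 ⟨hz.2.1.le, hz.2.2.le⟩).trans_lt hRρ⟩
  have hnn : ∀ s t, 0 ≤ s → s ≤ δ → t ∈ Icc (y - ρ) (y + ρ) → 0 ≤ F (s, t) := by
    intro s t hs hs1 ht
    rcases hs.eq_or_lt with rfl | hs
    · rw [h.zero t ((hin t ht).trans_lt hRρ)]
    · exact (h.pos _ ⟨hs, hs1.trans_lt hδ3, (hin t ht).trans_lt hRρ⟩).le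
  have key := mp (f := fun z => F z - ε * (z.1 - (z.2 - y) ^ 2 / 16)) (fx := fun z => pdx F z - ε)
    (fxx := fun z => pdx (pdx F) z) (fy := fun z => pdy F z + ε * (z.2 - y) / 8)
    (fyy := fun z => pdy (pdy F) z + ε / 8) (y₀ := y) hδ0 hρ0
    (by
      apply ContinuousOn.sub _ (by fun_prop)
      apply h.cont.mono
      intro z hz
      exact ⟨hz.1.1, hz.1.2.trans_lt hδ3, (hin z.2 hz.2).trans_lt hRρ⟩)
    (by
      intro z hz
      have := (lines (h.cdAt (hOm z hz))).1.sub ((((hasDerivAt_id z.1).sub_const ((z.2 - y) ^ 2 / 16))).const_mul ε)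
      exact this.congr_deriv (by ring))
    (by
      intro z hz
      exact (lines (h.cdAt (hOm z hz))).2.1.sub_const ε)
    (by
      intro z hz
      have := (lines (h.cdAt (hOm z hz))).2.2.1.sub ((((((hasDerivAt_id z.2).sub_const y).pow 2).div_const 16).const_sub z.1).const_mul ε)
      exact this.congr_deriv (by simp; ring))
    (by
      intro z hz
      have := (lines (h.cdAt (hOm z hz))).2.2.2.add ((((hasDerivAt_id z.2).sub_const y).const_mul ε).div_const 8)
      exact this.congr_deriv (by ring))
    (by
      intro t ht
      have := hnn 0 t le_rfl hδ0.le ht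
      simp only
      nlinarith [mul_nonneg hε0.le (sq_nonneg (t - y))])
    (by
      intro t ht
      have h1 : F (δ, y1) ≤ F (δ, t) := hmin (abs_le.mp (hin t ht))
      simp only
      nlinarith [mul_nonneg hε0.le (sq_nonneg (t - y))])
    (by
      intro s hs
      have := hnn s (y - ρ) hs.1 hs.2 ⟨le_rfl, by linarith⟩
      have h2 : s - (y - ρ - y) ^ 2 / 16 ≤ 0 := by
        have : (y - ρ - y) ^ 2 = ρ ^ 2 := by ring
        rw [this]; linarith [hs.2]
      simp only
      nlinarith [mul_nonneg hε0.le (neg_nonneg.mpr h2)])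
    (by
      intro s hs
      have := hnn s (y + ρ) hs.1 hs.2 ⟨by linarith, le_rfl⟩
      have h2 : s - (y + ρ - y) ^ 2 / 16 ≤ 0 := by
        have : (y + ρ - y) ^ 2 = ρ ^ 2 := by ring
        rw [this]; linarith [hs.2]
      simp only
      nlinarith [mul_nonneg hε0.le (neg_nonneg.mpr h2)])
    (by
      intro z hz h1 h2 h3 h4
      have hzO := hOm z hz
      have hFε : F z ≤ ε * z.1 := by
        have := mul_nonneg hε0.le (sq_nonneg (z.2 - y))
        linarith
      have hpx : pdx F z = ε := by linarith
      exact low_int hε0 hε1 hz.1.1 (hz.1.2.trans_le hδ1) (h.pos z hzO) (h.lt z hzO) hFε h3 h4 (hpx ▸ h.pde z hzO))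
  have := key (x, y) ⟨⟨hx0, hx1⟩, by simp; linarith, by simp; linarith⟩
  simp only [sub_self] at this
  linarith

lemma vpos {x v q s p α M N c η Y W : ℝ} (hα : α ∈ Ioo (0:ℝ) 1) (hη : 0 ≤ η) (hN : 0 ≤ N) (hM : 2 * N + 2 < M * c) (hc : 0 < c)
    (hc2 : 2 * c ≤ 1 - α - η - 2 * α * η) (hx0 : 0 < x) (hxc : x ≤ c) (hx4 : x < 1 / 4)
    (hW : W = x ^ α)
    (hq : q ≤ M * (1 + α) * α * (W / x)) (hp : p = M * (1 + α) * W + N * Y ^ 2) (hs : s ≤ 2 * N * x)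
    (hvx : v < x) (hv : M * W * x + N * x * Y ^ 2 < v)
    (heq : s + (1 - x) ^ 2 * (x - v) / (1 - v) * q - (1 - x) * (3 - 2 * (1 - x) / (1 - v)) * p - (1 - x) ^ 3 * p ^ 2 / (1 - v) ^ 2 + v - x = 0) : False := by
  obtain ⟨hα0, hα1⟩ := hα
  have hW0 : 0 < W := by rw [hW]; positivity
  have hWx : x ≤ W := by
    rw [hW]; nth_rewrite 1 [← rpow_one x]
    exact rpow_le_rpow_of_exponent_ge hx0 (by linarith) hα1.le
  have hM0 : 0 < M := by
    by_contra hh; push Not at hh; linarith [mul_nonpos_of_nonpos_of_nonneg hh hc.le]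
  have hp0 : M * (1 + α) * W ≤ p := by rw [hp]; linarith [mul_nonneg hN (sq_nonneg Y)]
  have hMW : 0 < M * (1 + α) * W := by positivity
  have hv0 : 0 < v := lt_of_le_of_lt (by positivity) hv
  have hA0 : 0 ≤ (1 - x) ^ 2 * (x - v) / (1 - v) := div_nonneg (mul_nonneg (sq_nonneg _) (by linarith)) (by linarith)
  have hA1 : (1 - x) ^ 2 * (x - v) / (1 - v) ≤ x := by
    rw [div_le_iff₀ (by linarith)]
    have : (1 - x) ^ 2 * (x - v) ≤ 1 * (x - v) := mul_le_mul_of_nonneg_right (by nlinarith) (by linarith)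
    nlinarith
  have hB : 1 - x ≤ (1 - x) * (3 - 2 * (1 - x) / (1 - v)) := by
    have : 2 * (1 - x) / (1 - v) ≤ 2 := by rw [div_le_iff₀ (by linarith)]; linarith
    nlinarith
  have hD : 0 ≤ (1 - x) ^ 3 * p ^ 2 / (1 - v) ^ 2 := by
    apply div_nonneg (mul_nonneg (pow_nonneg (by linarith) _) (sq_nonneg _)) (sq_nonneg _)
  generalize (1 - x) ^ 2 * (x - v) / (1 - v) = A at *
  generalize (1 - x) * (3 - 2 * (1 - x) / (1 - v)) = B at *
  generalize (1 - x) ^ 3 * p ^ 2 / (1 - v) ^ 2 = D at *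
  have t1 : A * q ≤ α * (M * (1 + α) * W) := by
    calc A * q ≤ A * (M * (1 + α) * α * (W / x)) := mul_le_mul_of_nonneg_left hq hA0
      _ ≤ x * (M * (1 + α) * α * (W / x)) := mul_le_mul_of_nonneg_right hA1 (by positivity)
      _ = _ := by field_simp
  have t2 : (1 - x) * (M * (1 + α) * W) ≤ B * p := by
    apply mul_le_mul hB hp0 hMW.le (by linarith)
  have t3 : (1 - x - α) * (M * (1 + α) * W) ≤ 2 * N * x := by linarith
  have : c ≤ 1 - x - α := by linarith [mul_nonneg hα0.le hη]
  have t4 : c * (M * W) ≤ (1 - x - α) * (M * (1 + α) * W) := by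
    have : M * W ≤ M * (1 + α) * W := by nlinarith [mul_pos hM0 hW0]
    apply mul_le_mul (by assumption) this (by positivity) (by linarith)
  have t5 : (2 * N + 2) * W < M * c * W := mul_lt_mul_of_pos_right hM hW0
  have t6 : (2 * N + 2) * x ≤ (2 * N + 2) * W := mul_le_mul_of_nonneg_left hWx (by linarith)
  linarith

lemma vneg {x v q s p α M N c η Y W : ℝ} (hα : α ∈ Ioo (0:ℝ) 1) (hη : 0 ≤ η) (hN : 0 ≤ N) (hM : 2 * N + 2 < M * c) (hc : 0 < c)
    (hc2 : 2 * c ≤ 1 - α - η - 2 * α * η) (hx0 : 0 < x) (hxc : x ≤ c) (hx4 : x < 1 / 4)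
    (hW : W = x ^ α)
    (hq : -(M * (1 + α) * α * (W / x)) ≤ q) (hp : -p = M * (1 + α) * W + N * Y ^ 2) (hs : -(2 * N * x) ≤ s)
    (hvx : - (η * x) ≤ v) (hv : v < -(M * W * x + N * x * Y ^ 2))
    (heq : s + (1 - x) ^ 2 * (x - v) / (1 - v) * q - (1 - x) * (3 - 2 * (1 - x) / (1 - v)) * p - (1 - x) ^ 3 * p ^ 2 / (1 - v) ^ 2 + v - x = 0) : False := by
  obtain ⟨hα0, hα1⟩ := hα
  have hW0 : 0 < W := by rw [hW]; positivity
  have hWx : x ≤ W := by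
    rw [hW]; nth_rewrite 1 [← rpow_one x]
    exact rpow_le_rpow_of_exponent_ge hx0 (by linarith) hα1.le
  have hM0 : 0 < M := by
    by_contra hh; push Not at hh; linarith [mul_nonpos_of_nonpos_of_nonneg hh hc.le]
  have hp0 : M * (1 + α) * W ≤ -p := by rw [hp]; linarith [mul_nonneg hN (sq_nonneg Y)]
  have hMW : 0 < M * (1 + α) * W := by positivity
  have hv0 : v < 0 := lt_of_lt_of_le hv (neg_nonpos.mpr (by positivity))
  have hη1 : η ≤ 1 := by linarith [mul_nonneg hα0.le hη]
  have hwη : M * W + N * Y ^ 2 ≤ η := by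
    have : (M * W + N * Y ^ 2) * x ≤ η * x := by linarith
    exact le_of_mul_le_mul_right this hx0
  have hpη : -p ≤ (1 + α) * η := by
    rw [hp]
    have := mul_le_mul_of_nonneg_left hwη (show 0 ≤ 1 + α by linarith)
    linarith [mul_nonneg hα0.le (mul_nonneg hN (sq_nonneg Y))]
  have hA0 : 0 ≤ (1 - x) ^ 2 * (x - v) / (1 - v) := div_nonneg (mul_nonneg (sq_nonneg _) (by linarith)) (by linarith)
  have hA1 : (1 - x) ^ 2 * (x - v) / (1 - v) ≤ (1 + η) * x := by
    rw [div_le_iff₀ (by linarith)]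
    have h1 : (1 - x) ^ 2 * (x - v) ≤ 1 * (x - v) := mul_le_mul_of_nonneg_right (by nlinarith) (by linarith)
    have h2 : 0 ≤ (1 + η) * x := by positivity
    nlinarith
  have hB : 1 - x ≤ (1 - x) * (3 - 2 * (1 - x) / (1 - v)) := by
    have : 2 * (1 - x) / (1 - v) ≤ 2 := by rw [div_le_iff₀ (by linarith)]; linarith
    nlinarith
  have hD : (1 - x) ^ 3 * p ^ 2 / (1 - v) ^ 2 ≤ (1 + α) * η * (-p) := by
    rw [div_le_iff₀ (by nlinarith)]
    have h1 : (1 - x) ^ 3 ≤ 1 := pow_le_one₀ (by linarith) (by linarith)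
    have h2 : p ^ 2 ≤ (1 + α) * η * (-p) := by
      have := mul_le_mul_of_nonneg_right hpη (show 0 ≤ -p by linarith)
      linarith
    have h3 : 0 ≤ (1 + α) * η * (-p) := le_trans (sq_nonneg p) h2
    have h4 : (1 - x) ^ 3 * p ^ 2 ≤ 1 * p ^ 2 := mul_le_mul_of_nonneg_right h1 (sq_nonneg _)
    have h5 : 1 ≤ (1 - v) ^ 2 := one_le_pow₀ (by linarith)
    linarith [le_mul_of_one_le_right h3 h5]
  generalize (1 - x) ^ 2 * (x - v) / (1 - v) = A at *
  generalize (1 - x) * (3 - 2 * (1 - x) / (1 - v)) = B at *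
  generalize (1 - x) ^ 3 * p ^ 2 / (1 - v) ^ 2 = D at *
  have t1 : - ((1 + η) * α * (M * (1 + α) * W)) ≤ A * q := by
    calc - ((1 + η) * α * (M * (1 + α) * W)) = -((1 + η) * x * (M * (1 + α) * α * (W / x))) := by field_simp
      _ ≤ - (A * (M * (1 + α) * α * (W / x))) := neg_le_neg (mul_le_mul_of_nonneg_right hA1 (by positivity))
      _ = A * (-(M * (1 + α) * α * (W / x))) := by ring
      _ ≤ _ := mul_le_mul_of_nonneg_left hq hA0
  have t2 : (1 - x) * (-p) ≤ B * (-p) := mul_le_mul_of_nonneg_right hB (by linarith)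
  have hk : 0 ≤ 1 - x - (1 + α) * η := by linarith [mul_nonneg hα0.le hη]
  have t3 : (1 - x - (1 + α) * η) * (M * (1 + α) * W) ≤ (1 - x - (1 + α) * η) * (-p) := mul_le_mul_of_nonneg_left hp0 hk
  have t3' : (1 - x - (1 + α) * η - (1 + η) * α) * (M * (1 + α) * W) ≤ (2 * N + 2) * x := by
    have := mul_le_mul_of_nonneg_right hη1 hx0.le
    linarith
  have hcc : c ≤ 1 - x - (1 + α) * η - (1 + η) * α := by linarith [mul_nonneg hα0.le hη]
  have t4 : c * (M * W) ≤ (1 - x - (1 + α) * η - (1 + η) * α) * (M * (1 + α) * W) := by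
    have : M * W ≤ M * (1 + α) * W := by nlinarith [mul_pos hM0 hW0]
    apply mul_le_mul hcc this (by positivity) (by linarith)
  have t5 : (2 * N + 2) * W < M * c * W := mul_lt_mul_of_pos_right hM hW0
  have t6 : (2 * N + 2) * x ≤ (2 * N + 2) * W := mul_le_mul_of_nonneg_left hWx (by linarith)
  linarith

end S15
end

section
open Real Set Filter Topology
namespace S15

lemma NS.barrier {F : ℝ × ℝ → ℝ} {a R R1 R2 α η c δ : ℝ} (h : NS F a R) (h12 : R1 < R2) (h2R : R2 < R)
    (hα : α ∈ Ioo (0:ℝ) 1) (hη : 0 ≤ η) (hc : 0 < c) (hc2 : 2 * c ≤ 1 - α - η - 2 * α * η) (hδ0 : 0 < δ) (hδa : δ < a) (hδc : δ ≤ c)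
    (hlow : ∀ x y, 0 < x → x ≤ δ → |y| ≤ R2 → -(η * x) ≤ Vf F (x, y)) :
    ∃ M : ℝ, 0 < M ∧ ∀ x y, 0 < x → x ≤ δ → |y| ≤ R1 → |Vf F (x, y)| ≤ M * x ^ (1 + α) := by
  obtain ⟨hα0, hα1⟩ := hα
  set ρ : ℝ := R2 - R1 with hρ
  have hρ0 : 0 < ρ := by rw [hρ]; linarith
  have ha4 := h.ha4
  obtain ⟨N, hN0, hN⟩ : ∃ N : ℝ, 0 ≤ N ∧ 2 ≤ N * ρ ^ 2 := ⟨2 / ρ ^ 2, by positivity, by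
    rw [div_mul_cancel₀ _ (by positivity)]⟩
  have hδα : 0 < δ ^ α := rpow_pos_of_pos hδ0 _
  obtain ⟨M, hM0, hM1, hM2⟩ : ∃ M : ℝ, 0 < M ∧ 2 * N + 2 < M * c ∧ 2 ≤ M * δ ^ α := by
    refine ⟨2 / δ ^ α + (2 * N + 3) / c, by positivity, ?_, ?_⟩
    · rw [add_mul, div_mul_cancel₀ _ hc.ne']
      have : 0 < 2 / δ ^ α * c := by positivity
      linarith
    · rw [add_mul, div_mul_cancel₀ _ hδα.ne']
      have : 0 < (2 * N + 3) / c * δ ^ α := by positivity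
      linarith
  refine ⟨M, hM0, ?_⟩
  intro x y hx0 hx1 hy
  have hin : ∀ t, t ∈ Icc (y - ρ) (y + ρ) → |t| ≤ R2 := by
    intro t ht
    rw [abs_le] at hy ⊢
    constructor <;> linarith [ht.1, ht.2, hy.1, hy.2]
  have hOm : ∀ z ∈ Ioo 0 δ ×ˢ Ioo (y - ρ) (y + ρ), z ∈ Om a R := by
    intro z hz
    exact ⟨hz.1.1, hz.1.2.trans hδa, (hin z.2 ⟨hz.2.1.le, hz.2.2.le⟩).trans_lt h2R⟩
  have hv2 : ∀ s t, 0 ≤ s → s ≤ δ → t ∈ Icc (y - ρ) (y + ρ) → |Vf F (s, t)| ≤ 2 * s := by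
    intro s t hs hs1 ht
    rcases hs.eq_or_lt with rfl | hs
    · have : Vf F (0, t) = 0 := by
        unfold Vf; rw [h.zero t ((hin t ht).trans_lt h2R)]; simp
      rw [this]; simp
    · have hb := h.Vbounds (z := (s, t)) ⟨hs, hs1.trans_lt hδa, (hin t ht).trans_lt h2R⟩
      simp only at hb
      have : -(2 * s) ≤ -s / (1 - s) := by
        rw [le_div_iff₀ (by linarith)]; nlinarith
      rw [abs_le]
      constructor <;> linarith
  have main : ∀ σ : ℝ, (σ = 1 ∨ σ = -1) → σ * Vf F (x, y) ≤ M * x ^ (1 + α) := by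
    intro σ hσ
    have hσ2 : ∀ s t, 0 ≤ s → s ≤ δ → t ∈ Icc (y - ρ) (y + ρ) → σ * Vf F (s, t) ≤ 2 * s := by
      intro s t hs hs1 ht
      have := abs_le.mp (hv2 s t hs hs1 ht)
      rcases hσ with rfl | rfl <;> linarith [this.1, this.2]
    have key := mp (f := fun z => M * z.1 ^ (1 + α) + N * z.1 * (z.2 - y) ^ 2 - σ * Vf F z)
      (fx := fun z => M * ((1 + α) * z.1 ^ α) + N * (z.2 - y) ^ 2 - σ * pdx (Vf F) z)
      (fxx := fun z => M * ((1 + α) * (α * (z.1 ^ α / z.1))) - σ * pdx (pdx (Vf F)) z)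
      (fy := fun z => 2 * N * z.1 * (z.2 - y) - σ * pdy (Vf F) z)
      (fyy := fun z => 2 * N * z.1 - σ * pdy (pdy (Vf F)) z) (y₀ := y) hδ0 hρ0
      (by
        apply ContinuousOn.sub
        · apply ContinuousOn.add
          · apply ContinuousOn.mul continuousOn_const
            exact (continuous_fst.continuousOn).rpow_const (fun z _ => Or.inr (by linarith))
          · fun_prop
        · apply ContinuousOn.mul continuousOn_const
          unfold Vf
          apply ContinuousOn.div
          · apply ContinuousOn.sub _ (by fun_prop)
            apply h.cont.mono
            intro z hz
            exact ⟨hz.1.1, hz.1.2.trans_lt hδa, (hin z.2 hz.2).trans_lt h2R⟩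
          · fun_prop
          · intro z hz
            have := hz.1.2
            linarith)
      (by
        intro z hz
        have h1 : HasDerivAt (fun t : ℝ => t ^ (1 + α)) ((1 + α) * z.1 ^ (1 + α - 1)) z.1 :=
          hasDerivAt_rpow_const (Or.inl hz.1.1.ne')
        have h2 : HasDerivAt (fun t : ℝ => N * t * (z.2 - y) ^ 2) (N * 1 * (z.2 - y) ^ 2) z.1 :=
          ((hasDerivAt_id z.1).const_mul N).mul_const _
        have := ((h1.const_mul M).add h2).sub ((lines (h.Vc2 (hOm z hz))).1.const_mul σ)
        refine this.congr_deriv ?_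
        rw [show 1 + α - 1 = α by ring]; ring)
      (by
        intro z hz
        have h1 : HasDerivAt (fun t : ℝ => t ^ α) (α * z.1 ^ (α - 1)) z.1 :=
          hasDerivAt_rpow_const (Or.inl hz.1.1.ne')
        have := (((h1.const_mul (1 + α)).const_mul M).add_const (N * (z.2 - y) ^ 2)).sub
          ((lines (h.Vc2 (hOm z hz))).2.1.const_mul σ)
        refine this.congr_deriv ?_
        rw [rpow_sub_one hz.1.1.ne'])
      (by
        intro z hz
        have h2 : HasDerivAt (fun t : ℝ => M * z.1 ^ (1 + α) + N * z.1 * (t - y) ^ 2) (2 * N * z.1 * (z.2 - y)) z.2 := by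
          have := ((((hasDerivAt_id z.2).sub_const y).pow 2).const_mul (N * z.1)).const_add (M * z.1 ^ (1 + α))
          exact this.congr_deriv (by simp; ring)
        exact h2.sub ((lines (h.Vc2 (hOm z hz))).2.2.1.const_mul σ))
      (by
        intro z hz
        have h2 : HasDerivAt (fun t : ℝ => 2 * N * z.1 * (t - y)) (2 * N * z.1) z.2 := by
          have := ((hasDerivAt_id z.2).sub_const y).const_mul (2 * N * z.1)
          exact this.congr_deriv (by ring)
        exact h2.sub ((lines (h.Vc2 (hOm z hz))).2.2.2.const_mul σ))
      (by
        intro t ht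
        have := hσ2 0 t le_rfl hδ0.le ht
        have h0 : (0:ℝ) ^ (1 + α) = 0 := zero_rpow (by linarith)
        simp only [h0]
        linarith)
      (by
        intro t ht
        have := hσ2 δ t hδ0.le le_rfl ht
        have h0 : δ ^ (1 + α) = δ * δ ^ α := by rw [rpow_add hδ0, rpow_one]
        have h1 : 0 ≤ N * δ * (t - y) ^ 2 := by positivity
        have h2 := mul_le_mul_of_nonneg_right hM2 hδ0.le
        simp only [h0]
        linarith)
      (by
        intro s hs
        have := hσ2 s (y - ρ) hs.1 hs.2 ⟨le_rfl, by linarith⟩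
        have h1 : 0 ≤ M * s ^ (1 + α) := mul_nonneg hM0.le (rpow_nonneg hs.1 _)
        have h2 := mul_le_mul_of_nonneg_right hN hs.1
        have h3 : N * s * (y - ρ - y) ^ 2 = N * ρ ^ 2 * s := by ring
        simp only [h3]
        linarith)
      (by
        intro s hs
        have := hσ2 s (y + ρ) hs.1 hs.2 ⟨by linarith, le_rfl⟩
        have h1 : 0 ≤ M * s ^ (1 + α) := mul_nonneg hM0.le (rpow_nonneg hs.1 _)
        have h2 := mul_le_mul_of_nonneg_right hN hs.1
        have h3 : N * s * (y + ρ - y) ^ 2 = N * ρ ^ 2 * s := by ring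
        simp only [h3]
        linarith)
      (by
        intro z hz h1 h2 h3 h4
        have hzO := hOm z hz
        have hp := h.Vpde hzO
        have hx0 := hz.1.1
        have e1 : z.1 ^ (1 + α) = z.1 * z.1 ^ α := by rw [rpow_add hx0, rpow_one]
        have hlo := hlow z.1 z.2 hx0 hz.1.2.le (hin z.2 ⟨hz.2.1.le, hz.2.2.le⟩)
        have hup := (h.Vbounds hzO).1
        simp only [e1] at h1
        rcases hσ with rfl | rfl
        · exact vpos ⟨hα0, hα1⟩ hη hN0 hM1 hc hc2 hx0 (hz.1.2.le.trans hδc) (by linarith [hz.1.2]) rfl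
            (by linarith) (by linarith : _ = _ + N * (z.2 - y) ^ 2) (by linarith) hup (by linarith) hp
        · exact vneg ⟨hα0, hα1⟩ hη hN0 hM1 hc hc2 hx0 (hz.1.2.le.trans hδc) (by linarith [hz.1.2]) rfl
            (by linarith) (by linarith : _ = _ + N * (z.2 - y) ^ 2) (by linarith) hlo (by linarith) hp)
    have := key (x, y) ⟨⟨hx0.le, hx1⟩, by simp; linarith, by simp; linarith⟩
    simp only [sub_self] at this
    linarith
  rw [abs_le]
  constructor
  · linarith [main (-1) (Or.inr rfl)]
  · linarith [main 1 (Or.inl rfl)]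

lemma NS.growth {F : ℝ × ℝ → ℝ} {a R R' α : ℝ} (h : NS F a R) (hR' : R' < R) (hα : α ∈ Ioo (0:ℝ) 1) :
    ∃ M δ : ℝ, 0 < M ∧ 0 < δ ∧ δ < a ∧ ∀ x y, 0 < x → x ≤ δ → |y| ≤ R' → |Vf F (x, y)| ≤ M * x ^ (1 + α) := by
  obtain ⟨hα0, hα1⟩ := hα
  set d : ℝ := (R - R') / 4 with hd
  have hd0 : 0 < d := by rw [hd]; linarith
  have ha := h.ha
  have ha4 := h.ha4
  obtain ⟨ε, δ, hε0, hε1, hδ0, hδa, hF⟩ := h.lower (R' := R' + 2 * d) (by rw [hd]; linarith)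
  have hεδ : 0 < min δ (ε / 16) := by positivity
  have hδ' : min δ (ε / 16) ≤ δ := min_le_left _ _
  have hε' : min δ (ε / 16) ≤ ε / 16 := min_le_right _ _
  set δ1 := min δ (ε / 16) with hδ1
  obtain ⟨M0, hM0, hg0⟩ := h.barrier (R1 := R' + d) (R2 := R' + 2 * d) (α := ε / 8) (η := 1 - ε / 2) (c := ε / 16) (δ := δ1)
    (by linarith) (by rw [hd]; linarith) ⟨by linarith, by linarith⟩ (by linarith) (by linarith) (by nlinarith) hεδ (by linarith) hε'
    (by
      intro x y hx0 hx1 hy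
      have hFx := hF x y hx0.le (by linarith) hy
      unfold Vf
      rw [le_div_iff₀ (by simp only; linarith)]
      simp only
      have : x * x ≤ x * (ε / 16) := mul_le_mul_of_nonneg_left (by linarith) hx0.le
      have h7 : 0 ≤ ε * (x * x) := by positivity
      have h8 : 0 ≤ ε * x := by positivity
      linarith)
  set η : ℝ := (1 - α) / 6 with hη
  have hη0 : 0 < η := by rw [hη]; linarith
  set δ2 : ℝ := min δ1 (min ((1 - α) / 4) ((η / M0) ^ (1 / (ε / 8)))) with hδ2
  have h20 : 0 < δ2 := by
    have : 0 < (η / M0) ^ (1 / (ε / 8)) := by positivity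
    have : 0 < (1 - α) / 4 := by linarith
    positivity
  have h21 : δ2 ≤ δ1 := min_le_left _ _
  have h22 : δ2 ≤ (1 - α) / 4 := (min_le_right _ _).trans (min_le_left _ _)
  have h23 : δ2 ≤ (η / M0) ^ (1 / (ε / 8)) := (min_le_right _ _).trans (min_le_right _ _)
  obtain ⟨M, hM, hg⟩ := h.barrier (R1 := R') (R2 := R' + d) (α := α) (η := η) (c := (1 - α) / 4) (δ := δ2)
    (by linarith) (by rw [hd]; linarith) ⟨hα0, hα1⟩ hη0.le (by linarith) (by rw [hη]; nlinarith) h20 (by linarith) h22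
    (by
      intro x y hx0 hx1 hy
      have h1 := (abs_le.mp (hg0 x y hx0 (by linarith) hy)).1
      have h2 : x ^ (ε / 8) ≤ η / M0 := by
        calc x ^ (ε / 8) ≤ ((η / M0) ^ (1 / (ε / 8))) ^ (ε / 8) := rpow_le_rpow hx0.le (by linarith) (by positivity)
          _ = η / M0 := by
            rw [← rpow_mul (by positivity), one_div_mul_cancel (by positivity), rpow_one]
      rw [le_div_iff₀ hM0] at h2
      have e1 : x ^ (1 + ε / 8) = x * x ^ (ε / 8) := by rw [rpow_add hx0, rpow_one]
      rw [e1] at h1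
      have := mul_le_mul_of_nonneg_right h2 hx0.le
      linarith)
  exact ⟨M, δ2, hM, h20, by linarith, fun x y h0 h1 h2 => hg x y h0 h1 h2⟩

end S15
end

section
open Real Set Filter Topology
namespace S15

noncomputable def lam (τ : ℝ) : ℝ := - log (1 - τ) - τ

lemma lam_bd {τ : ℝ} (h : |τ| ≤ 2 / 3) : 0 ≤ lam τ ∧ lam τ ≤ 3 * τ ^ 2 := by
  have ⟨h1, h2⟩ := abs_le.mp h
  have hp : 0 < 1 - τ := by linarith
  unfold lam
  constructor
  · have := log_le_sub_one_of_pos hp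
    linarith
  · have := one_sub_inv_le_log_of_pos hp
    have h3 : (1 - τ)⁻¹ - 1 - τ = τ ^ 2 / (1 - τ) := by field_simp; ring
    have h4 : τ ^ 2 / (1 - τ) ≤ 3 * τ ^ 2 := by
      rw [div_le_iff₀ hp]; nlinarith [sq_nonneg τ]
    linarith

lemma lam_diff {a b : ℝ} (ha : a < 1) (hb : b < 1) :
    lam b - lam a = a / (1 - a) * (b - a) + lam ((b - a) / (1 - a)) := by
  have h1 : 0 < 1 - a := by linarith
  have h2 : 0 < 1 - b := by linarith
  unfold lam
  have : 1 - (b - a) / (1 - a) = (1 - b) / (1 - a) := by field_simp; ring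
  rw [this, log_div h2.ne' h1.ne']
  field_simp
  ring

noncomputable def Lm (x₀ M u : ℝ) : ℝ := lam (M * u) / (x₀ * M)

lemma Lm_bd {x₀ M κ a : ℝ} (hx : 0 < x₀) (hM : 0 < M) (hM4 : M ≤ 1 / 4) (hMκ : M ≤ κ * x₀) (ha : |a| ≤ 1) :
    |Lm x₀ M a| ≤ 3 * κ := by
  have h1 : |M * a| ≤ 2 / 3 := by
    rw [abs_mul, abs_of_pos hM]; nlinarith [abs_nonneg a]
  have ⟨h2, h3⟩ := lam_bd h1
  unfold Lm
  rw [abs_of_nonneg (by positivity), div_le_iff₀ (by positivity)]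
  have h4 : a ^ 2 ≤ 1 := by rw [← sq_abs]; exact pow_le_one₀ (abs_nonneg a) ha
  have h5 : M * M ≤ κ * x₀ * M := mul_le_mul_of_nonneg_right hMκ hM.le
  have h6 : M * M * a ^ 2 ≤ M * M := by nlinarith [mul_pos hM hM]
  nlinarith

lemma Lm_diff {x₀ M κ a : ℝ} (hx : 0 < x₀) (hM : 0 < M) (hM4 : M ≤ 1 / 4) (hMκ : M ≤ κ * x₀) (ha : |a| ≤ 1) :
    ∃ μ : ℝ, |μ| ≤ 2 * κ ∧ ∀ b, |b| ≤ 1 → |Lm x₀ M b - Lm x₀ M a - μ * (b - a)| ≤ 6 * κ * (b - a) ^ 2 := by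
  have ⟨a1, a2⟩ := abs_le.mp ha
  have hMa : M * a ≤ 1 / 4 := by nlinarith
  have h1a : 0 < 1 - M * a := by linarith
  have h5 : M * M ≤ κ * x₀ * M := mul_le_mul_of_nonneg_right hMκ hM.le
  refine ⟨(M * a / (1 - M * a)) / x₀, ?_, ?_⟩
  · rw [abs_div, abs_div, abs_mul, abs_of_pos hM, abs_of_pos h1a, abs_of_pos hx, div_div, div_le_iff₀ (by positivity)]
    have : M * |a| ≤ M := by nlinarith
    have : M * 1 ≤ 2 * M * (1 - M * a) := by nlinarith
    nlinarith [mul_pos hx h1a]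
  · intro b hb
    have ⟨b1, b2⟩ := abs_le.mp hb
    have hMb : M * b ≤ 1 / 4 := by nlinarith
    have e := lam_diff (a := M * a) (b := M * b) (by linarith) (by linarith)
    have e2 : Lm x₀ M b - Lm x₀ M a - (M * a / (1 - M * a)) / x₀ * (b - a) = lam ((M * b - M * a) / (1 - M * a)) / (x₀ * M) := by
      have : lam ((M * b - M * a) / (1 - M * a)) = lam (M * b) - lam (M * a) - M * a / (1 - M * a) * (M * b - M * a) := by
        linarith
      rw [this]; unfold Lm; field_simp
    rw [e2]
    have hτ : |(M * b - M * a) / (1 - M * a)| ≤ 2 / 3 := by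
      rw [abs_div, abs_of_pos h1a, div_le_iff₀ h1a]
      have : |M * b - M * a| ≤ 1 / 2 := by
        rw [abs_le]; constructor <;> nlinarith
      linarith
    have ⟨l1, l2⟩ := lam_bd hτ
    rw [abs_of_nonneg (by positivity), div_le_iff₀ (by positivity)]
    refine l2.trans ?_
    have h7 : ((M * b - M * a) / (1 - M * a)) ^ 2 ≤ 2 * (M * M * (b - a) ^ 2) := by
      rw [div_pow, div_le_iff₀ (by positivity)]
      have h8 : 1 / 2 ≤ (1 - M * a) ^ 2 := by nlinarith
      have h9 : 0 ≤ M * M * (b - a) ^ 2 := by positivity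
      nlinarith
    have h10 : M * M * (b - a) ^ 2 ≤ κ * x₀ * M * (b - a) ^ 2 := mul_le_mul_of_nonneg_right h5 (sq_nonneg _)
    nlinarith

noncomputable def cf (x₀ κ s : ℝ) : ℝ := 1 - (1 - x₀ * (1 + κ * s)) ^ 2 * (1 + κ * s)
noncomputable def ef (x₀ κ s : ℝ) : ℝ := (1 - x₀ * (1 + κ * s)) ^ 3
noncomputable def Gf (x₀ κ M : ℝ) (u : ℝ × ℝ → ℝ) (z : ℝ × ℝ) : ℝ :=
  cf x₀ κ z.1 * u z + ef x₀ κ z.1 * Lm x₀ M (u z)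
noncomputable def G1f (x₀ κ M : ℝ) (u : ℝ × ℝ → ℝ) (z : ℝ × ℝ) : ℝ :=
  -κ * ((1 - x₀ * (1 + κ * z.1)) * u z - 4 * (1 - x₀ * (1 + κ * z.1)) ^ 2 * (u z + x₀ * Lm x₀ M (u z)))

lemma pp {κ s : ℝ} (hκ : 0 < κ) (hκ4 : κ ≤ 1 / 4) (hs : |s| < 1) : 3 / 4 ≤ 1 + κ * s ∧ 1 + κ * s ≤ 5 / 4 := by
  have ⟨a1, a2⟩ := abs_lt.mp hs
  constructor <;> nlinarith

lemma cf_bd {x₀ κ s h : ℝ} (hx : 0 < x₀) (hκ : 0 < κ) (hκ4 : κ ≤ 1 / 4) (hxκ : x₀ ≤ κ) (hs : |s| < 1) (hsh : |s + h| < 1) :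
    |cf x₀ κ s| ≤ 5 * κ ∧ |cf x₀ κ (s + h) - cf x₀ κ s| ≤ 5 * κ * |h| ∧
      |cf x₀ κ (s + h) + cf x₀ κ (s - h) - 2 * cf x₀ κ s| ≤ 5 * κ * h ^ 2 := by
  obtain ⟨p1, p2⟩ := pp hκ hκ4 hs
  obtain ⟨q1, q2⟩ := pp hκ hκ4 hsh
  have ⟨a1, a2⟩ := abs_lt.mp hs
  have e1 : cf x₀ κ (s + h) - cf x₀ κ s = -(κ * h) * (1 - 2 * x₀ * ((1 + κ * s) + (1 + κ * (s + h))) + x₀ ^ 2 *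
      ((1 + κ * s) ^ 2 + (1 + κ * s) * (1 + κ * (s + h)) + (1 + κ * (s + h)) ^ 2)) := by
    unfold cf; ring
  have e2 : cf x₀ κ (s + h) + cf x₀ κ (s - h) - 2 * cf x₀ κ s = (κ * h ^ 2) * (κ * (4 * x₀ - 6 * x₀ ^ 2 * (1 + κ * s))) := by
    unfold cf; ring
  have hks : |κ * s| ≤ κ := by rw [abs_mul, abs_of_pos hκ]; nlinarith
  have ⟨k1, k2⟩ := abs_le.mp hks
  have e0 : cf x₀ κ s = 1 - (1 - x₀ * (1 + κ * s)) ^ 2 * (1 + κ * s) := rfl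
  rw [e1, e2, e0]
  clear e0 e1 e2
  generalize hp : 1 + κ * s = p at *
  generalize hq : 1 + κ * (s + h) = q at *
  have hp1 : 1 - κ ≤ p := by linarith
  have hp2 : p ≤ 1 + κ := by linarith
  clear hp hq hks k1 k2 a1 a2 hs hsh
  have hxp : x₀ * p ≤ 2 * κ := by
    have := mul_le_mul hxκ p2 (by linarith) hκ.le
    linarith
  have hp0 : 0 < p := by linarith
  have hq0 : 0 < q := by linarith
  have hxp0 : 0 < x₀ * p := by positivity
  refine ⟨?_, ?_, ?_⟩
  · generalize x₀ * p = X at *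
    have g1 : (1 - X) ^ 2 ≤ 1 := pow_le_one₀ (by linarith) (by linarith)
    have g2 : 1 - 4 * κ ≤ (1 - X) ^ 2 := by linarith [sq_nonneg X, show (1 - X) ^ 2 = 1 - 2 * X + X ^ 2 by ring]
    have g0 := sq_nonneg (1 - X)
    generalize (1 - X) ^ 2 = Y at *
    rw [abs_le]
    have m1 := mul_le_mul_of_nonneg_right g1 (show 0 ≤ p by linarith)
    have m2 := mul_le_mul_of_nonneg_left hp1 g0
    have m3 := mul_le_mul_of_nonneg_left g1 hκ.le
    constructor <;> linarith
  · rw [abs_mul, abs_neg, abs_mul, abs_of_pos hκ]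
    have hb : |1 - 2 * x₀ * (p + q) + x₀ ^ 2 * (p ^ 2 + p * q + q ^ 2)| ≤ 5 := by
      have g0 : 0 ≤ x₀ * (p + q) := by apply mul_nonneg hx.le; linarith
      have g1 : x₀ * (p + q) ≤ 1 / 4 * (5 / 2) := by
        apply mul_le_mul (by linarith) (by linarith) (by linarith) (by norm_num)
      have g2 : 0 ≤ x₀ ^ 2 * (p ^ 2 + p * q + q ^ 2) := by
        apply mul_nonneg (sq_nonneg _); positivity
      have g3 : x₀ ^ 2 * (p ^ 2 + p * q + q ^ 2) ≤ (x₀ * (p + q)) ^ 2 := by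
        rw [mul_pow]; apply mul_le_mul_of_nonneg_left _ (sq_nonneg _)
        have : 0 ≤ p * q := by positivity
        linarith [show (p + q) ^ 2 = p ^ 2 + 2 * (p * q) + q ^ 2 by ring]
      have g4 : (x₀ * (p + q)) ^ 2 ≤ 1 := pow_le_one₀ g0 (by linarith)
      rw [abs_le]; constructor <;> linarith
    have := mul_le_mul_of_nonneg_left hb (mul_nonneg hκ.le (abs_nonneg h))
    linarith
  · rw [abs_mul, abs_of_nonneg (by positivity)]
    have hb : |κ * (4 * x₀ - 6 * x₀ ^ 2 * p)| ≤ 5 := by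
      have g2 : 0 ≤ x₀ ^ 2 * p := by positivity
      have g3 : x₀ ^ 2 * p ≤ 1 / 4 := by
        have : x₀ * (x₀ * p) ≤ 1 / 4 * (1 / 2) := mul_le_mul (by linarith) (by linarith) hxp0.le (by norm_num)
        linarith [show x₀ ^ 2 * p = x₀ * (x₀ * p) by ring]
      have h0p : 0 < p := by linarith
      rw [abs_mul, abs_of_pos hκ]
      have : |4 * x₀ - 6 * x₀ ^ 2 * p| ≤ 5 := by rw [abs_le]; constructor <;> linarith
      have := mul_le_mul hκ4 this (abs_nonneg _) (by norm_num)
      linarith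
    have := mul_le_mul_of_nonneg_left hb (mul_nonneg hκ.le (sq_nonneg h))
    linarith

lemma ef_bd {x₀ κ s h : ℝ} (hx : 0 < x₀) (hκ : 0 < κ) (hκ4 : κ ≤ 1 / 4) (hxκ : x₀ ≤ κ) (hs : |s| < 1) (hsh : |s + h| < 1) :
    |ef x₀ κ s| ≤ 1 ∧ |ef x₀ κ (s + h) - ef x₀ κ s| ≤ 1 * |h| ∧
      |ef x₀ κ (s + h) + ef x₀ κ (s - h) - 2 * ef x₀ κ s| ≤ 1 * h ^ 2 := by
  obtain ⟨p1, p2⟩ := pp hκ hκ4 hs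
  obtain ⟨q1, q2⟩ := pp hκ hκ4 hsh
  have e1 : ef x₀ κ (s + h) - ef x₀ κ s = -(x₀ * κ) * h * ((1 - x₀ * (1 + κ * s)) ^ 2 + (1 - x₀ * (1 + κ * s)) * (1 - x₀ * (1 + κ * (s + h))) +
      (1 - x₀ * (1 + κ * (s + h))) ^ 2) := by
    unfold ef; ring
  have e2 : ef x₀ κ (s + h) + ef x₀ κ (s - h) - 2 * ef x₀ κ s = (x₀ * κ) * (x₀ * κ) * 6 * (1 - x₀ * (1 + κ * s)) * h ^ 2 := by
    unfold ef; ring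
  have hA : 0 ≤ 1 - x₀ * (1 + κ * s) ∧ 1 - x₀ * (1 + κ * s) ≤ 1 := by constructor <;> nlinarith
  have hB : 0 ≤ 1 - x₀ * (1 + κ * (s + h)) ∧ 1 - x₀ * (1 + κ * (s + h)) ≤ 1 := by constructor <;> nlinarith
  rw [e1, e2]
  unfold ef
  generalize 1 - x₀ * (1 + κ * s) = A at *
  generalize 1 - x₀ * (1 + κ * (s + h)) = B at *
  obtain ⟨A0, A1⟩ := hA
  obtain ⟨B0, B1⟩ := hB
  have hxk : x₀ * κ ≤ 1 / 16 := by nlinarith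
  have hxk0 : 0 < x₀ * κ := by positivity
  refine ⟨?_, ?_, ?_⟩
  · rw [abs_of_nonneg (by positivity)]; exact pow_le_one₀ A0 A1
  · have : 0 ≤ A ^ 2 + A * B + B ^ 2 := by positivity
    rw [abs_mul, abs_mul, abs_neg, abs_of_pos hxk0, abs_of_nonneg this]
    have h3 : A ^ 2 + A * B + B ^ 2 ≤ 3 := by nlinarith
    have h4 : (x₀ * κ) * (A ^ 2 + A * B + B ^ 2) ≤ 1 := by nlinarith
    have := mul_le_mul_of_nonneg_right h4 (abs_nonneg h)
    linarith
  · rw [abs_of_nonneg (by positivity)]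
    have h4 : (x₀ * κ) * (x₀ * κ) * 6 * A ≤ 1 := by
      have : (x₀ * κ) * (x₀ * κ) ≤ 1 / 16 * (1 / 16) := mul_le_mul hxk hxk hxk0.le (by norm_num)
      nlinarith
    exact mul_le_mul_of_nonneg_right h4 (sq_nonneg h)

lemma dd_prod {A c cp cm w wp wm n : ℝ} (hA : 0 ≤ A) (h1 : |c| ≤ A) (h2 : |cp - c| ≤ A * n) (h2' : |cm - c| ≤ A * n)
    (h3 : |cp + cm - 2 * c| ≤ A * n ^ 2) :
    |cp * wp + cm * wm - 2 * (c * w)| ≤ A * (|wp + wm - 2 * w| + n * |wp - w| + n * |wm - w| + |w| * n ^ 2) := by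
  have e : cp * wp + cm * wm - 2 * (c * w) = c * (wp + wm - 2 * w) + (cp - c) * (wp - w) + (cm - c) * (wm - w) + (cp + cm - 2 * c) * w := by ring
  rw [e]
  have a1 : |c * (wp + wm - 2 * w)| ≤ A * |wp + wm - 2 * w| := by
    rw [abs_mul]; exact mul_le_mul_of_nonneg_right h1 (abs_nonneg _)
  have a2 : |(cp - c) * (wp - w)| ≤ A * n * |wp - w| := by
    rw [abs_mul]; exact mul_le_mul_of_nonneg_right h2 (abs_nonneg _)
  have a3 : |(cm - c) * (wm - w)| ≤ A * n * |wm - w| := by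
    rw [abs_mul]; exact mul_le_mul_of_nonneg_right h2' (abs_nonneg _)
  have a4 : |(cp + cm - 2 * c) * w| ≤ A * n ^ 2 * |w| := by
    rw [abs_mul]; exact mul_le_mul_of_nonneg_right h3 (abs_nonneg _)
  have b1 := abs_add_le (c * (wp + wm - 2 * w) + (cp - c) * (wp - w) + (cm - c) * (wm - w)) ((cp + cm - 2 * c) * w)
  have b2 := abs_add_le (c * (wp + wm - 2 * w) + (cp - c) * (wp - w)) ((cm - c) * (wm - w))
  have b3 := abs_add_le (c * (wp + wm - 2 * w)) ((cp - c) * (wp - w))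
  linarith

end S15
end

section
open Real Set Filter Topology
namespace S15

lemma Lm_diff1 {x₀ M κ a b μ : ℝ} (hκ : 0 < κ) (ha : |a| ≤ 1) (hb : |b| ≤ 1) (hμ : |μ| ≤ 2 * κ)
    (h : |Lm x₀ M b - Lm x₀ M a - μ * (b - a)| ≤ 6 * κ * (b - a) ^ 2) :
    |Lm x₀ M b - Lm x₀ M a| ≤ 14 * κ * |b - a| := by
  have h1 : |b - a| ≤ 2 := by
    have := abs_sub b a
    linarith
  have h2 : (b - a) ^ 2 ≤ 2 * |b - a| := by
    rw [← sq_abs, sq]; exact mul_le_mul_of_nonneg_right h1 (abs_nonneg _)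
  have h3 : |μ * (b - a)| ≤ 2 * κ * |b - a| := by
    rw [abs_mul]; exact mul_le_mul_of_nonneg_right hμ (abs_nonneg _)
  have h4 := abs_add_le (Lm x₀ M b - Lm x₀ M a - μ * (b - a)) (μ * (b - a))
  rw [sub_add_cancel] at h4
  have h5 := mul_le_mul_of_nonneg_left h2 (show 0 ≤ 6 * κ by linarith)
  linarith

lemma nums {κ n D P N E1 E2 L1 L2 : ℝ} (hκ : 0 < κ) (_hn : 0 ≤ n) (_hP : 0 ≤ P) (_hN : 0 ≤ N) (hD : 0 ≤ D)
    (h1 : E1 ≤ 5 * κ * (D + n * P + n * N + n ^ 2))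
    (h2 : E2 ≤ 1 * ((2 * κ * D + 6 * κ * P ^ 2 + 6 * κ * N ^ 2) + n * L1 + n * L2 + (3 * κ) * n ^ 2))
    (h3 : n * L1 ≤ n * (14 * κ * P)) (h4 : n * L2 ≤ n * (14 * κ * N)) :
    E1 + E2 ≤ 40 * κ * (D + n ^ 2 + P ^ 2 + N ^ 2) := by
  have a1 : 0 ≤ κ * (n - P) ^ 2 := by positivity
  have a2 : 0 ≤ κ * (n - N) ^ 2 := by positivity
  have a3 : 0 ≤ κ * n ^ 2 := by positivity
  have a4 : 0 ≤ κ * P ^ 2 := by positivity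
  have a5 : 0 ≤ κ * N ^ 2 := by positivity
  have a6 : 0 ≤ κ * D := by positivity
  have e1 : κ * (n - P) ^ 2 = κ * n ^ 2 - 2 * (κ * n * P) + κ * P ^ 2 := by ring
  have e2 : κ * (n - N) ^ 2 = κ * n ^ 2 - 2 * (κ * n * N) + κ * N ^ 2 := by ring
  linarith

lemma fst_abs (z k : ℝ × ℝ) (h : ‖z‖ + ‖k‖ < 1) : ‖z‖ < 1 ∧ ‖z + k‖ < 1 ∧ ‖z - k‖ < 1 ∧ |z.1| < 1 ∧ |z.1 + k.1| < 1 ∧ |z.1 - k.1| < 1 ∧ |k.1| ≤ ‖k‖ := by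
  have h1 := norm_add_le z k
  have h2 := norm_sub_le z k
  have h3 : |z.1| ≤ ‖z‖ := norm_fst_le z
  have h4 : |(z + k).1| ≤ ‖z + k‖ := norm_fst_le (z + k)
  have h5 : |(z - k).1| ≤ ‖z - k‖ := norm_fst_le (z - k)
  have h6 : |k.1| ≤ ‖k‖ := norm_fst_le k
  have h7 := norm_nonneg k
  simp only [Prod.fst_add, Prod.fst_sub] at h4 h5
  refine ⟨by linarith, by linarith, by linarith, by linarith, by linarith, by linarith, h6⟩

lemma ddG {x₀ κ M : ℝ} (hx : 0 < x₀) (hκ : 0 < κ) (hκ4 : κ ≤ 1 / 4) (hxκ : x₀ ≤ κ) (hM : 0 < M) (hMκ : M ≤ κ * x₀)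
    {u : ℝ × ℝ → ℝ} (hu : ∀ z, ‖z‖ < 1 → |u z| ≤ 1) (z k : ℝ × ℝ) (hz : ‖z‖ + ‖k‖ < 1) :
    |dd (Gf x₀ κ M u) z k| ≤ 40 * κ * (|dd u z k| + ‖k‖ ^ 2 + |u (z + k) - u z| ^ 2 + |u (z - k) - u z| ^ 2) := by
  obtain ⟨n1, n2, n3, s1, s2, s3, hk⟩ := fst_abs z k hz
  have hM4 : M ≤ 1 / 4 := by
    have := mul_le_mul hκ4 (hxκ.trans hκ4) hx.le (by norm_num)
    linarith
  have u1 := hu _ n1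
  have u2 := hu _ n2
  have u3 := hu _ n3
  have n0 := norm_nonneg k
  have hk2 : k.1 ^ 2 ≤ ‖k‖ ^ 2 := by rw [← sq_abs]; exact pow_le_pow_left₀ (abs_nonneg _) hk 2
  obtain ⟨μ, hμ, hL⟩ := Lm_diff hx hM hM4 hMκ u1
  have Lp := hL _ u2
  have Lmm := hL _ u3
  have Lp1 := Lm_diff1 hκ u1 u2 hμ Lp
  have Lm1 := Lm_diff1 hκ u1 u3 hμ Lmm
  have L0 := Lm_bd hx hM hM4 hMκ u1
  have c1 := cf_bd hx hκ hκ4 hxκ s1 s2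
  have c2 := cf_bd (h := -k.1) hx hκ hκ4 hxκ s1 (by rw [← sub_eq_add_neg]; exact s3)
  have e1 := ef_bd hx hκ hκ4 hxκ s1 s2
  have e2 := ef_bd (h := -k.1) hx hκ hκ4 hxκ s1 (by rw [← sub_eq_add_neg]; exact s3)
  rw [← sub_eq_add_neg, abs_neg] at c2 e2
  have hκ5 : 0 < 5 * κ := by linarith
  have P1 := dd_prod (A := 5 * κ) (c := cf x₀ κ z.1) (cp := cf x₀ κ (z.1 + k.1)) (cm := cf x₀ κ (z.1 - k.1)) (w := u z)
    (wp := u (z + k)) (wm := u (z - k)) (n := ‖k‖) hκ5.le c1.1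
    (c1.2.1.trans (mul_le_mul_of_nonneg_left hk hκ5.le)) (c2.2.1.trans (mul_le_mul_of_nonneg_left hk hκ5.le))
    (c1.2.2.trans (mul_le_mul_of_nonneg_left hk2 hκ5.le))
  have P2 := dd_prod (A := 1) (c := ef x₀ κ z.1) (cp := ef x₀ κ (z.1 + k.1)) (cm := ef x₀ κ (z.1 - k.1)) (w := Lm x₀ M (u z))
    (wp := Lm x₀ M (u (z + k))) (wm := Lm x₀ M (u (z - k))) (n := ‖k‖) zero_le_one e1.1
    (e1.2.1.trans (mul_le_mul_of_nonneg_left hk zero_le_one)) (e2.2.1.trans (mul_le_mul_of_nonneg_left hk zero_le_one))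
    (e1.2.2.trans (mul_le_mul_of_nonneg_left hk2 zero_le_one))
  have Ldd : |Lm x₀ M (u (z + k)) + Lm x₀ M (u (z - k)) - 2 * Lm x₀ M (u z)| ≤
      2 * κ * |dd u z k| + 6 * κ * |u (z + k) - u z| ^ 2 + 6 * κ * |u (z - k) - u z| ^ 2 := by
    have e : Lm x₀ M (u (z + k)) + Lm x₀ M (u (z - k)) - 2 * Lm x₀ M (u z) = μ * dd u z k +
      (Lm x₀ M (u (z + k)) - Lm x₀ M (u z) - μ * (u (z + k) - u z)) + (Lm x₀ M (u (z - k)) - Lm x₀ M (u z) - μ * (u (z - k) - u z)) := by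
      unfold dd; ring
    rw [e, sq_abs, sq_abs]
    have h3 : |μ * dd u z k| ≤ 2 * κ * |dd u z k| := by
      rw [abs_mul]; exact mul_le_mul_of_nonneg_right hμ (abs_nonneg _)
    have b2 := abs_add_le (μ * dd u z k +
      (Lm x₀ M (u (z + k)) - Lm x₀ M (u z) - μ * (u (z + k) - u z))) (Lm x₀ M (u (z - k)) - Lm x₀ M (u z) - μ * (u (z - k) - u z))
    have b3 := abs_add_le (μ * dd u z k) (Lm x₀ M (u (z + k)) - Lm x₀ M (u z) - μ * (u (z + k) - u z))
    linarith
  have eG : dd (Gf x₀ κ M u) z k = (cf x₀ κ (z.1 + k.1) * u (z + k) + cf x₀ κ (z.1 - k.1) * u (z - k) - 2 * (cf x₀ κ z.1 * u z))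
    + (ef x₀ κ (z.1 + k.1) * Lm x₀ M (u (z + k)) + ef x₀ κ (z.1 - k.1) * Lm x₀ M (u (z - k)) - 2 * (ef x₀ κ z.1 * Lm x₀ M (u z))) := by
    unfold dd Gf; simp only [Prod.fst_add, Prod.fst_sub]; ring
  rw [eG]
  refine (abs_add_le _ _).trans ?_
  have f1 : |u z| * ‖k‖ ^ 2 ≤ 1 * ‖k‖ ^ 2 := mul_le_mul_of_nonneg_right u1 (sq_nonneg _)
  have f2 : |Lm x₀ M (u z)| * ‖k‖ ^ 2 ≤ 3 * κ * ‖k‖ ^ 2 := mul_le_mul_of_nonneg_right L0 (sq_nonneg _)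
  refine nums hκ n0 (abs_nonneg _) (abs_nonneg _) (abs_nonneg _) (P1.trans ?_) (P2.trans ?_)
    (mul_le_mul_of_nonneg_left Lp1 n0) (mul_le_mul_of_nonneg_left Lm1 n0)
  · apply mul_le_mul_of_nonneg_left _ hκ5.le
    have : |u (z + k) + u (z - k) - 2 * u z| = |dd u z k| := rfl
    rw [this]; linarith
  · apply mul_le_mul_of_nonneg_left _ zero_le_one
    linarith

lemma prod_diff {f fp g gp : ℝ} (h : |fp| ≤ 1) : |fp * gp - f * g| ≤ |gp - g| + |fp - f| * |g| := by
  have e : fp * gp - f * g = fp * (gp - g) + (fp - f) * g := by ring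
  rw [e]
  refine (abs_add_le _ _).trans ?_
  rw [abs_mul, abs_mul]
  have := mul_le_mul_of_nonneg_right h (abs_nonneg (gp - g))
  linarith

lemma diffG1 {x₀ κ M : ℝ} (hx : 0 < x₀) (hκ : 0 < κ) (hκ4 : κ ≤ 1 / 4) (hxκ : x₀ ≤ κ) (hM : 0 < M) (hMκ : M ≤ κ * x₀)
    {u : ℝ × ℝ → ℝ} (hu : ∀ z, ‖z‖ < 1 → |u z| ≤ 1) (z k : ℝ × ℝ) (hz : ‖z‖ + ‖k‖ < 1) :
    |G1f x₀ κ M u (z + k) - G1f x₀ κ M u z| ≤ 40 * κ * (|u (z + k) - u z| + ‖k‖) := by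
  obtain ⟨n1, n2, n3, s1, s2, s3, hk⟩ := fst_abs z k hz
  have hM4 : M ≤ 1 / 4 := by
    have := mul_le_mul hκ4 (hxκ.trans hκ4) hx.le (by norm_num)
    linarith
  have u1 := hu _ n1
  have u2 := hu _ n2
  have n0 := norm_nonneg k
  obtain ⟨μ, hμ, hL⟩ := Lm_diff hx hM hM4 hMκ u1
  have Lp1 := Lm_diff1 hκ u1 u2 hμ (hL _ u2)
  have L0 := Lm_bd hx hM hM4 hMκ u1
  obtain ⟨p1, p2⟩ := pp hκ hκ4 s1
  obtain ⟨q1, q2⟩ := pp hκ hκ4 s2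
  have hxp : x₀ * (1 + κ * z.1) ≤ 1 / 4 * (5 / 4) := mul_le_mul (by linarith) p2 (by linarith) (by norm_num)
  have hxq : x₀ * (1 + κ * (z.1 + k.1)) ≤ 1 / 4 * (5 / 4) := mul_le_mul (by linarith) q2 (by linarith) (by norm_num)
  have hxp0 : 0 < x₀ * (1 + κ * z.1) := mul_pos hx (by linarith)
  have hxq0 : 0 < x₀ * (1 + κ * (z.1 + k.1)) := mul_pos hx (by linarith)
  have hxk : x₀ * κ ≤ 1 / 4 * (1 / 4) := mul_le_mul (by linarith) hκ4 hκ.le (by norm_num)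
  have hd : |(1 - x₀ * (1 + κ * (z.1 + k.1))) - (1 - x₀ * (1 + κ * z.1))| ≤ ‖k‖ := by
    have : (1 - x₀ * (1 + κ * (z.1 + k.1))) - (1 - x₀ * (1 + κ * z.1)) = - (x₀ * κ) * k.1 := by ring
    rw [this, abs_mul, abs_neg, abs_of_pos (by positivity)]
    have := mul_le_mul hxk hk (abs_nonneg _) (by norm_num)
    linarith
  unfold G1f
  simp only [Prod.fst_add]
  generalize x₀ * (1 + κ * z.1) = X at *
  generalize x₀ * (1 + κ * (z.1 + k.1)) = X' at *
  have a1 : |1 - X| ≤ 1 := by rw [abs_of_nonneg (by linarith)]; linarith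
  have a2 : |1 - X'| ≤ 1 := by rw [abs_of_nonneg (by linarith)]; linarith
  have a3 : |(1 - X') ^ 2| ≤ 1 := by rw [abs_pow]; exact pow_le_one₀ (abs_nonneg _) a2
  have a4 : |(1 - X') ^ 2 - (1 - X) ^ 2| ≤ 2 * ‖k‖ := by
    have := prod_diff (f := 1 - X) (g := 1 - X) (gp := 1 - X') a2
    rw [← sq, ← sq] at this
    have h3 := mul_le_mul hd a1 (abs_nonneg _) n0
    linarith
  have P1 := prod_diff (f := 1 - X) (g := u z) (gp := u (z + k)) a2
  have P2 := prod_diff (f := (1 - X) ^ 2) (g := u z + x₀ * Lm x₀ M (u z)) (gp := u (z + k) + x₀ * Lm x₀ M (u (z + k))) a3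
  have b1 : |u z + x₀ * Lm x₀ M (u z)| ≤ 2 := by
    refine (abs_add_le _ _).trans ?_
    rw [abs_mul, abs_of_pos hx]
    have := mul_le_mul (hxκ.trans hκ4) L0 (abs_nonneg _) (by norm_num)
    linarith
  have b2 : |u (z + k) + x₀ * Lm x₀ M (u (z + k)) - (u z + x₀ * Lm x₀ M (u z))| ≤ 2 * |u (z + k) - u z| := by
    have e : u (z + k) + x₀ * Lm x₀ M (u (z + k)) - (u z + x₀ * Lm x₀ M (u z)) = (u (z + k) - u z) + x₀ * (Lm x₀ M (u (z + k)) - Lm x₀ M (u z)) := by ring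
    rw [e]
    refine (abs_add_le _ _).trans ?_
    rw [abs_mul, abs_of_pos hx]
    have h1 := mul_le_mul_of_nonneg_left Lp1 hx.le
    have h2 := mul_le_mul_of_nonneg_right hxk (abs_nonneg (u (z + k) - u z))
    have := abs_nonneg (u (z + k) - u z)
    linarith
  have c1 := mul_le_mul hd u1 (abs_nonneg _) n0
  have c2 := mul_le_mul a4 b1 (abs_nonneg _) (by linarith)
  have e : -κ * ((1 - X') * u (z + k) - 4 * (1 - X') ^ 2 * (u (z + k) + x₀ * Lm x₀ M (u (z + k))))
     - -κ * ((1 - X) * u z - 4 * (1 - X) ^ 2 * (u z + x₀ * Lm x₀ M (u z))) =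
     -κ * (((1 - X') * u (z + k) - (1 - X) * u z) - 4 * ((1 - X') ^ 2 * (u (z + k) + x₀ * Lm x₀ M (u (z + k))) - (1 - X) ^ 2 * (u z + x₀ * Lm x₀ M (u z)))) := by ring
  rw [e, abs_mul, abs_neg, abs_of_pos hκ, mul_comm 40 κ, mul_assoc]
  apply mul_le_mul_of_nonneg_left _ hκ.le
  refine (abs_sub _ _).trans ?_
  rw [abs_mul, abs_of_pos (by norm_num : (0:ℝ) < 4)]
  have := abs_nonneg (u (z + k) - u z)
  linarith

end S15
end

section
open Real Set Filter Topology
namespace S15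

lemma alg {x₀ κ M p u u1 u2 l w : ℝ} (hx : x₀ ≠ 0) (hκ : κ ≠ 0) (hM : M ≠ 0) (hu : 1 - M * u ≠ 0)
  (hp : M * w / (κ ^ 2 * x₀) + (1 - x₀ * p) ^ 2 * (x₀ * p - M * u) / (1 - M * u) * (M * u2 / (κ * x₀) ^ 2)
     - (1 - x₀ * p) * (3 - 2 * (1 - x₀ * p) / (1 - M * u)) * (M * u1 / (κ * x₀))
     - (1 - x₀ * p) ^ 3 * (M * u1 / (κ * x₀)) ^ 2 / (1 - M * u) ^ 2 + M * u - x₀ * p = 0) :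
  u2 + w - ((2 * x₀ * κ * (-(x₀ * κ) * p + (1 - x₀ * p) * κ) + 2 * κ * (x₀ * κ) * (1 - x₀ * p)) * u
    + 2 * ((2 * (1 - x₀ * p) * (x₀ * κ) * p - (1 - x₀ * p) ^ 2 * κ) * u1) + (1 - (1 - x₀ * p) ^ 2 * p) * u2
    + 6 * (x₀ * κ) ^ 2 * (1 - x₀ * p) * l + 2 * (-3 * (x₀ * κ) * (1 - x₀ * p) ^ 2 * (M * u / (1 - M * u) / x₀ * u1))
    + (1 - x₀ * p) ^ 3 * (M * u1 / (1 - M * u) ^ 2 / x₀ * u1 + M * u / (1 - M * u) / x₀ * u2))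
   - (-κ * (-(x₀ * κ) * u + (1 - x₀ * p) * u1 - (-8 * (x₀ * κ) * (1 - x₀ * p) * (u + x₀ * l) + 4 * (1 - x₀ * p) ^ 2 * (u1 + x₀ * (M * u / (1 - M * u) / x₀ * u1)))))
   = κ ^ 2 * x₀ * (2 * (1 - x₀ * p) * (u + x₀ * l)) + κ ^ 2 * x₀ * (x₀ * p / M) := by
  rw [← sub_eq_zero]
  rw [← mul_zero (κ ^ 2 * x₀ / M), ← hp]
  clear hp
  obtain ⟨D, hD⟩ : ∃ D, D = 1 - M * u := ⟨_, rfl⟩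
  have hu' : u = (1 - D) / M := by rw [hD]; field_simp; ring
  rw [← hD] at hu ⊢
  rw [hu']
  field_simp
  ring
end S15
end

section
open Real Set Filter Topology
namespace S15

lemma Lm_cd {n : WithTop ℕ∞} {x₀ M : ℝ} {u : ℝ × ℝ → ℝ} {z : ℝ × ℝ} (hu : ContDiffAt ℝ n u z) (h1 : M * u z < 1) :
    ContDiffAt ℝ n (fun z => Lm x₀ M (u z)) z := by
  unfold Lm lam
  have h2 : ContDiffAt ℝ n (fun z => M * u z) z := contDiffAt_const.mul hu
  have h3 : ContDiffAt ℝ n (fun z => log (1 - M * u z)) z :=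
    (contDiffAt_const.sub h2).log (by linarith)
  exact (h3.neg.sub h2).div_const _

lemma Gf_cd {n : WithTop ℕ∞} {x₀ κ M : ℝ} {u : ℝ × ℝ → ℝ} {z : ℝ × ℝ} (hu : ContDiffAt ℝ n u z) (h1 : M * u z < 1) :
    ContDiffAt ℝ n (Gf x₀ κ M u) z := by
  have h2 := Lm_cd (x₀ := x₀) hu h1
  have h3 : ContDiffAt ℝ n (fun z : ℝ × ℝ => cf x₀ κ z.1) z := by unfold cf; fun_prop
  have h4 : ContDiffAt ℝ n (fun z : ℝ × ℝ => ef x₀ κ z.1) z := by unfold ef; fun_prop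
  exact (h3.mul hu).add (h4.mul h2)

lemma G1f_cd {n : WithTop ℕ∞} {x₀ κ M : ℝ} {u : ℝ × ℝ → ℝ} {z : ℝ × ℝ} (hu : ContDiffAt ℝ n u z) (h1 : M * u z < 1) :
    ContDiffAt ℝ n (G1f x₀ κ M u) z := by
  have h2 := Lm_cd (x₀ := x₀) hu h1
  have h3 : ContDiffAt ℝ n (fun z : ℝ × ℝ => (1 - x₀ * (1 + κ * z.1))) z := by fun_prop
  exact contDiffAt_const.mul ((h3.mul hu).sub ((contDiffAt_const.mul (h3.pow 2)).mul (hu.add (contDiffAt_const.mul h2))))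

lemma Lm_line {x₀ M : ℝ} {u : ℝ → ℝ} {s u1 : ℝ} (hM : M ≠ 0) (hu : HasDerivAt u u1 s) (h1 : M * u s < 1) :
    HasDerivAt (fun t => Lm x₀ M (u t)) (M * u s / (1 - M * u s) / x₀ * u1) s := by
  unfold Lm lam
  have h0 : 1 - M * u s ≠ 0 := by linarith
  have h2 := hu.const_mul M
  have h3 := ((h2.const_sub 1).log h0).neg.sub h2
  refine (h3.div_const (x₀ * M)).congr_deriv ?_
  rcases eq_or_ne x₀ 0 with rfl | hx
  · simp
  field_simp
  ring

lemma p_line (x₀ κ s : ℝ) : HasDerivAt (fun t => 1 - x₀ * (1 + κ * t)) (-(x₀ * κ)) s := by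
  have := ((((hasDerivAt_id s).const_mul κ).const_add 1).const_mul x₀).const_sub 1
  exact this.congr_deriv (by simp)

lemma q_line (κ s : ℝ) : HasDerivAt (fun t => 1 + κ * t) κ s := by
  have := (((hasDerivAt_id s).const_mul κ).const_add 1)
  exact this.congr_deriv (by simp)

noncomputable def cf1 (x₀ κ s : ℝ) : ℝ := 2 * (1 - x₀ * (1 + κ * s)) * (x₀ * κ) * (1 + κ * s) - (1 - x₀ * (1 + κ * s)) ^ 2 * κ
noncomputable def ef1 (x₀ κ s : ℝ) : ℝ := -3 * (x₀ * κ) * (1 - x₀ * (1 + κ * s)) ^ 2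

lemma cf_line (x₀ κ s : ℝ) : HasDerivAt (cf x₀ κ) (cf1 x₀ κ s) s := by
  have := (((p_line x₀ κ s).pow 2).mul (q_line κ s)).const_sub 1
  unfold cf cf1
  exact this.congr_deriv (by simp; ring)

lemma ef_line (x₀ κ s : ℝ) : HasDerivAt (ef x₀ κ) (ef1 x₀ κ s) s := by
  have := ((p_line x₀ κ s).pow 3)
  unfold ef ef1
  exact this.congr_deriv (by simp; ring)

lemma cf1_line (x₀ κ s : ℝ) : HasDerivAt (cf1 x₀ κ)
    (2 * x₀ * κ * (-(x₀ * κ) * (1 + κ * s) + (1 - x₀ * (1 + κ * s)) * κ) + 2 * κ * (x₀ * κ) * (1 - x₀ * (1 + κ * s))) s := by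
  have := (((((p_line x₀ κ s).const_mul 2).mul_const (x₀ * κ)).mul (q_line κ s))).sub (((p_line x₀ κ s).pow 2).mul_const κ)
  unfold cf1
  exact this.congr_deriv (by simp; ring)

lemma ef1_line (x₀ κ s : ℝ) : HasDerivAt (ef1 x₀ κ) (6 * (x₀ * κ) ^ 2 * (1 - x₀ * (1 + κ * s))) s := by
  have := ((p_line x₀ κ s).pow 2).const_mul (-3 * (x₀ * κ))
  unfold ef1
  exact this.congr_deriv (by simp; ring)

lemma N_line {x₀ M : ℝ} {u : ℝ → ℝ} {s u1 : ℝ} (hu : HasDerivAt u u1 s) (h1 : M * u s < 1) :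
    HasDerivAt (fun t => M * u t / (1 - M * u t) / x₀) (M * u1 / (1 - M * u s) ^ 2 / x₀) s := by
  have h0 : 1 - M * u s ≠ 0 := by linarith
  have h2 := hu.const_mul M
  refine ((h2.div (h2.const_sub 1) h0).div_const x₀).congr_deriv ?_
  congr 2
  ring

lemma Gpde {x₀ κ M : ℝ} {u : ℝ × ℝ → ℝ} {U : Set (ℝ × ℝ)} (hU : IsOpen U) (hM : M ≠ 0)
    (hu : ∀ z ∈ U, ContDiffAt ℝ 2 u z) (h1 : ∀ z ∈ U, M * u z < 1) {z : ℝ × ℝ} (hz : z ∈ U) :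
    pdx (pdx (Gf x₀ κ M u)) z = ((2 * x₀ * κ * (-(x₀ * κ) * (1 + κ * z.1) + (1 - x₀ * (1 + κ * z.1)) * κ) + 2 * κ * (x₀ * κ) * (1 - x₀ * (1 + κ * z.1))) * u z
    + 2 * ((2 * (1 - x₀ * (1 + κ * z.1)) * (x₀ * κ) * (1 + κ * z.1) - (1 - x₀ * (1 + κ * z.1)) ^ 2 * κ) * pdx u z) + (1 - (1 - x₀ * (1 + κ * z.1)) ^ 2 * (1 + κ * z.1)) * pdx (pdx u) z
    + 6 * (x₀ * κ) ^ 2 * (1 - x₀ * (1 + κ * z.1)) * Lm x₀ M (u z) + 2 * (-3 * (x₀ * κ) * (1 - x₀ * (1 + κ * z.1)) ^ 2 * (M * u z / (1 - M * u z) / x₀ * pdx u z))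
    + (1 - x₀ * (1 + κ * z.1)) ^ 3 * (M * pdx u z / (1 - M * u z) ^ 2 / x₀ * pdx u z + M * u z / (1 - M * u z) / x₀ * pdx (pdx u) z)) ∧
    pdx (G1f x₀ κ M u) z = (-κ * (-(x₀ * κ) * u z + (1 - x₀ * (1 + κ * z.1)) * pdx u z - (-8 * (x₀ * κ) * (1 - x₀ * (1 + κ * z.1)) * (u z + x₀ * Lm x₀ M (u z)) + 4 * (1 - x₀ * (1 + κ * z.1)) ^ 2 * (pdx u z + x₀ * (M * u z / (1 - M * u z) / x₀ * pdx u z))))) := by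
  have r1 : ∀ w ∈ U, pdx (Gf x₀ κ M u) w = cf1 x₀ κ w.1 * u w + cf x₀ κ w.1 * pdx u w + (ef1 x₀ κ w.1 * Lm x₀ M (u w) +
      ef x₀ κ w.1 * (M * u w / (1 - M * u w) / x₀ * pdx u w)) := by
    intro w hw
    have d0 := (lines (Gf_cd (x₀ := x₀) (κ := κ) (hu w hw) (h1 w hw))).1
    have d1 := (lines (hu w hw)).1
    have d2 := Lm_line (x₀ := x₀) hM d1 (h1 w hw)
    exact d0.unique (((cf_line x₀ κ w.1).mul d1).add ((ef_line x₀ κ w.1).mul d2))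
  have ez : ∀ᶠ t in 𝓝 z.1, (t, z.2) ∈ U := by
    have : ContinuousAt (fun t : ℝ => (t, z.2)) z.1 := by fun_prop
    exact this.eventually_mem (hU.mem_nhds hz)
  have d1 := (lines (hu z hz)).1
  have d2 := Lm_line (x₀ := x₀) hM d1 (h1 z hz)
  constructor
  · have d0 := (lines (Gf_cd (x₀ := x₀) (κ := κ) (hu z hz) (h1 z hz))).2.1
    have d1' := (lines (hu z hz)).2.1
    have d3 := N_line (x₀ := x₀) d1 (h1 z hz)
    have d4 := (((cf1_line x₀ κ z.1).mul d1).add ((cf_line x₀ κ z.1).mul d1')).add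
      (((ef1_line x₀ κ z.1).mul d2).add ((ef_line x₀ κ z.1).mul (d3.mul d1')))
    have := d0.unique (d4.congr_of_eventuallyEq (by filter_upwards [ez] with t ht using r1 _ ht))
    rw [this]
    simp only [cf1, cf, ef, ef1, Pi.mul_apply, Prod.mk.eta]
    ring
  · have d0 := line_x ((G1f_cd (x₀ := x₀) (κ := κ) (hu z hz) (h1 z hz)).differentiableAt (by simp))
    have d4 := (((p_line x₀ κ z.1).mul d1).sub ((((p_line x₀ κ z.1).pow 2).const_mul 4).mul (d1.add (d2.const_mul x₀)))).const_mul (-κ)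
    have := d0.unique d4
    rw [this]
    simp only [Pi.pow_apply, Pi.add_apply, Prod.mk.eta]
    push_cast
    ring

end S15
end

section
open Real Set Filter Topology
namespace S15

lemma aff_pd {W : ℝ × ℝ → ℝ} {x₀ y₀ A B m : ℝ} {z : ℝ × ℝ} (h : DifferentiableAt ℝ W (x₀ + A * z.1, y₀ + B * z.2)) :
    pdx (fun z => m * W (x₀ + A * z.1, y₀ + B * z.2)) z = m * A * pdx W (x₀ + A * z.1, y₀ + B * z.2) ∧
    pdy (fun z => m * W (x₀ + A * z.1, y₀ + B * z.2)) z = m * B * pdy W (x₀ + A * z.1, y₀ + B * z.2) := by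
  have hd : DifferentiableAt ℝ (fun z : ℝ × ℝ => m * W (x₀ + A * z.1, y₀ + B * z.2)) z := by
    apply DifferentiableAt.const_mul
    exact DifferentiableAt.comp (g := W) (f := fun z : ℝ × ℝ => (x₀ + A * z.1, y₀ + B * z.2)) z h (by fun_prop)
  constructor
  · have d0 := line_x hd
    have d1 := line_x h
    have d2 : HasDerivAt (fun t : ℝ => x₀ + A * t) A z.1 := by
      have := ((hasDerivAt_id z.1).const_mul A).const_add x₀
      exact this.congr_deriv (by simp)
    have d3 := (HasDerivAt.comp (h₂ := fun t => W (t, y₀ + B * z.2)) z.1 d1 d2).const_mul m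
    rw [d0.unique d3]; ring
  · have d0 := line_y hd
    have d1 := line_y h
    have d2 : HasDerivAt (fun t : ℝ => y₀ + B * t) B z.2 := by
      have := ((hasDerivAt_id z.2).const_mul B).const_add y₀
      exact this.congr_deriv (by simp)
    have d3 := (HasDerivAt.comp (h₂ := fun t => W (x₀ + A * z.1, t)) z.2 d1 d2).const_mul m
    rw [d0.unique d3]; ring

lemma aff_pd2 {W : ℝ × ℝ → ℝ} {x₀ y₀ A B m : ℝ} {U : Set (ℝ × ℝ)} (hU : IsOpen U)
    (h : ∀ z ∈ U, ContDiffAt ℝ 2 W (x₀ + A * z.1, y₀ + B * z.2)) {z : ℝ × ℝ} (hz : z ∈ U) :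
    pdx (pdx (fun z => m * W (x₀ + A * z.1, y₀ + B * z.2))) z = m * A * A * pdx (pdx W) (x₀ + A * z.1, y₀ + B * z.2) ∧
    pdy (pdy (fun z => m * W (x₀ + A * z.1, y₀ + B * z.2))) z = m * B * B * pdy (pdy W) (x₀ + A * z.1, y₀ + B * z.2) := by
  constructor
  · have e : pdx (fun z => m * W (x₀ + A * z.1, y₀ + B * z.2)) =ᶠ[𝓝 z] fun z => m * A * pdx W (x₀ + A * z.1, y₀ + B * z.2) := by
      filter_upwards [hU.mem_nhds hz] with w hw using (aff_pd ((h w hw).differentiableAt (by simp))).1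
    rw [(pdx_congr e).eq_of_nhds]
    exact (aff_pd ((pdx_cdAt (h z hz)).differentiableAt (by simp))).1
  · have e : pdy (fun z => m * W (x₀ + A * z.1, y₀ + B * z.2)) =ᶠ[𝓝 z] fun z => m * B * pdy W (x₀ + A * z.1, y₀ + B * z.2) := by
      filter_upwards [hU.mem_nhds hz] with w hw using (aff_pd ((h w hw).differentiableAt (by simp))).2
    rw [(pdy_congr e).eq_of_nhds]
    exact (aff_pd ((pdy_cdAt (h z hz)).differentiableAt (by simp))).2

lemma rhs_bd {x₀ κ M p u l : ℝ} (hx : 0 < x₀) (hκ : 0 < κ) (hκ4 : κ ≤ 1 / 4) (hxκ : x₀ ≤ κ) (hM : 0 < M) (hM2 : x₀ ^ 2 ≤ M)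
    (hp : 3 / 4 ≤ p ∧ p ≤ 5 / 4) (hu : |u| ≤ 1) (hl : |l| ≤ 3 * κ) :
    |κ ^ 2 * x₀ * (2 * (1 - x₀ * p) * (u + x₀ * l)) + κ ^ 2 * x₀ * (x₀ * p / M)| ≤ 1 := by
  have k2 : κ ^ 2 ≤ 1 / 16 := by nlinarith
  have x4 : x₀ ≤ 1 / 4 := by linarith
  have a1 : |κ ^ 2 * x₀| ≤ 1 / 64 := by
    rw [abs_of_pos (by positivity)]
    have := mul_le_mul k2 x4 hx.le (by norm_num); linarith
  have a2 : |1 - x₀ * p| ≤ 1 := by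
    rw [abs_le]; constructor <;> nlinarith
  have a3 : |u + x₀ * l| ≤ 2 := by
    refine (abs_add_le _ _).trans ?_
    rw [abs_mul, abs_of_pos hx]
    have := mul_le_mul x4 (hl.trans (by linarith : 3 * κ ≤ 1)) (abs_nonneg _) (by norm_num)
    linarith
  have a4 : |κ ^ 2 * x₀ * (x₀ * p / M)| ≤ 1 / 8 := by
    have e : κ ^ 2 * x₀ * (x₀ * p / M) = κ ^ 2 * (p * (x₀ ^ 2 / M)) := by ring
    have h1 : x₀ ^ 2 / M ≤ 1 := (div_le_one hM).2 hM2
    have h0 : 0 ≤ x₀ ^ 2 / M := by positivity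
    have p0 : 0 ≤ p := by linarith
    rw [e, abs_of_nonneg (by positivity)]
    have := mul_le_mul hp.2 h1 h0 (by norm_num)
    have := mul_le_mul k2 this (by positivity) (by norm_num)
    linarith
  have a5 : |κ ^ 2 * x₀ * (2 * (1 - x₀ * p) * (u + x₀ * l))| ≤ 1 / 16 := by
    rw [abs_mul, abs_mul (2 * _), abs_mul 2, abs_of_pos (by norm_num : (0:ℝ) < 2)]
    have := mul_le_mul a2 a3 (abs_nonneg _) (by norm_num)
    have := mul_le_mul a1 this (by positivity) (by norm_num)
    linarith
  refine (abs_add_le _ _).trans ?_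
  linarith

end S15
end

section
open Real Set Filter Topology
namespace S15

lemma n2 {z : ℝ × ℝ} {c : ℝ} (h : ‖z‖ < c) : |z.1| < c ∧ |z.2| < c := by
  rw [Prod.norm_def, max_lt_iff] at h; exact h

lemma core {α : ℝ} (hα : α ∈ Ioo (0:ℝ) 1) : ∃ κ C : ℝ, 0 < κ ∧ κ ≤ 1 / 4 ∧ 0 < C ∧ ∀ (F : ℝ × ℝ → ℝ) (a R x₀ y₀ M : ℝ),
    NS F a R → 0 < x₀ → x₀ ≤ κ → 0 < M → M ≤ κ * x₀ → x₀ ^ 2 ≤ M → 3 / 2 * x₀ < a → |y₀| + √x₀ < R →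
    (∀ x y, |x - x₀| ≤ x₀ / 4 → |y - y₀| ≤ √x₀ → |Vf F (x, y)| ≤ M) →
    (|pdx (Vf F) (x₀, y₀)| ≤ C * (M / (κ * x₀)) ∧ |pdy (Vf F) (x₀, y₀)| ≤ C * (M / (κ * x₀))) ∧
    ∀ z' : ℝ × ℝ, ‖z' - (x₀, y₀)‖ ≤ κ / 8 * x₀ → 
      |pdx (Vf F) z' - pdx (Vf F) (x₀, y₀)| ≤ C * (M / (κ * x₀)) * (‖z' - (x₀, y₀)‖ / (κ * x₀)) ^ α ∧
      |pdy (Vf F) z' - pdy (Vf F) (x₀, y₀)| ≤ C * (M / (κ * x₀)) * (‖z' - (x₀, y₀)‖ / (κ * x₀)) ^ α := by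
  obtain ⟨ε, C, hε, hC, H⟩ := LL hα
  refine ⟨min (1 / 4) (ε / 40), C, by positivity, min_le_left _ _, hC, ?_⟩
  obtain ⟨κ, hκe⟩ : ∃ κ, κ = min (1 / 4) (ε / 40) := ⟨_, rfl⟩
  have hκ : 0 < κ := by rw [hκe]; positivity
  have hκ4 : κ ≤ 1 / 4 := by rw [hκe]; exact min_le_left _ _
  have hκε : 40 * κ ≤ ε := by
    have : κ ≤ ε / 40 := by rw [hκe]; exact min_le_right _ _
    linarith
  rw [← hκe]
  clear hκe
  intro F a R x₀ y₀ M h hx hxκ hM hMκ hM2 hxa hyR hV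
  obtain ⟨q, hq⟩ : ∃ q, q = √x₀ := ⟨_, rfl⟩
  have hq0 : 0 < q := by rw [hq]; exact sqrt_pos.2 hx
  have hqq : q * q = x₀ := by rw [hq]; exact mul_self_sqrt hx.le
  have hxq : x₀ ≤ q := by
    have : q ≤ 1 := by rw [hq]; exact sqrt_le_one.2 (by linarith)
    nlinarith
  rw [← hq] at hyR hV
  clear hq
  set A := κ * x₀ with hA
  set B := κ * q with hB
  have hA0 : 0 < A := by positivity
  have hB0 : 0 < B := by positivity
  have hAB : A ≤ B := by rw [hA, hB]; exact mul_le_mul_of_nonneg_left hxq hκ.le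
  set u : ℝ × ℝ → ℝ := fun z => M⁻¹ * Vf F (x₀ + A * z.1, y₀ + B * z.2) with hu
  set U : Set (ℝ × ℝ) := Metric.ball 0 2 with hUdef
  have hU : IsOpen U := Metric.isOpen_ball
  have inOm : ∀ z ∈ U, (x₀ + A * z.1, y₀ + B * z.2) ∈ Om a R := by
    intro z hz
    have hz' : ‖z‖ < 2 := by rw [hUdef] at hz; simpa using hz
    obtain ⟨h1, h2⟩ := n2 hz'
    have t1 : |A * z.1| ≤ x₀ / 2 := by
      rw [abs_mul, abs_of_pos hA0, hA]
      have := mul_le_mul (mul_le_mul_of_nonneg_right hκ4 hx.le) h1.le (abs_nonneg _) (by positivity)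
      linarith
    have t2 : |B * z.2| ≤ q / 2 := by
      rw [abs_mul, abs_of_pos hB0, hB]
      have := mul_le_mul (mul_le_mul_of_nonneg_right hκ4 hq0.le) h2.le (abs_nonneg _) (by positivity)
      linarith
    have t3 := abs_le.1 t1
    refine ⟨?_, ?_, ?_⟩
    · simp only; linarith
    · simp only; linarith
    · simp only; have := abs_add_le y₀ (B * z.2); linarith
  have Wc : ∀ z ∈ U, ContDiffAt ℝ 2 (Vf F) (x₀ + A * z.1, y₀ + B * z.2) := fun z hz => h.Vc2 (inOm z hz)
  have uc : ∀ z ∈ U, ContDiffAt ℝ 2 u z := by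
    intro z hz
    refine contDiffAt_const.mul ?_
    exact ContDiffAt.comp (g := Vf F) (f := fun z : ℝ × ℝ => (x₀ + A * z.1, y₀ + B * z.2)) z (Wc z hz) (by fun_prop)
  have Mu : ∀ z, M * u z = Vf F (x₀ + A * z.1, y₀ + B * z.2) := by
    intro z; rw [hu]; field_simp
  have Mu1 : ∀ z ∈ U, M * u z < 1 := by
    intro z hz
    rw [Mu]
    have := (h.Vbounds (inOm z hz)).1
    have := (inOm z hz).2.1
    have := h.ha4
    linarith
  have ubd : ∀ z, ‖z‖ < 1 → |u z| ≤ 1 := by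
    intro z hz
    obtain ⟨h1, h2⟩ := n2 hz
    have : |M * u z| ≤ M := by
      rw [Mu]
      apply hV
      · rw [add_sub_cancel_left, abs_mul, abs_of_pos hA0, hA]
        have := mul_le_mul (mul_le_mul_of_nonneg_right hκ4 hx.le) h1.le (abs_nonneg _) (by positivity)
        linarith
      · rw [add_sub_cancel_left, abs_mul, abs_of_pos hB0, hB]
        have := mul_le_mul (mul_le_mul_of_nonneg_right hκ4 hq0.le) h2.le (abs_nonneg _) (by positivity)
        linarith
    rw [abs_mul, abs_of_pos hM] at this
    exact le_of_mul_le_mul_left (by linarith) hM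
  have lU : ∀ z : ℝ × ℝ, ‖z‖ < 1 → z ∈ U := by
    intro z hz; rw [hUdef]; simp; linarith
  have hM4 : M ≤ 1 / 4 := by
    have := mul_le_mul hκ4 (hxκ.trans hκ4) hx.le (by norm_num)
    linarith
  obtain ⟨G1, G2⟩ := H u (Gf x₀ κ M u) (G1f x₀ κ M u)
    (fun z hz => (uc z hz).contDiffWithinAt)
    (fun z hz => (Gf_cd (uc z hz) (Mu1 z hz)).contDiffWithinAt)
    (fun z hz => (G1f_cd ((uc z hz).of_le (by norm_num)) (Mu1 z hz)).contDiffWithinAt)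
    ubd
    (by
      intro z hz
      have hzU := lU z hz
      obtain ⟨g1, g2⟩ := Gpde (x₀ := x₀) (κ := κ) hU hM.ne' uc Mu1 hzU
      rw [g1, g2]
      have pd := h.Vpde (inOm z hzU)
      have e1 := (aff_pd (m := M⁻¹) ((Wc z hzU).differentiableAt (by simp))).1
      obtain ⟨e2, e3⟩ := aff_pd2 (m := M⁻¹) hU Wc hzU
      rw [← hu] at e1 e2 e3
      have hxe : x₀ + A * z.1 = x₀ * (1 + κ * z.1) := by rw [hA]; ring
      have f1 : pdx (Vf F) (x₀ + A * z.1, y₀ + B * z.2) = M * pdx u z / (κ * x₀) := by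
        rw [e1, ← hA]; field_simp
      have f2 : pdx (pdx (Vf F)) (x₀ + A * z.1, y₀ + B * z.2) = M * pdx (pdx u) z / (κ * x₀) ^ 2 := by
        rw [e2, ← hA]; field_simp
      have f3 : pdy (pdy (Vf F)) (x₀ + A * z.1, y₀ + B * z.2) = M * pdy (pdy u) z / (κ ^ 2 * x₀) := by
        rw [e3, hB, ← hqq]; field_simp
      rw [f1, f2, f3, ← Mu] at pd
      simp only [hxe] at pd
      rw [alg hx.ne' hκ.ne' hM.ne' (by have := Mu1 z hzU; linarith) pd]
      exact rhs_bd hx hκ hκ4 hxκ hM hM2 (pp hκ hκ4 (n2 hz).1) (ubd z hz) (Lm_bd hx hM hM4 hMκ (ubd z hz)))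
    (by
      intro z k hz
      refine (ddG hx hκ hκ4 hxκ hM hMκ ubd z k hz).trans ?_
      exact mul_le_mul_of_nonneg_right hκε (by positivity))
    (by
      intro z k hz
      refine (diffG1 hx hκ hκ4 hxκ hM hMκ ubd z k hz).trans ?_
      exact mul_le_mul_of_nonneg_right hκε (by positivity))
  have nx : ‖((1:ℝ), (0:ℝ))‖ = 1 := by simp [Prod.norm_def]
  have ny : ‖((0:ℝ), (1:ℝ))‖ = 1 := by simp [Prod.norm_def]
  have Vx : ∀ z ∈ U, pdx (Vf F) (x₀ + A * z.1, y₀ + B * z.2) = M / A * pdx u z := by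
    intro z hz
    have e1 := (aff_pd (m := M⁻¹) ((Wc z hz).differentiableAt (by simp))).1
    rw [← hu] at e1
    rw [e1]; field_simp
  have Vy : ∀ z ∈ U, pdy (Vf F) (x₀ + A * z.1, y₀ + B * z.2) = M / B * pdy u z := by
    intro z hz
    have e1 := (aff_pd (m := M⁻¹) ((Wc z hz).differentiableAt (by simp))).2
    rw [← hu] at e1
    rw [e1]; field_simp
  have hMB : M / B ≤ M / A := by
    apply div_le_div_of_nonneg_left hM.le hA0 hAB
  have z0U : (0 : ℝ × ℝ) ∈ U := lU 0 (by simp)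
  have Vx0 := Vx 0 z0U
  have Vy0 := Vy 0 z0U
  simp only [Prod.fst_zero, Prod.snd_zero, mul_zero, add_zero] at Vx0 Vy0
  have MA0 : 0 < M / A := by positivity
  have MB0 : 0 < M / B := by positivity
  constructor
  · constructor
    · rw [Vx0, abs_mul, abs_of_pos MA0, mul_comm C]
      have := G1 0 (1, 0) (by simp)
      rw [nx, mul_one] at this
      exact mul_le_mul_of_nonneg_left this MA0.le
    · rw [Vy0, abs_mul, abs_of_pos MB0, mul_comm C]
      have := G1 0 (0, 1) (by simp)
      rw [ny, mul_one] at this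
      exact mul_le_mul hMB this (abs_nonneg _) MA0.le
  · intro z' hz'
    obtain ⟨x', y'⟩ := z'
    set D := ‖(x', y') - (x₀, y₀)‖ with hD
    have hD1 : |x' - x₀| ≤ D := by
      rw [hD, Prod.norm_def]; exact le_max_left _ _
    have hD2 : |y' - y₀| ≤ D := by
      rw [hD, Prod.norm_def]; exact le_max_right _ _
    have hD0 : 0 ≤ D := by rw [hD]; positivity
    set w : ℝ × ℝ := ((x' - x₀) / A, (y' - y₀) / B) with hw
    have hwn : ‖w‖ ≤ D / A := by
      rw [hw, Prod.norm_def, max_le_iff]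
      constructor
      · simp only [norm_eq_abs, abs_div, abs_of_pos hA0]
        exact div_le_div_of_nonneg_right hD1 hA0.le
      · simp only [norm_eq_abs, abs_div, abs_of_pos hB0]
        exact div_le_div₀ hD0 hD2 hA0 hAB
    have hDA : D / A ≤ 1 / 8 := by
      rw [div_le_iff₀ hA0, hA]; linarith
    have hwU : w ∈ U := lU w (by linarith)
    have ew : (x₀ + A * w.1, y₀ + B * w.2) = (x', y') := by
      rw [hw]; ext
      · simp only; field_simp; ring
      · simp only; field_simp; ring
    have Vxw := Vx w hwU
    have Vyw := Vy w hwU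
    rw [ew] at Vxw Vyw
    have hp : ‖w - 0‖ ^ α ≤ (D / A) ^ α := by
      rw [sub_zero]; exact rpow_le_rpow (norm_nonneg _) hwn hα.1.le
    constructor
    · rw [Vxw, Vx0, ← mul_sub, abs_mul, abs_of_pos MA0, mul_comm C, mul_assoc]
      have := G2 0 w (1, 0) (by simp) (by linarith) (by rw [sub_zero]; linarith)
      rw [nx, mul_one] at this
      refine mul_le_mul_of_nonneg_left (le_trans this ?_) MA0.le
      exact mul_le_mul_of_nonneg_left hp hC.le
    · rw [Vyw, Vy0, ← mul_sub, abs_mul, abs_of_pos MB0, mul_comm C, mul_assoc]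
      have := G2 0 w (0, 1) (by simp) (by linarith) (by rw [sub_zero]; linarith)
      rw [ny, mul_one] at this
      refine mul_le_mul hMB (le_trans this ?_) (abs_nonneg _) MA0.le
      exact mul_le_mul_of_nonneg_left hp hC.le

end S15
end

section
open Real Set Filter Topology
namespace S15

lemma NS.est {F : ℝ × ℝ → ℝ} {a R R' α : ℝ} (h : NS F a R) (hR' : R' < R) (hα : α ∈ Ioo (0:ℝ) 1) :
    ∃ K δ c : ℝ, 0 < K ∧ 0 < δ ∧ 3 / 2 * δ < a ∧ 0 < c ∧ c ≤ 1 / 2 ∧ (∀ y, |y| ≤ R' → |y| + δ < R) ∧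
      ∀ x₀ y₀ : ℝ, 0 < x₀ → x₀ ≤ δ → |y₀| ≤ R' → 
      |Vf F (x₀, y₀)| ≤ K * x₀ ^ α ∧ |pdx (Vf F) (x₀, y₀)| ≤ K * x₀ ^ α ∧ |pdy (Vf F) (x₀, y₀)| ≤ K * x₀ ^ α ∧
      ∀ z' : ℝ × ℝ, ‖z' - (x₀, y₀)‖ ≤ c * x₀ → 
        |pdx (Vf F) z' - pdx (Vf F) (x₀, y₀)| ≤ K * ‖z' - (x₀, y₀)‖ ^ α ∧
        |pdy (Vf F) z' - pdy (Vf F) (x₀, y₀)| ≤ K * ‖z' - (x₀, y₀)‖ ^ α := by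
  obtain ⟨κ, C, hκ, hκ4, hC, H⟩ := core hα
  obtain ⟨hα0, hα1⟩ := hα
  set d : ℝ := (R - R') / 4 with hd
  have hd0 : 0 < d := by rw [hd]; linarith
  obtain ⟨C₁, δg, hC₁, hδg, hδa, hG⟩ := h.growth (R' := R' + d) (by rw [hd]; linarith) ⟨hα0, hα1⟩
  set C₀ : ℝ := 4 * C₁ + 1 with hC₀
  have hC₀0 : 0 < C₀ := by positivity
  have hκ1 : κ ^ α ≤ 1 := rpow_le_one hκ.le (by linarith) hα0.le
  have hκ0 : 0 < κ ^ α := by positivity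
  set K : ℝ := C * C₀ / κ / κ ^ α with hK
  have hK0 : 0 < K := by positivity
  have hK1 : C * C₀ / κ ≤ K := by
    rw [hK, le_div_iff₀ hκ0]
    exact mul_le_of_le_one_right (by positivity) hκ1
  set e : ℝ := (κ / C₀) ^ (1 / α) with he
  have he0 : 0 < e := by positivity
  set δ : ℝ := min (δg / 2) (min κ (min e (min (d ^ 2) d))) with hδ
  have hδ0 : 0 < δ := by positivity
  have l1 : δ ≤ δg / 2 := min_le_left _ _
  have l2 : δ ≤ κ := (min_le_right _ _).trans (min_le_left _ _)
  have l3 : δ ≤ e := (min_le_right _ _).trans ((min_le_right _ _).trans (min_le_left _ _))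
  have l4 : δ ≤ d ^ 2 := (min_le_right _ _).trans ((min_le_right _ _).trans ((min_le_right _ _).trans (min_le_left _ _)))
  have l5 : δ ≤ d := (min_le_right _ _).trans ((min_le_right _ _).trans ((min_le_right _ _).trans (min_le_right _ _)))
  clear_value δ
  refine ⟨K + C₁, δ, κ / 8, by positivity, hδ0, by linarith, by positivity, by linarith, ?_, ?_⟩
  · intro y hy; linarith
  intro x₀ y₀ hx hxδ hy
  have hx1 : x₀ ≤ 1 := by linarith
  have hxα : 0 < x₀ ^ α := by positivity
  have xa : x₀ ^ (1 + α) = x₀ * x₀ ^ α := by rw [rpow_add hx, rpow_one]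
  set M : ℝ := C₀ * x₀ ^ (1 + α) with hM
  have hM0 : 0 < M := by positivity
  have hxe : x₀ ^ α ≤ κ / C₀ := by
    have := rpow_le_rpow hx.le (hxδ.trans l3) hα0.le
    rwa [he, ← rpow_mul (by positivity), one_div, inv_mul_cancel₀ hα0.ne', rpow_one] at this
  have hMκ : M ≤ κ * x₀ := by
    rw [hM, xa]
    have := mul_le_mul_of_nonneg_left hxe hC₀0.le
    rw [mul_div_cancel₀ _ hC₀0.ne'] at this
    have := mul_le_mul_of_nonneg_right this hx.le
    linarith
  have hM2 : x₀ ^ 2 ≤ M := by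
    have : x₀ ^ (2:ℝ) ≤ x₀ ^ (1 + α) := rpow_le_rpow_of_exponent_ge hx hx1 (by linarith)
    rw [rpow_two] at this
    have h1 : 1 * x₀ ^ (1 + α) ≤ C₀ * x₀ ^ (1 + α) := mul_le_mul_of_nonneg_right (by linarith) (by positivity)
    linarith
  have hsq : √x₀ ≤ d := by
    rw [sqrt_le_left hd0.le]; linarith
  have hVM : ∀ x y, |x - x₀| ≤ x₀ / 4 → |y - y₀| ≤ √x₀ → |Vf F (x, y)| ≤ M := by
    intro x y h1 h2
    rw [abs_le] at h1
    have hx0' : 0 < x := by linarith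
    refine (hG x y hx0' (by linarith) ?_).trans ?_
    · have := abs_add_le y₀ (y - y₀)
      rw [add_sub_cancel] at this
      linarith
    · have h3 : x ^ (1 + α) ≤ (5 / 4 * x₀) ^ (1 + α) := rpow_le_rpow hx0'.le (by linarith) (by linarith)
      rw [mul_rpow (by norm_num) hx.le] at h3
      have h4 : (5 / 4 : ℝ) ^ (1 + α) ≤ (5 / 4 : ℝ) ^ (2:ℝ) := rpow_le_rpow_of_exponent_le (by norm_num) (by linarith)
      rw [rpow_two] at h4
      have h5 : (5 / 4 : ℝ) ^ (1 + α) * x₀ ^ (1 + α) ≤ 4 * x₀ ^ (1 + α) :=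
        mul_le_mul_of_nonneg_right (by linarith) (by positivity)
      have h6 := mul_le_mul_of_nonneg_left (h3.trans h5) hC₁.le
      have h7 : 0 ≤ x₀ ^ (1 + α) := by positivity
      rw [hM, hC₀]; linarith
  obtain ⟨⟨H1, H2⟩, H3⟩ := H F a R x₀ y₀ M h hx (by linarith) hM0 hMκ hM2 (by linarith) (by linarith) hVM
  have eM : C * (M / (κ * x₀)) = C * C₀ / κ * x₀ ^ α := by
    rw [hM, xa]; field_simp
  rw [eM] at H1 H2 H3
  have hKx : C * C₀ / κ * x₀ ^ α ≤ (K + C₁) * x₀ ^ α := mul_le_mul_of_nonneg_right (by linarith) hxα.le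
  refine ⟨?_, H1.trans hKx, H2.trans hKx, ?_⟩
  · refine (hG x₀ y₀ hx (by linarith) (by linarith)).trans ?_
    rw [xa]
    have h1 : x₀ * x₀ ^ α ≤ x₀ ^ α := mul_le_of_le_one_left hxα.le hx1
    exact mul_le_mul (by linarith) h1 (by positivity) (by positivity)
  · intro z' hz'
    obtain ⟨H4, H5⟩ := H3 z' hz'
    have eD : C * C₀ / κ * x₀ ^ α * (‖z' - (x₀, y₀)‖ / (κ * x₀)) ^ α = K * ‖z' - (x₀, y₀)‖ ^ α := by
      rw [div_rpow (norm_nonneg _) (by positivity), mul_rpow hκ.le hx.le, hK]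
      field_simp
    rw [eD] at H4 H5
    have : K * ‖z' - (x₀, y₀)‖ ^ α ≤ (K + C₁) * ‖z' - (x₀, y₀)‖ ^ α :=
      mul_le_mul_of_nonneg_right (by linarith) (by positivity)
    exact ⟨H4.trans this, H5.trans this⟩

end S15
end

section
open Real Set Filter Topology
namespace S15

lemma fd_bd {f : ℝ × ℝ → ℝ} {z : ℝ × ℝ} {B : ℝ} (h1 : |pdx f z| ≤ B) (h2 : |pdy f z| ≤ B) : ‖fderiv ℝ f z‖ ≤ 2 * B := by
  have hB : 0 ≤ B := (abs_nonneg _).trans h1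
  refine ContinuousLinearMap.opNorm_le_bound _ (by positivity) ?_
  intro e
  have he : fderiv ℝ f z e = e.1 * pdx f z + e.2 * pdy f z := by
    have : e = e.1 • ((1:ℝ), (0:ℝ)) + e.2 • ((0:ℝ), (1:ℝ)) := by ext <;> simp
    unfold pdx pdy
    conv_lhs => rw [this]
    rw [map_add, map_smul, map_smul]; simp
  rw [he, norm_eq_abs]
  refine (abs_add_le _ _).trans ?_
  rw [abs_mul, abs_mul]
  have a1 : |e.1| ≤ ‖e‖ := norm_fst_le e
  have a2 : |e.2| ≤ ‖e‖ := norm_snd_le e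
  have := mul_le_mul a1 h1 (abs_nonneg _) (norm_nonneg _)
  have := mul_le_mul a2 h2 (abs_nonneg _) (norm_nonneg _)
  linarith

lemma NS.Fest {F : ℝ × ℝ → ℝ} {a R R' α : ℝ} (h : NS F a R) (hR' : R' < R) (hα : α ∈ Ioo (0:ℝ) 1) :
    ∃ K δ c : ℝ, 0 < K ∧ 0 < δ ∧ 3 / 2 * δ < a ∧ 0 < c ∧ c ≤ 1 / 2 ∧
      ∀ x₀ y₀ : ℝ, 0 < x₀ → x₀ ≤ δ → |y₀| ≤ R' → 
      |pdx F (x₀, y₀) - 1| ≤ K * x₀ ^ α ∧ |pdy F (x₀, y₀)| ≤ K * x₀ ^ α ∧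
      ∀ z' : ℝ × ℝ, ‖z' - (x₀, y₀)‖ ≤ c * x₀ → 
        |pdx F z' - pdx F (x₀, y₀)| ≤ K * ‖z' - (x₀, y₀)‖ ^ α ∧
        |pdy F z' - pdy F (x₀, y₀)| ≤ K * ‖z' - (x₀, y₀)‖ ^ α := by
  obtain ⟨K, δ, c, hK, hδ, hδa, hc, hc2, hyR, H⟩ := h.est hR' hα
  obtain ⟨hα0, hα1⟩ := hα
  refine ⟨6 * K, δ, c, by positivity, hδ, hδa, hc, hc2, ?_⟩
  intro x₀ y₀ hx hxδ hy
  obtain ⟨H0, H1, H2, H3⟩ := H x₀ y₀ hx hxδ hy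
  have ha4 := h.ha4
  have hyR' := hyR y₀ hy
  have hxα : 0 < x₀ ^ α := by positivity
  have hxα1 : x₀ ^ α ≤ 1 := rpow_le_one hx.le (by linarith) hα0.le
  have inOm : ∀ z : ℝ × ℝ, ‖z - (x₀, y₀)‖ ≤ c * x₀ → z ∈ Om a R ∧ |z.1 - x₀| ≤ ‖z - (x₀, y₀)‖ := by
    intro z hz
    have t1 : |z.1 - x₀| ≤ ‖z - (x₀, y₀)‖ := norm_fst_le (z - (x₀, y₀))
    have t2 : |z.2 - y₀| ≤ ‖z - (x₀, y₀)‖ := norm_snd_le (z - (x₀, y₀))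
    have t3 : c * x₀ ≤ 1 / 2 * x₀ := mul_le_mul_of_nonneg_right hc2 hx.le
    have t4 := abs_le.1 t1
    have := abs_add_le y₀ (z.2 - y₀)
    rw [add_sub_cancel] at this
    exact ⟨⟨by linarith, by linarith, by linarith⟩, t1⟩
  obtain ⟨h0Om, -⟩ := inOm (x₀, y₀) (by simp; positivity)
  obtain ⟨-, e1, e2, -, -⟩ := h.rel h0Om
  simp only at e1 e2
  have x1 : |1 - x₀| ≤ 1 := by rw [abs_le]; constructor <;> linarith
  refine ⟨?_, ?_, ?_⟩
  · rw [e1]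
    have : 1 - Vf F (x₀, y₀) + (1 - x₀) * pdx (Vf F) (x₀, y₀) - 1 = -Vf F (x₀, y₀) + (1 - x₀) * pdx (Vf F) (x₀, y₀) := by ring
    rw [this]
    refine (abs_add_le _ _).trans ?_
    rw [abs_neg, abs_mul]
    have := mul_le_mul x1 H1 (abs_nonneg _) (by norm_num)
    have : 0 < K * x₀ ^ α := by positivity
    linarith
  · rw [e2, abs_mul]
    have := mul_le_mul x1 H2 (abs_nonneg _) (by norm_num)
    have : 0 < K * x₀ ^ α := by positivity
    linarith
  · intro z' hz'
    obtain ⟨hOm, hd1⟩ := inOm z' hz'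
    obtain ⟨-, f1, f2, -, -⟩ := h.rel hOm
    obtain ⟨H4, H5⟩ := H3 z' hz'
    have hD1 : c * x₀ ≤ 1 := by
      have := mul_le_mul hc2 (by linarith : x₀ ≤ 1) hx.le (by norm_num)
      linarith
    have Vd : |Vf F z' - Vf F (x₀, y₀)| ≤ 2 * (2 * K) * ‖z' - (x₀, y₀)‖ := by
      have hs := convex_closedBall (x₀, y₀) (c * x₀)
      refine hs.norm_image_sub_le_of_norm_fderiv_le (𝕜 := ℝ) (f := Vf F) (C := 2 * (2 * K)) ?_ ?_ ?_ ?_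
      · intro z hz
        rw [mem_closedBall_iff_norm] at hz
        exact (h.Vc2 (inOm z hz).1).differentiableAt (by simp)
      · intro z hz
        rw [mem_closedBall_iff_norm] at hz
        obtain ⟨q1, q2⟩ := H3 z hz
        have q3 : K * ‖z - (x₀, y₀)‖ ^ α ≤ K := 
          mul_le_of_le_one_right hK.le (rpow_le_one (norm_nonneg _) (by linarith) hα0.le)
        have q4 : K * x₀ ^ α ≤ K := mul_le_of_le_one_right hK.le hxα1
        apply fd_bd
        · have := abs_sub_abs_le_abs_sub (pdx (Vf F) z) (pdx (Vf F) (x₀, y₀)); linarith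
        · have := abs_sub_abs_le_abs_sub (pdy (Vf F) z) (pdy (Vf F) (x₀, y₀)); linarith
      · simp; positivity
      · rw [mem_closedBall_iff_norm]; exact hz'
    generalize hDd : ‖z' - (x₀, y₀)‖ = D at *
    have hD0 : 0 ≤ D := by rw [← hDd]; positivity
    have hDα : D ≤ D ^ α := by
      have := rpow_le_rpow_of_exponent_ge' hD0 (hz'.trans hD1) hα0.le hα1.le
      rwa [rpow_one] at this
    have x1' : |1 - z'.1| ≤ 1 := by
      have := hOm.1; have := hOm.2.1
      rw [abs_le]; constructor <;> linarith
    have KD : K * D ≤ K * D ^ α := mul_le_mul_of_nonneg_left hDα hK.le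
    have KD0 : 0 ≤ K * D ^ α := by positivity
    have gen : ∀ p p' : ℝ, |p| ≤ K * x₀ ^ α → |p' - p| ≤ K * D ^ α → |(1 - z'.1) * p' - (1 - x₀) * p| ≤ 2 * (K * D ^ α) := by
      intro p p' hp hpp
      have : (1 - z'.1) * p' - (1 - x₀) * p = (1 - z'.1) * (p' - p) - (z'.1 - x₀) * p := by ring
      rw [this]
      refine (abs_sub _ _).trans ?_
      rw [abs_mul, abs_mul]
      have m1 := mul_le_mul x1' hpp (abs_nonneg _) (by norm_num)
      have m2 := mul_le_mul hd1 hp (abs_nonneg _) hD0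
      have m3 : D * (K * x₀ ^ α) ≤ D * K := mul_le_mul_of_nonneg_left (mul_le_of_le_one_right hK.le hxα1) hD0
      linarith
    constructor
    · rw [f1, e1]
      have : 1 - Vf F z' + (1 - z'.1) * pdx (Vf F) z' - (1 - Vf F (x₀, y₀) + (1 - x₀) * pdx (Vf F) (x₀, y₀)) =
        ((1 - z'.1) * pdx (Vf F) z' - (1 - x₀) * pdx (Vf F) (x₀, y₀)) - (Vf F z' - Vf F (x₀, y₀)) := by ring
      rw [this]
      refine (abs_sub _ _).trans ?_
      have := gen _ _ H1 H4
      linarith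
    · rw [f2, e2]
      have := gen _ _ H2 H5
      linarith

lemma assemble {f : ℝ × ℝ → ℝ} {b K δ c L B ρ R' α : ℝ} (hα : α ∈ Ioo (0:ℝ) 1) (hK : 0 ≤ K) (hδ : 0 < δ) (hc : 0 < c) (hc2 : c ≤ 1 / 2)
    (hL : 0 ≤ L) (hB : 0 ≤ B)
    (h1 : ∀ z : ℝ × ℝ, 0 < z.1 → z.1 ≤ δ → |z.2| ≤ R' → |f z - b| ≤ K * z.1 ^ α)
    (h2 : ∀ z z' : ℝ × ℝ, 0 < z.1 → z.1 ≤ δ → |z.2| ≤ R' → 0 < z'.1 → z'.1 ≤ ρ → |z'.2| ≤ R' →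
       ‖z' - z‖ ≤ c * z.1 → |f z' - f z| ≤ K * ‖z' - z‖ ^ α)
    (h3 : ∀ z z' : ℝ × ℝ, δ / 2 ≤ z.1 → z.1 ≤ ρ → |z.2| ≤ R' → δ / 2 ≤ z'.1 → z'.1 ≤ ρ → |z'.2| ≤ R' →
       |f z' - f z| ≤ L * ‖z' - z‖)
    (h4 : ∀ z : ℝ × ℝ, 0 < z.1 → z.1 ≤ ρ → |z.2| ≤ R' → |f z - b| ≤ B) :
    ∃ K' : ℝ, 0 ≤ K' ∧ ∀ z z' : ℝ × ℝ, 0 ≤ z.1 → z.1 ≤ ρ → |z.2| ≤ R' → 0 ≤ z'.1 → z'.1 ≤ ρ → |z'.2| ≤ R' →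
      |(if z'.1 ≤ 0 then b else f z') - (if z.1 ≤ 0 then b else f z)| ≤ K' * ‖z' - z‖ ^ α := by
  obtain ⟨hα0, hα1⟩ := hα
  obtain ⟨g, hg⟩ : ∃ g : ℝ × ℝ → ℝ, g = fun z => if z.1 ≤ 0 then b else f z := ⟨_, rfl⟩
  have g0 : ∀ z : ℝ × ℝ, z.1 ≤ 0 → g z = b := by intro z hz; rw [hg]; simp [hz]
  have gp : ∀ z : ℝ × ℝ, 0 < z.1 → g z = f z := by intro z hz; rw [hg]; simp [hz]
  have gB : ∀ z : ℝ × ℝ, z.1 ≤ ρ → |z.2| ≤ R' → |g z - b| ≤ B := by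
    intro z hz hy
    rcases le_or_gt z.1 0 with hz0 | hz0
    · rw [g0 z hz0]; simpa using hB
    · rw [gp z hz0]; exact h4 z hz0 hz hy
  have gK : ∀ z : ℝ × ℝ, 0 ≤ z.1 → z.1 ≤ δ → |z.2| ≤ R' → |g z - b| ≤ K * z.1 ^ α := by
    intro z hz hzδ hy
    rcases hz.eq_or_lt with hz0 | hz0
    · rw [g0 z hz0.ge]; simp; positivity
    · rw [gp z hz0]; exact h1 z hz0 hzδ hy
  obtain ⟨K', hK'⟩ : ∃ K', K' = K + 2 * K / c ^ α + L + 2 * B + 2 * B / (δ / 2) ^ α := ⟨_, rfl⟩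
  have b1 : 0 ≤ 2 * K / c ^ α := by positivity
  have b2 : 0 ≤ 2 * B / (δ / 2) ^ α := by positivity
  have K0 : 0 ≤ K' := by rw [hK']; positivity
  refine ⟨K', K0, ?_⟩
  have key : ∀ z z' : ℝ × ℝ, 0 ≤ z.1 → z.1 ≤ ρ → |z.2| ≤ R' → 0 ≤ z'.1 → z'.1 ≤ z.1 → |z'.2| ≤ R' →
      |g z' - g z| ≤ K' * ‖z' - z‖ ^ α := by
    intro z z' hz hzρ hy hz' hzz hy'
    obtain ⟨D, hD⟩ : ∃ D, D = ‖z' - z‖ := ⟨_, rfl⟩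
    have hD0 : 0 ≤ D := by rw [hD]; positivity
    have hDα : 0 ≤ D ^ α := by positivity
    have hd1 : |z'.1 - z.1| ≤ D := by rw [hD]; exact norm_fst_le (z' - z)
    have tri : |g z' - g z| ≤ |g z' - b| + |g z - b| := by
      have := abs_sub_le (g z') b (g z)
      rwa [abs_sub_comm b] at this
    have sel : ∀ q, q ≤ K' → |g z' - g z| ≤ q * D ^ α → |g z' - g z| ≤ K' * D ^ α := fun q hq h =>
      h.trans (mul_le_mul_of_nonneg_right hq hDα)
    rw [← hD]
    rcases hz.eq_or_lt with hz0 | hz0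
    · rw [g0 z hz0.ge, g0 z' (by linarith)]; simp; positivity
    rcases le_or_gt z.1 δ with hzδ | hzδ
    · rcases le_or_gt D (c * z.1) with hDc | hDc
      · have : 0 < z'.1 := by
          have := (abs_le.1 hd1).1
          have : c * z.1 ≤ 1 / 2 * z.1 := mul_le_mul_of_nonneg_right hc2 hz
          linarith
        apply sel K (by rw [hK']; linarith)
        rw [gp z' this, gp z hz0, hD]
        exact h2 z z' hz0 hzδ hy this (by linarith) hy' (by rw [← hD]; exact hDc)
      · apply sel (2 * K / c ^ α) (by rw [hK']; linarith)
        have t1 : z.1 ^ α ≤ D ^ α / c ^ α := by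
          rw [← div_rpow hD0 hc.le]
          apply rpow_le_rpow hz _ hα0.le
          rw [le_div_iff₀ hc]; linarith
        have t2 : z'.1 ^ α ≤ z.1 ^ α := rpow_le_rpow hz' hzz hα0.le
        have t3 := gK z hz hzδ hy
        have t4 := gK z' hz' (by linarith) hy'
        have t5 := mul_le_mul_of_nonneg_left t1 hK
        have t6 := mul_le_mul_of_nonneg_left (t2.trans t1) hK
        have : 2 * K / c ^ α * D ^ α = 2 * (K * (D ^ α / c ^ α)) := by ring
        rw [this]; linarith
    · have t3 := gB z hzρ hy
      have t4 := gB z' (by linarith) hy'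
      rcases le_or_gt (δ / 2) z'.1 with hz2 | hz2
      · rcases le_or_gt D 1 with hD1 | hD1
        · apply sel L (by rw [hK']; linarith)
          rw [gp z' (by linarith), gp z hz0]
          have := h3 z z' (by linarith) hzρ hy hz2 (by linarith) hy'
          rw [← hD] at this
          have hDD : D ≤ D ^ α := by
            have := rpow_le_rpow_of_exponent_ge' hD0 hD1 hα0.le hα1.le
            rwa [rpow_one] at this
          exact this.trans (mul_le_mul_of_nonneg_left hDD hL)
        · apply sel (2 * B) (by rw [hK']; linarith)
          have : 1 ≤ D ^ α := one_le_rpow hD1.le hα0.le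
          have := mul_le_mul_of_nonneg_left this hB
          linarith
      · apply sel (2 * B / (δ / 2) ^ α) (by rw [hK']; linarith)
        have t0 : (δ / 2) ^ α ≤ D ^ α := by
          apply rpow_le_rpow (by positivity) _ hα0.le
          have := (abs_le.1 hd1).1
          linarith
        have : 2 * B / (δ / 2) ^ α * D ^ α = 2 * B * (D ^ α / (δ / 2) ^ α) := by ring
        rw [this]
        have t1 : 1 ≤ D ^ α / (δ / 2) ^ α := by rwa [le_div_iff₀ (by positivity), one_mul]
        have := mul_le_mul_of_nonneg_left t1 hB
        linarith
  intro z z' hz hzρ hy hz' hzρ' hy'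
  have e : (if z'.1 ≤ 0 then b else f z') - (if z.1 ≤ 0 then b else f z) = g z' - g z := by rw [hg]
  rw [e]
  rcases le_total z'.1 z.1 with hle | hle
  · exact key z z' hz hzρ hy hz' hle hy'
  · rw [abs_sub_comm, norm_sub_rev]
    exact key z' z hz' hzρ' hy' hz hle hy

end S15
end

section
open Real Set Filter Topology
namespace S15

lemma lip {f : ℝ × ℝ → ℝ} {S : Set (ℝ × ℝ)} (hS : IsCompact S) (hc : Convex ℝ S) (hf : ∀ z ∈ S, ContDiffAt ℝ 1 f z) :
    ∃ L : ℝ, 0 ≤ L ∧ ∀ z ∈ S, |f z| ≤ L ∧ ∀ z' ∈ S, |f z' - f z| ≤ L * ‖z' - z‖ := by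
  have c1 : ContinuousOn f S := fun z hz => (hf z hz).continuousAt.continuousWithinAt
  have c2 : ContinuousOn (fderiv ℝ f) S := fun z hz =>
    ((hf z hz).fderiv_right (m := 0) (by norm_num)).continuousAt.continuousWithinAt
  obtain ⟨A, hA⟩ := hS.exists_bound_of_continuousOn c1
  obtain ⟨B, hB⟩ := hS.exists_bound_of_continuousOn c2
  refine ⟨max 0 (max A B), le_max_left _ _, fun z hz => ⟨?_, fun z' hz' => ?_⟩⟩
  · exact (hA z hz).trans ((le_max_left _ _).trans (le_max_right _ _))
  · exact hc.norm_image_sub_le_of_norm_fderiv_le (𝕜 := ℝ) (f := f)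
      (fun w hw => (hf w hw).differentiableAt (by simp))
      (fun w hw => (hB w hw).trans ((le_max_right _ _).trans (le_max_right _ _))) hz hz'

lemma comp_holder {f : ℝ × ℝ → ℝ} {b K δ c ρ R' α : ℝ} (hα : α ∈ Ioo (0:ℝ) 1) (hK : 0 ≤ K) (hδ : 0 < δ) (hc : 0 < c) (hc2 : c ≤ 1 / 2)
    (h1 : ∀ z : ℝ × ℝ, 0 < z.1 → z.1 ≤ δ → |z.2| ≤ R' → |f z - b| ≤ K * z.1 ^ α)
    (h2 : ∀ z z' : ℝ × ℝ, 0 < z.1 → z.1 ≤ δ → |z.2| ≤ R' → 0 < z'.1 → z'.1 ≤ ρ → |z'.2| ≤ R' →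
       ‖z' - z‖ ≤ c * z.1 → |f z' - f z| ≤ K * ‖z' - z‖ ^ α)
    (hf : ∀ z : ℝ × ℝ, 0 < z.1 → z.1 ≤ ρ → |z.2| ≤ R' → ContDiffAt ℝ 1 f z) :
    ∃ K' : ℝ, 0 ≤ K' ∧ ∀ z z' : ℝ × ℝ, 0 ≤ z.1 → z.1 ≤ ρ → |z.2| ≤ R' → 0 ≤ z'.1 → z'.1 ≤ ρ → |z'.2| ≤ R' →
      |(if z'.1 ≤ 0 then b else f z') - (if z.1 ≤ 0 then b else f z)| ≤ K' * ‖z' - z‖ ^ α := by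
  obtain ⟨L, hL, HL⟩ := lip (f := f) (S := Icc (δ / 2) ρ ×ˢ Icc (-R') R') (isCompact_Icc.prod isCompact_Icc)
    ((convex_Icc _ _).prod (convex_Icc _ _)) (by
      rintro z ⟨hz, hz'⟩
      exact hf z (by linarith [hz.1]) hz.2 (abs_le.2 hz'))
  refine assemble (L := L) (B := K * δ ^ α + L + |b|) hα hK hδ hc hc2 hL (by positivity) h1 h2 ?_ ?_
  · intro z z' a1 a2 a3 a4 a5 a6
    exact (HL z ⟨⟨a1, a2⟩, abs_le.1 a3⟩).2 z' ⟨⟨a4, a5⟩, abs_le.1 a6⟩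
  · intro z a1 a2 a3
    have p1 : 0 ≤ K * δ ^ α := by positivity
    rcases le_or_gt z.1 δ with hz | hz
    · have := h1 z a1 hz a3
      have q := mul_le_mul_of_nonneg_left (rpow_le_rpow a1.le hz hα.1.le) hK
      have := abs_nonneg b
      linarith
    · have := (HL z ⟨⟨by linarith, a2⟩, abs_le.1 a3⟩).1
      have := abs_sub (f z) b
      linarith

lemma scale_alg {r₁ x φ m F p q s : ℝ} (hr : r₁ ≠ 0) (hx : r₁ - r₁ * x ≠ 0) (hφ : r₁ ^ 2 - φ ≠ 0) (hm : m = (r₁ ^ 2)⁻¹) (hF : F = m * φ)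
   (h : (2 * r₁ * (r₁ * x) - φ + -((r₁ * x) ^ 2)) * p
        + (1 + ((r₁ * x) * (2 * r₁ - (r₁ * x)) - φ) / (r₁ - (r₁ * x)) ^ 2) * q
        + (r₁ + (2 * (r₁ * x) ^ 2 - 3 * r₁ * (r₁ * x) + φ) / (r₁ - (r₁ * x))) * s
        - (1 + ((r₁ * x) ^ 2 - 2 * r₁ * (r₁ * x) + φ) / (r₁ ^ 2 - φ)) * s ^ 2 = 0) :
    (2 * x - F - x ^ 2) * (m * r₁ * r₁ * p) + (1 - F) / (1 - x) ^ 2 * (m * 1 * 1 * q)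
    + (1 - 4 * x + 2 * x ^ 2 + F) / (1 - x) * (m * r₁ * s)
    - (1 - x) ^ 2 / (1 - F) * (m * r₁ * s) ^ 2 = 0 := by
  have h1 : 1 - x ≠ 0 := by
    intro h0; apply hx
    have : r₁ - r₁ * x = r₁ * (1 - x) := by ring
    rw [this, h0, mul_zero]
  have e1 : r₁ - r₁ * x = r₁ * (1 - x) := by ring
  obtain ⟨D, hD⟩ : ∃ D, D = r₁ ^ 2 - φ := ⟨_, rfl⟩
  have hφ' : φ = r₁ ^ 2 - D := by rw [hD]; ring
  have eF : F = 1 - D / r₁ ^ 2 := by rw [hF, hφ', hm]; field_simp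
  obtain ⟨X, hX⟩ : ∃ X, X = 1 - x := ⟨_, rfl⟩
  have hx' : x = 1 - X := by rw [hX]; ring
  rw [← hD] at hφ
  rw [← hX] at h1
  rw [← mul_zero m, ← h, eF, e1, ← hD, ← hX, hφ', hx', hm]
  have e2 : (1 : ℝ) - (1 - D / r₁ ^ 2) = D / r₁ ^ 2 := by ring
  rw [e2]
  field_simp
  ring

end S15
end

section
open Real Set Filter Topology
namespace S15

noncomputable def sc (r₁ : ℝ) (φ : ℝ × ℝ → ℝ) (z : ℝ × ℝ) : ℝ := (r₁ ^ 2)⁻¹ * φ (0 + r₁ * z.1, 0 + 1 * z.2)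

lemma mkNS (r₁ r R : ℝ) (hr₁ : 0 < r₁) (hr : 0 < r) (hrr₁ : r < r₁ / 4) (hR : 0 < R)
    (φ : ℝ × ℝ → ℝ)
    (hreg : ContDiffOn ℝ 2 φ (Om r R)) (hcont : ContinuousOn φ (closure (Om r R)))
    (hpos : ∀ z ∈ Om r R, 0 < φ z)
    (hzero : ∀ y : ℝ, |y| < R → φ (0, y) = 0)
    (k : ℝ) (hk : 0 < k)
    (hub : ∀ z ∈ Om r R, 0 ≤ φ z ∧ φ z ≤ (2 * r₁ - k) * z.1)
    (hpde : ∀ z ∈ Om r R,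
      (2 * r₁ * z.1 - φ z + -(z.1 ^ 2)) * pdx (pdx φ) z
        + (1 + (z.1 * (2 * r₁ - z.1) - φ z) / (r₁ - z.1) ^ 2) * pdy (pdy φ) z
        + (r₁ + (2 * z.1 ^ 2 - 3 * r₁ * z.1 + φ z) / (r₁ - z.1)) * pdx φ z
        - (1 + (z.1 ^ 2 - 2 * r₁ * z.1 + φ z) / (r₁ ^ 2 - φ z)) * (pdx φ z) ^ 2 = 0) :
    NS (sc r₁ φ) (min (r / r₁) (k / r₁)) R := by
  set a := min (r / r₁) (k / r₁) with ha
  have m0 : 0 < (r₁ ^ 2)⁻¹ := by positivity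
  have ar : ∀ x, x < a → r₁ * x < r ∧ r₁ * x < k := by
    intro x hx
    obtain ⟨h1, h2⟩ := lt_min_iff.1 hx
    rw [lt_div_iff₀ hr₁] at h1 h2
    constructor <;> linarith
  have inOm : ∀ z ∈ Om a R, (0 + r₁ * z.1, 0 + 1 * z.2) ∈ Om r R := by
    intro z hz
    have := ar z.1 hz.2.1
    refine ⟨?_, ?_, ?_⟩
    · simp only; have := mul_pos hr₁ hz.1; linarith
    · simp only; linarith
    · simp only [zero_add, one_mul]; exact hz.2.2
  have cd : ∀ z ∈ Om a R, ContDiffAt ℝ 2 φ (0 + r₁ * z.1, 0 + 1 * z.2) := fun z hz =>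
    hreg.contDiffAt ((Om_open r R).mem_nhds (inOm z hz))
  have hlt : ∀ z ∈ Om a R, sc r₁ φ z < 2 * z.1 - z.1 ^ 2 := by
    intro z hz
    have h1 := (hub _ (inOm z hz)).2
    have h2 := (ar z.1 hz.2.1).2
    simp only [sc]
    rw [inv_mul_lt_iff₀ (by positivity)]
    refine lt_of_le_of_lt h1 ?_
    simp only
    have h3 := mul_lt_mul_of_pos_right h2 (mul_pos hr₁ hz.1)
    nlinarith
  refine ⟨by positivity, ?_, hR, ?_, ?_, ?_, ?_, hlt, ?_⟩
  · refine (min_le_left _ _).trans ?_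
    rw [div_le_iff₀ hr₁]; linarith
  · intro z hz
    refine ContDiffAt.contDiffWithinAt ?_
    refine contDiffAt_const.mul ?_
    exact ContDiffAt.comp (g := φ) (f := fun z : ℝ × ℝ => (0 + r₁ * z.1, 0 + 1 * z.2)) z (cd z hz) (by fun_prop)
  · unfold sc
    refine continuousOn_const.mul ?_
    refine ContinuousOn.comp (g := φ) (f := fun z : ℝ × ℝ => (0 + r₁ * z.1, 0 + 1 * z.2)) hcont (by fun_prop) ?_
    rintro z ⟨h1, h2, h3⟩
    have h4 := (ar z.1 h2).1
    simp only [zero_add, one_mul]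
    rcases h1.eq_or_lt with h0 | h0
    · rw [← h0, mul_zero, mem_closure_iff_seq_limit]
      refine ⟨fun n => (r * (1 / ((n:ℝ) + 2)), z.2), ?_, ?_⟩
      · intro n
        refine ⟨by simp only; positivity, ?_, h3⟩
        simp only
        rw [mul_one_div, div_lt_iff₀ (by positivity)]
        have : (0:ℝ) ≤ n := by positivity
        nlinarith
      · have t1 : Tendsto (fun n : ℕ => r * (1 / ((n:ℝ) + 2))) atTop (𝓝 (r * 0)) := by
          apply Tendsto.const_mul
          apply Tendsto.const_div_atTop
          exact tendsto_atTop_add_const_right _ _ tendsto_natCast_atTop_atTop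
        rw [mul_zero] at t1
        exact t1.prodMk_nhds tendsto_const_nhds
    · apply subset_closure
      exact ⟨mul_pos hr₁ h0, h4, h3⟩
  · intro y hy
    simp only [sc, mul_zero, zero_add, one_mul]
    rw [hzero y hy, mul_zero]
  · intro z hz
    exact mul_pos m0 (hpos _ (inOm z hz))
  · intro z hz
    have e1 := (aff_pd (m := (r₁ ^ 2)⁻¹) ((cd z hz).differentiableAt (by simp))).1
    obtain ⟨e2, e3⟩ := aff_pd2 (m := (r₁ ^ 2)⁻¹) (Om_open a R) cd hz
    have hF : (fun z : ℝ × ℝ => (r₁ ^ 2)⁻¹ * φ (0 + r₁ * z.1, 0 + 1 * z.2)) = sc r₁ φ := rfl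
    rw [hF] at e1 e2 e3
    have hp := hpde _ (inOm z hz)
    rw [e1, e2, e3]
    have hx4 := (ar z.1 hz.2.1).1
    have hl := hlt z hz
    generalize hφ : φ (0 + r₁ * z.1, 0 + 1 * z.2) = f0 at hp
    have es : sc r₁ φ z = (r₁ ^ 2)⁻¹ * f0 := by rw [← hφ]; rfl
    simp only [zero_add, one_mul] at hp ⊢
    have hne : r₁ ^ 2 - f0 ≠ 0 := by
      rw [es, inv_mul_lt_iff₀ (by positivity)] at hl
      have : 2 * z.1 - z.1 ^ 2 ≤ 1 := by nlinarith [sq_nonneg (z.1 - 1)]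
      have := mul_le_mul_of_nonneg_left this (by positivity : 0 ≤ r₁ ^ 2)
      linarith
    have := scale_alg hr₁.ne' (by linarith) hne rfl es hp
    simpa only [one_mul, mul_one] using this

lemma holder_of {f1 f2 : ℝ × ℝ → ℝ} {S : Set (ℝ × ℝ)} {K1 K2 α : ℝ} (hα : 0 < α) (h1 : 0 ≤ K1) (h2 : 0 ≤ K2)
    (H1 : ∀ z ∈ S, ∀ z' ∈ S, |f1 z - f1 z'| ≤ K1 * ‖z - z'‖ ^ α)
    (H2 : ∀ z ∈ S, ∀ z' ∈ S, |f2 z - f2 z'| ≤ K2 * ‖z - z'‖ ^ α) :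
    HolderOnWith (Real.toNNReal (K1 + K2)) (Real.toNNReal α) (fun z => (f1 z, f2 z)) S := by
  intro z hz z' hz'
  have hn : 0 ≤ ‖z - z'‖ ^ α := by positivity
  have hd : dist (f1 z, f2 z) (f1 z', f2 z') ≤ (K1 + K2) * ‖z - z'‖ ^ α := by
    have := H1 z hz z' hz'
    have := H2 z hz z' hz'
    have := mul_nonneg h1 hn
    have := mul_nonneg h2 hn
    rw [Prod.dist_eq, max_le_iff]
    simp only [Real.dist_eq]
    constructor <;> linarith
  rw [edist_dist, edist_dist, Real.coe_toNNReal α hα.le, ENNReal.ofReal_rpow_of_nonneg dist_nonneg hα.le]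
  rw [dist_eq_norm z z']
  change _ ≤ ENNReal.ofReal (K1 + K2) * _
  rw [← ENNReal.ofReal_mul (by positivity)]
  exact ENNReal.ofReal_le_ofReal hd

lemma main (r₁ r R : ℝ) (hr₁ : 0 < r₁) (hr : 0 < r) (hR : 0 < R) (φ : ℝ × ℝ → ℝ)
    (hreg : ContDiffOn ℝ 2 φ (Om r R)) (a : ℝ) (hns : NS (sc r₁ φ) a R) (har : r₁ * a ≤ r)
    (α : ℝ) (hα : α ∈ Ioo (0:ℝ) 1) :
    ∃ (C : NNReal) (g : ℝ × ℝ → ℝ × ℝ),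
        HolderOnWith C (Real.toNNReal α) g
          (closure {z : ℝ × ℝ | 0 < z.1 ∧ z.1 < r / 2 ∧ |z.2| < R / 2}) ∧
        (∀ z : ℝ × ℝ, 0 < z.1 → z.1 < r / 2 → |z.2| < R / 2 →
          g z = (pdx φ z, pdy φ z)) ∧
        (∀ y : ℝ, |y| < R / 2 → g (0, y) = (r₁, 0)) := by
  obtain ⟨K, δ, c, hK, hδ, hδa, hc, hc2, H⟩ := hns.Fest (R' := R / 2) (by linarith) hα
  have cd : ∀ z : ℝ × ℝ, 0 < z.1 → z.1 ≤ r / 2 → |z.2| ≤ R / 2 → ContDiffAt ℝ 2 φ z := fun z h1 h2 h3 =>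
    hreg.contDiffAt ((Om_open r R).mem_nhds ⟨h1, by linarith, by linarith⟩)
  have rel : ∀ z : ℝ × ℝ, 0 < z.1 → z.1 < r → |z.2| ≤ R / 2 → pdx φ z = r₁ * pdx (sc r₁ φ) (z.1 / r₁, z.2) ∧
      pdy φ z = r₁ ^ 2 * pdy (sc r₁ φ) (z.1 / r₁, z.2) := by
    intro z h1 h2 h3
    have hz : ContDiffAt ℝ 2 φ z := hreg.contDiffAt ((Om_open r R).mem_nhds ⟨h1, h2, by linarith⟩)
    have ez : (0 + r₁ * ((z.1 / r₁, z.2) : ℝ × ℝ).1, 0 + 1 * ((z.1 / r₁, z.2) : ℝ × ℝ).2) = z := by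
      ext
      · simp only; field_simp; ring
      · simp
    obtain ⟨e1, e2⟩ := aff_pd (W := φ) (x₀ := 0) (y₀ := 0) (A := r₁) (B := 1) (z := (z.1 / r₁, z.2)) (m := (r₁ ^ 2)⁻¹)
      (by rw [ez]; exact hz.differentiableAt (by simp))
    have hF : (fun z : ℝ × ℝ => (r₁ ^ 2)⁻¹ * φ (0 + r₁ * z.1, 0 + 1 * z.2)) = sc r₁ φ := rfl
    rw [hF, ez] at e1 e2
    rw [e1, e2]
    constructor <;> field_simp
  have hα0 := hα.1
  have s0 : 0 < 1 + 1 / r₁ := by positivity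
  have sn : ∀ z z' : ℝ × ℝ, ‖((z'.1 / r₁, z'.2) : ℝ × ℝ) - (z.1 / r₁, z.2)‖ ≤ (1 + 1 / r₁) * ‖z' - z‖ := by
    intro z z'
    have n1 : |z'.1 - z.1| ≤ ‖z' - z‖ := norm_fst_le (z' - z)
    have n2 : |z'.2 - z.2| ≤ ‖z' - z‖ := norm_snd_le (z' - z)
    have n0 := norm_nonneg (z' - z)
    have p0 : 0 ≤ 1 / r₁ * ‖z' - z‖ := by positivity
    rw [Prod.norm_def, max_le_iff]
    simp only [Prod.fst_sub, Prod.snd_sub, norm_eq_abs]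
    constructor
    · rw [← sub_div, abs_div, abs_of_pos hr₁]
      have := mul_le_mul_of_nonneg_left n1 (by positivity : 0 ≤ 1 / r₁)
      rw [one_div_mul_eq_div] at this
      linarith
    · linarith
  have hsr : c / (r₁ + 1) ≤ 1 / 2 := (div_le_self hc.le (by linarith)).trans hc2
  have scl : ∀ z z' : ℝ × ℝ, 0 < z.1 → ‖z' - z‖ ≤ c / (r₁ + 1) * z.1 →
      ‖((z'.1 / r₁, z'.2) : ℝ × ℝ) - (z.1 / r₁, z.2)‖ ≤ c * (z.1 / r₁) := by
    intro z z' hz h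
    refine (sn z z').trans ((mul_le_mul_of_nonneg_left h s0.le).trans (le_of_eq ?_))
    field_simp
  have pw : ∀ z z' : ℝ × ℝ, ‖((z'.1 / r₁, z'.2) : ℝ × ℝ) - (z.1 / r₁, z.2)‖ ^ α ≤ (1 + 1 / r₁) ^ α * ‖z' - z‖ ^ α := by
    intro z z'
    rw [← mul_rpow s0.le (norm_nonneg _)]
    exact rpow_le_rpow (norm_nonneg _) (sn z z') hα0.le
  have px : ∀ x : ℝ, 0 < x → (x / r₁) ^ α ≤ (1 + 1 / r₁) ^ α * x ^ α := by
    intro x hx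
    rw [← mul_rpow s0.le hx.le]
    refine rpow_le_rpow (by positivity) ?_ hα0.le
    have : (1 + 1 / r₁) * x = x + x / r₁ := by ring
    linarith
  have dl : ∀ x : ℝ, x ≤ r₁ * δ → x / r₁ ≤ δ ∧ x < r := by
    intro x hx
    constructor
    · rw [div_le_iff₀ hr₁]; linarith
    · have := mul_lt_mul_of_pos_left (by linarith : δ < a) hr₁
      linarith
  have S0 : 0 < (1 + 1 / r₁) ^ α := by positivity
  obtain ⟨K1, hK1, H1⟩ := comp_holder (f := pdx φ) (b := r₁) (K := r₁ * (K * (1 + 1 / r₁) ^ α)) (δ := r₁ * δ) (c := c / (r₁ + 1))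
    (ρ := r / 2) (R' := R / 2) hα (by positivity) (by positivity) (by positivity) hsr
    (by
      intro z h1 h2 h3
      obtain ⟨d1, d2⟩ := dl _ h2
      rw [(rel z h1 d2 h3).1]
      have := (H (z.1 / r₁) z.2 (by positivity) d1 h3).1
      have e : r₁ * pdx (sc r₁ φ) (z.1 / r₁, z.2) - r₁ = r₁ * (pdx (sc r₁ φ) (z.1 / r₁, z.2) - 1) := by ring
      rw [e, abs_mul, abs_of_pos hr₁, mul_assoc r₁, mul_assoc K]
      refine mul_le_mul_of_nonneg_left (this.trans ?_) hr₁.le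
      exact mul_le_mul_of_nonneg_left (px _ h1) hK.le)
    (by
      intro z z' h1 h2 h3 h4 h5 h6 h7
      obtain ⟨d1, d2⟩ := dl _ h2
      rw [(rel z h1 d2 h3).1, (rel z' h4 (by linarith) h6).1]
      have := ((H (z.1 / r₁) z.2 (by positivity) d1 h3).2.2 _ (scl z z' h1 h7)).1
      rw [← mul_sub, abs_mul, abs_of_pos hr₁, mul_assoc r₁, mul_assoc K]
      refine mul_le_mul_of_nonneg_left (this.trans ?_) hr₁.le
      exact mul_le_mul_of_nonneg_left (pw _ _) hK.le)
    (fun z h1 h2 h3 => pdx_cdAt (cd z h1 h2 h3))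
  have q0 : 0 < r₁ ^ 2 := by positivity
  obtain ⟨K2, hK2, H2⟩ := comp_holder (f := pdy φ) (b := 0) (K := r₁ ^ 2 * (K * (1 + 1 / r₁) ^ α)) (δ := r₁ * δ) (c := c / (r₁ + 1))
    (ρ := r / 2) (R' := R / 2) hα (by positivity) (by positivity) (by positivity) hsr
    (by
      intro z h1 h2 h3
      obtain ⟨d1, d2⟩ := dl _ h2
      rw [(rel z h1 d2 h3).2]
      have := (H (z.1 / r₁) z.2 (by positivity) d1 h3).2.1
      rw [sub_zero, abs_mul, abs_of_pos q0, mul_assoc (r₁ ^ 2), mul_assoc K]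
      refine mul_le_mul_of_nonneg_left (this.trans ?_) q0.le
      exact mul_le_mul_of_nonneg_left (px _ h1) hK.le)
    (by
      intro z z' h1 h2 h3 h4 h5 h6 h7
      obtain ⟨d1, d2⟩ := dl _ h2
      rw [(rel z h1 d2 h3).2, (rel z' h4 (by linarith) h6).2]
      have := ((H (z.1 / r₁) z.2 (by positivity) d1 h3).2.2 _ (scl z z' h1 h7)).2
      rw [← mul_sub, abs_mul, abs_of_pos q0, mul_assoc (r₁ ^ 2), mul_assoc K]
      refine mul_le_mul_of_nonneg_left (this.trans ?_) q0.le
      exact mul_le_mul_of_nonneg_left (pw _ _) hK.le)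
    (fun z h1 h2 h3 => pdy_cdAt (cd z h1 h2 h3))
  have cl : closure {z : ℝ × ℝ | 0 < z.1 ∧ z.1 < r / 2 ∧ |z.2| < R / 2} ⊆ {z | 0 ≤ z.1 ∧ z.1 ≤ r / 2 ∧ |z.2| ≤ R / 2} := by
    apply closure_minimal
    · rintro z ⟨h1, h2, h3⟩; exact ⟨h1.le, h2.le, h3.le⟩
    · apply IsClosed.inter (isClosed_le continuous_const continuous_fst)
      exact IsClosed.inter (isClosed_le continuous_fst continuous_const)
        (isClosed_le (continuous_snd.abs) continuous_const)
  refine ⟨_, _, holder_of hα0 hK1 hK2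
    (f1 := fun z : ℝ × ℝ => if z.1 ≤ 0 then r₁ else pdx φ z) (f2 := fun z : ℝ × ℝ => if z.1 ≤ 0 then 0 else pdy φ z) ?_ ?_, ?_, ?_⟩
  · intro z hz z' hz'
    obtain ⟨a1, a2, a3⟩ := cl hz
    obtain ⟨b1, b2, b3⟩ := cl hz'
    exact H1 z' z b1 b2 b3 a1 a2 a3
  · intro z hz z' hz'
    obtain ⟨a1, a2, a3⟩ := cl hz
    obtain ⟨b1, b2, b3⟩ := cl hz'
    exact H2 z' z b1 b2 b3 a1 a2 a3
  · intro z h1 h2 h3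
    simp [not_le.2 h1]
  · intro y hy
    simp

end S15
end

/-- `C^{1,α}` regularity up to the degenerate sonic boundary for solutions of
the degenerate elliptic equation satisfied by `φ = p₁ − p` in the flattened
coordinates `(x, y)`: the gradient of `φ` extends Hölder-continuously to the
closure of `Q⁺_{r/2,R/2}`, with `φ_x(0,y) = r₁` and `φ_y(0,y) = 0`. -/
theorem stmt15
    (r₁ r R : ℝ) (hr₁ : 0 < r₁) (hr : 0 < r) (hrr₁ : r < r₁ / 4) (hR : 0 < R)
    (Q : Set (ℝ × ℝ)) (hQ : Q = {z : ℝ × ℝ | 0 < z.1 ∧ z.1 < r ∧ |z.2| < R})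
    (φ : ℝ × ℝ → ℝ)
    (hreg : ContDiffOn ℝ 2 φ Q) (hcont : ContinuousOn φ (closure Q))
    (hpos : ∀ z ∈ Q, 0 < φ z)
    (hzero : ∀ y : ℝ, |y| < R → φ (0, y) = 0)
    (k : ℝ) (hk : 0 < k)
    (hub : ∀ z ∈ Q, 0 ≤ φ z ∧ φ z ≤ (2 * r₁ - k) * z.1)
    (hinf : ∃ c > 0, ∀ z ∈ Q, r / 2 < z.1 → c ≤ φ z)
    (hpde : ∀ z ∈ Q,
      (2 * r₁ * z.1 - φ z + -(z.1 ^ 2)) * pdx (pdx φ) z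
        + (1 + (z.1 * (2 * r₁ - z.1) - φ z) / (r₁ - z.1) ^ 2) * pdy (pdy φ) z
        + (r₁ + (2 * z.1 ^ 2 - 3 * r₁ * z.1 + φ z) / (r₁ - z.1)) * pdx φ z
        - (1 + (z.1 ^ 2 - 2 * r₁ * z.1 + φ z) / (r₁ ^ 2 - φ z)) * (pdx φ z) ^ 2 = 0) :
    ∀ α : ℝ, α ∈ Set.Ioo (0 : ℝ) 1 →
      ∃ (C : NNReal) (g : ℝ × ℝ → ℝ × ℝ),
        HolderOnWith C (Real.toNNReal α) g
          (closure {z : ℝ × ℝ | 0 < z.1 ∧ z.1 < r / 2 ∧ |z.2| < R / 2}) ∧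
        (∀ z : ℝ × ℝ, 0 < z.1 → z.1 < r / 2 → |z.2| < R / 2 →
          g z = (pdx φ z, pdy φ z)) ∧
        (∀ y : ℝ, |y| < R / 2 → g (0, y) = (r₁, 0)) := by
  intro α hα
  subst hQ
  have h := S15.mkNS r₁ r R hr₁ hr hrr₁ hR φ hreg hcont hpos hzero k hk hub hpde
  refine S15.main r₁ r R hr₁ hr hR φ hreg _ h ?_ α hα
  have := mul_le_mul_of_nonneg_left (min_le_left (r / r₁) (k / r₁)) hr₁.le
  rwa [mul_div_cancel₀ r hr₁.ne'] at this
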